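/- arXiv:0909.0219 — 2 statements merged into one kernel-verified Lean document; each statement's English description precedes it below -/
import Mathlib

section
/- Let 0 < r₁ ≤ r₃ < r₄ ≤ r₂ and T > 0 be real numbers. Let u ∈ C¹((r₁,r₂)×[0,T)) be a classical solution of the radial equation u_t = (φ'(u_r))_r + φ'(u_r)/r on (r₁,r₂)×[0,T), and assume |u_r(r,0)| < 1 for all r ∈ (r₃,r₄). Set k₀ := r₂⁻¹·√(2·φ'(1)·|φ'''(1)|) and 𝒟 := {(r,t) ∈ (r₁,r₂)×[0,T) : r₃ − k₀t < r < r₄ + k₀t}. Then |u_r(r,t)| < 1 for every (r,t) ∈ 𝒟. -/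
section

open Set Filter Topology

/-- A function with negative derivative at `y` is below its value at `y` just to the right. -/
theorem eventually_lt_right_of_hasDerivAt_neg {h : ℝ → ℝ} {h' y : ℝ} (hd : HasDerivAt h h' y)
    (hneg : h' < 0) : ∀ᶠ x in 𝓝[>] y, h x < h y := by
  have h1 := (hasDerivAt_iff_tendsto_slope.1 hd).mono_left
    (nhdsWithin_mono y (fun x (hx : y < x) => hx.ne'))
  filter_upwards [h1.eventually_lt_const hneg, self_mem_nhdsWithin] with x hx hxy
  rw [slope_def_field] at hx
  have hxy' : 0 < x - y := sub_pos.2 hxy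
  have := (div_lt_iff₀ hxy').1 hx
  linarith

theorem eventually_lt_left_of_hasDerivAt_pos {h : ℝ → ℝ} {h' y : ℝ} (hd : HasDerivAt h h' y)
    (hpos : 0 < h') : ∀ᶠ x in 𝓝[<] y, h x < h y := by
  have h1 := (hasDerivAt_iff_tendsto_slope.1 hd).mono_left
    (nhdsWithin_mono y (fun x (hx : x < y) => hx.ne))
  filter_upwards [h1.eventually_const_lt hpos, self_mem_nhdsWithin] with x hx hxy
  rw [slope_def_field] at hx
  have hxy' : x - y < 0 := sub_neg.2 hxy
  have := (lt_div_iff_of_neg hxy').1 hx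
  linarith

theorem HasDerivAt.nonneg_of_right_min {h : ℝ → ℝ} {h' y : ℝ} (hd : HasDerivAt h h' y)
    (hmin : ∃ᶠ x in 𝓝[>] y, h y ≤ h x) : 0 ≤ h' := by
  by_contra! hneg
  obtain ⟨x, hx, hx'⟩ :=
    (hmin.and_eventually (eventually_lt_right_of_hasDerivAt_neg hd hneg)).exists
  linarith

theorem HasDerivAt.nonpos_of_left_min {h : ℝ → ℝ} {h' y : ℝ} (hd : HasDerivAt h h' y)
    (hmin : ∃ᶠ x in 𝓝[<] y, h y ≤ h x) : h' ≤ 0 := by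
  by_contra! hneg
  obtain ⟨x, hx, hx'⟩ :=
    (hmin.and_eventually (eventually_lt_left_of_hasDerivAt_pos hd hneg)).exists
  linarith

/-- Second order condition at a minimum of a primitive of `v - z`, for `ψ ∘ v` and `ψ ∘ z`. -/
theorem deriv_comp_le_of_right_min {ψ v z a : ℝ → ℝ} {y w' ζ' : ℝ}
    (hψ : StrictMonoOn ψ (Ioo 0 1)) (ha : ∀ᶠ x in 𝓝 y, HasDerivAt a (v x - z x) x)
    (hv : ContinuousAt v y) (hz : ContinuousAt z y) (hvz : v y = z y) (hzy : z y ∈ Ioo (0 : ℝ) 1)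
    (hw : HasDerivAt (fun x => ψ (v x)) w' y) (hζ : HasDerivAt (fun x => ψ (z x)) ζ' y)
    (hmin : ∀ᶠ x in 𝓝[>] y, a y ≤ a x) : ζ' ≤ w' := by
  by_contra! hlt
  have h1 := eventually_lt_right_of_hasDerivAt_neg (hw.sub hζ) (sub_neg.2 hlt)
  have h2 : ∀ᶠ x in 𝓝 y, v x ∈ Ioo (0 : ℝ) 1 := hv (by rw [hvz]; exact Ioo_mem_nhds hzy.1 hzy.2)
  have h3 : ∀ᶠ x in 𝓝 y, z x ∈ Ioo (0 : ℝ) 1 := hz (Ioo_mem_nhds hzy.1 hzy.2)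
  have h4 : ∀ᶠ x in 𝓝[>] y, v x < z x ∧ HasDerivAt a (v x - z x) x ∧ a y ≤ a x := by
    filter_upwards [h1, nhdsWithin_le_nhds h2, nhdsWithin_le_nhds h3, nhdsWithin_le_nhds ha, hmin]
      with x hx hvx hzx hax hmx
    refine ⟨(hψ.lt_iff_lt hvx hzx).1 ?_, hax, hmx⟩
    simp only [Pi.sub_apply, hvz, sub_self] at hx
    linarith
  obtain ⟨d, hd, hd'⟩ := mem_nhdsGT_iff_exists_Ioc_subset.1 h4
  have hyd : y < d := hd
  have hcont : ContinuousOn a (Icc y d) := fun x hx => by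
    rcases hx.1.eq_or_lt with rfl | hx1
    · exact ha.self_of_nhds.continuousAt.continuousWithinAt
    · exact (hd' ⟨hx1, hx.2⟩).2.1.continuousAt.continuousWithinAt
  obtain ⟨x, hx, hx'⟩ := exists_hasDerivAt_eq_slope a (fun x => v x - z x) hyd hcont
    (fun x hx => (hd' ⟨hx.1, hx.2.le⟩).2.1)
  have h5 : v x < z x := (hd' ⟨hx.1, hx.2.le⟩).1
  have h6 := (hd' ⟨hyd, le_rfl⟩).2.2
  have h7 : 0 ≤ (a d - a y) / (d - y) := div_nonneg (by linarith) (by linarith)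
  linarith

theorem le_deriv_comp_of_left_max {ψ v z a : ℝ → ℝ} {y w' ζ' : ℝ}
    (hψ : StrictMonoOn ψ (Ioo 0 1)) (ha : ∀ᶠ x in 𝓝 y, HasDerivAt a (v x - z x) x)
    (hv : ContinuousAt v y) (hz : ContinuousAt z y) (hvz : v y = z y) (hzy : z y ∈ Ioo (0 : ℝ) 1)
    (hw : HasDerivAt (fun x => ψ (v x)) w' y) (hζ : HasDerivAt (fun x => ψ (z x)) ζ' y)
    (hmax : ∀ᶠ x in 𝓝[<] y, a x ≤ a y) : w' ≤ ζ' := by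
  have hneg : Tendsto (fun x : ℝ => -x) (𝓝 (-y)) (𝓝 y) := by
    simpa using (continuous_neg (G := ℝ)).tendsto (-y)
  have key : ∀ {h : ℝ → ℝ} {h' x : ℝ}, HasDerivAt h h' (-x) →
      HasDerivAt (fun x => h (-x)) (-h') x := fun {h h' x} hh => by
    simpa [Function.comp_def] using hh.comp x (hasDerivAt_neg x)
  have := deriv_comp_le_of_right_min (ψ := ψ) (v := fun x => v (-x)) (z := fun x => z (-x))
    (a := fun x => -a (-x)) (y := -y) (w' := -w') (ζ' := -ζ') hψ
    ?_ ?_ ?_ (by simpa using hvz) (by simpa using hzy)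
    (key (h := fun x => ψ (v x)) (by simpa using hw))
    (key (h := fun x => ψ (z x)) (by simpa using hζ)) ?_
  · linarith
  · filter_upwards [hneg.eventually ha] with x hx
    simpa using (key hx).fun_neg
  · exact ContinuousAt.comp (f := fun x : ℝ => -x) (by simpa using hv) continuous_neg.continuousAt
  · exact ContinuousAt.comp (f := fun x : ℝ => -x) (by simpa using hz) continuous_neg.continuousAt
  · have h2 : Tendsto (fun x : ℝ => -x) (𝓝[>] (-y)) (𝓝[<] y) := by
      simpa using tendsto_neg_nhdsGT (a := -y)
    filter_upwards [h2.eventually hmax] with x hx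
    simpa using hx

/-- If `P` is negative somewhere on the compact set `K` at times approaching `t₀` from the left,
then in the limit `P ≤ 0` at a point of `K`, and if moreover `P ≥ 0` on `K` at time `t₀`,
then the time derivative is nonnegative there. -/
theorem exists_limit_contact {K : Set ℝ} (hK : IsCompact K) {s t₀ : ℝ} (hst : s < t₀)
    {P Pt : ℝ → ℝ → ℝ}
    (hP : ContinuousOn (fun p : ℝ × ℝ => P p.1 p.2) (K ×ˢ Icc s t₀))
    (hPt : ContinuousOn (fun p : ℝ × ℝ => Pt p.1 p.2) (K ×ˢ Icc s t₀))
    (hd : ∀ x ∈ K, ∀ t ∈ Ioo s t₀, HasDerivAt (P x) (Pt x t) t)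
    (hneg : ∃ᶠ t in 𝓝[<] t₀, ∃ x ∈ K, P x t < 0) :
    ∃ x ∈ K, P x t₀ ≤ 0 ∧ ((∀ x ∈ K, 0 ≤ P x t₀) → 0 ≤ Pt x t₀) := by
  obtain ⟨τ, hτ, hτ'⟩ := exists_seq_forall_of_frequently
    (hneg.and_eventually (Ioo_mem_nhdsLT hst))
  have hτ0 : Tendsto τ atTop (𝓝 t₀) := hτ.mono_right nhdsWithin_le_nhds
  choose x hxK hxP using fun n => (hτ' n).1
  have hτI : ∀ n, τ n ∈ Ioo s t₀ := fun n => (hτ' n).2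
  obtain ⟨x₀, hx₀, θ, hθ, hlim⟩ := hK.tendsto_subseq hxK
  have hτθ : Tendsto (τ ∘ θ) atTop (𝓝 t₀) := hτ0.comp hθ.tendsto_atTop
  have hmem : (x₀, t₀) ∈ K ×ˢ Icc s t₀ := ⟨hx₀, hst.le, le_rfl⟩
  have key : ∀ σ : ℕ → ℝ, (∀ n, σ n ∈ Icc s t₀) → Tendsto σ atTop (𝓝 t₀) →
      Tendsto (fun n => (x (θ n), σ n)) atTop (𝓝[K ×ˢ Icc s t₀] (x₀, t₀)) := fun σ h1 h2 =>
    tendsto_nhdsWithin_iff.2 ⟨hlim.prodMk_nhds h2, Eventually.of_forall fun n => ⟨hxK _, h1 n⟩⟩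
  refine ⟨x₀, hx₀, ?_, fun hall => ?_⟩
  · refine le_of_tendsto ((hP _ hmem).tendsto.comp
      (key (τ ∘ θ) (fun n => ⟨(hτI _).1.le, (hτI _).2.le⟩) hτθ)) (Eventually.of_forall fun n => ?_)
    exact (hxP (θ n)).le
  · have hmvt : ∀ n, ∃ σ ∈ Ioo (τ n) t₀, 0 ≤ Pt (x n) σ := fun n => by
      obtain ⟨σ, hσ, hσ'⟩ := exists_hasDerivAt_eq_slope (P (x n)) (Pt (x n)) (hτI n).2
        ((hP.comp (f := fun t => (x n, t)) (by fun_prop)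
          (fun t ht => ⟨hxK n, (hτI n).1.le.trans ht.1, ht.2⟩)))
        (fun t ht => hd _ (hxK n) t ⟨(hτI n).1.trans ht.1, ht.2⟩)
      refine ⟨σ, hσ, ?_⟩
      rw [hσ']
      have := hxP n
      have := hall _ (hxK n)
      exact div_nonneg (by linarith) (by linarith [(hτI n).2])
    choose σ hσ hσ' using hmvt
    have hσlim : Tendsto (σ ∘ θ) atTop (𝓝 t₀) :=
      tendsto_of_tendsto_of_tendsto_of_le_of_le hτθ tendsto_const_nhds
        (fun n => (hσ _).1.le) (fun n => (hσ _).2.le)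
    refine ge_of_tendsto ((hPt _ hmem).tendsto.comp
      (key (σ ∘ θ) (fun n => ⟨((hτI _).1.trans (hσ _).1).le, (hσ _).2.le⟩) hσlim))
      (Eventually.of_forall fun n => ?_)
    exact hσ' (θ n)

/-- A primitive `F` of a barrier profile `f` vanishing on the negative axis. -/
structure IsProfile (F f f' : ℝ → ℝ) : Prop where
  prim : ∀ ξ, HasDerivAt F (f ξ) ξ
  prim_zero : ∀ ξ ≤ 0, F ξ = 0
  zero : ∀ ξ ≤ 0, f ξ = 0
  pos : ∀ ξ, 0 < ξ → 0 < f ξ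
  cont : Continuous f
  deriv : ∀ ξ, 0 < ξ → HasDerivAt f (f' ξ) ξ

theorem IsProfile.strictMonoOn {F f f' : ℝ → ℝ} (h : IsProfile F f f') :
    StrictMonoOn F (Ici 0) := by
  refine strictMonoOn_of_deriv_pos (convex_Ici 0)
    (fun x _ => (h.prim x).continuousAt.continuousWithinAt) fun x hx => ?_
  rw [interior_Ici] at hx
  rw [(h.prim x).deriv]
  exact h.pos x hx

theorem IsProfile.prim_pos {F f f' : ℝ → ℝ} (h : IsProfile F f f') {ξ : ℝ} (hξ : 0 < ξ) :
    0 < F ξ := by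
  have := h.strictMonoOn (mem_Ici.2 le_rfl) (mem_Ici.2 hξ.le) hξ
  rwa [h.prim_zero 0 le_rfl] at this

theorem IsProfile.prim_nonneg {F f f' : ℝ → ℝ} (h : IsProfile F f f') (ξ : ℝ) : 0 ≤ F ξ := by
  rcases le_or_gt ξ 0 with h0 | h0
  · exact (h.prim_zero ξ h0).ge
  · exact (h.prim_pos h0).le

/-- The operator `(ψ(z))_r + ψ(z)/r - z_t`, up to sign of the last term, evaluated on
`z(r,t) = 1 - f(q(t) - r)` with `q' = k`. -/
noncomputable def barrierDefect (ψ ψ' f f' : ℝ → ℝ) (k q r : ℝ) : ℝ :=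
  ψ' (1 - f (q - r)) * f' (q - r) + ψ (1 - f (q - r)) / r - k * f (q - r)

/-- There is no first violating pair `(y₀, x₀)` at the time slice under consideration. -/
theorem no_first_violation {ψ ψ' F f f' U V W : ℝ → ℝ} {l R ρ b q k σ η e : ℝ}
    (hψd : ∀ s, HasDerivAt ψ (ψ' s) s) (hψ : StrictMonoOn ψ (Ioo 0 1)) (hψmax : IsLocalMax ψ 1)
    (hf : IsProfile F f f')
    (hU : ∀ r ∈ Ioo l R, HasDerivAt U (V r) r) (hV : ∀ r ∈ Ioo l R, ContinuousAt V r)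
    (hW : ∀ r ∈ Ioo l R, HasDerivAt (fun x => ψ (V x)) (W r - ψ (V r) / r) r)
    (hlρ : l < ρ) (hbR : b < R) (hqb : q < b) (hη : 0 < η) (he : 0 < e)
    (hf1 : ∀ r ∈ Icc ρ b, f (q - r) < 1)
    (hzone : ∀ y x, ρ ≤ y → y < x → x ≤ b → y < q → q - σ < x →
      ψ 1 / x ≤ barrierDefect ψ ψ' f f' k q y)
    (hmono : ∀ y x, ρ ≤ y → y < x → x ≤ b → x < q →
      barrierDefect ψ ψ' f f' k q x ≤ barrierDefect ψ ψ' f f' k q y)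
    (hsub : ∀ r ∈ Icc ρ b, r ≤ q - σ → V r < 1) (hVρ : V ρ < 1 - f (q - ρ))
    (hlim : ∀ y x, ρ ≤ y → y ≤ x → x ≤ b →
      (U x - x - F (q - x) ≤ U y - y - F (q - y) + e ∧
        (U y - y - F (q - y) + e ≤ U x - x - F (q - x) →
          W y - k * f (q - y) + η ≤ W x - k * f (q - x))) ∨
      ∃ c ∈ Icc y x, U c - c ≤ U y - y - F (q - y) + e ∧
        ((∀ c ∈ Icc y x, U y - y - F (q - y) + e ≤ U c - c) →
          W y - k * f (q - y) + η ≤ W c))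
    {y₀ x₀ : ℝ} (hρy : ρ ≤ y₀) (hyx : y₀ ≤ x₀) (hxb : x₀ ≤ b)
    (hax : U y₀ - y₀ - F (q - y₀) + e ≤ U x₀ - x₀ - F (q - x₀))
    (hgx : ∀ c ∈ Icc y₀ x₀, U y₀ - y₀ - F (q - y₀) + e ≤ U c - c) : False := by
  obtain ⟨g, hg⟩ : ∃ g : ℝ → ℝ, ∀ r, g r = U r - r := ⟨_, fun _ => rfl⟩
  obtain ⟨a, ha⟩ : ∃ a : ℝ → ℝ, ∀ r, a r = g r - F (q - r) := ⟨_, fun _ => rfl⟩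
  simp only [← hg, ← ha] at hlim hax hgx
  have hgd : ∀ r ∈ Ioo l R, HasDerivAt g (V r - 1) r := fun r hr => by
    rw [show g = fun r => U r - r from funext hg]
    exact (hU r hr).sub (hasDerivAt_id' r)
  have had : ∀ r ∈ Ioo l R, HasDerivAt a (V r - (1 - f (q - r))) r := fun r hr => by
    rw [show a = fun r => g r - F (q - r) from funext ha]
    exact ((hgd r hr).sub ((hf.prim (q - r)).comp r
      ((hasDerivAt_id' r).const_sub q))).congr_deriv (by ring)
  have hI : ∀ {r}, ρ ≤ r → r ≤ b → r ∈ Ioo l R := fun h1 h2 => ⟨by linarith, by linarith⟩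
  have hag : ∀ r, a r ≤ g r := fun r => by rw [ha]; linarith [hf.prim_nonneg (q - r)]
  have hstrict : ∀ y x, ρ ≤ y → y ≤ x → x ≤ b → a y + e < a x →
      (∀ c ∈ Icc y x, a y + e < g c) → False := fun y x h1 h2 h3 h4 h5 => by
    rcases hlim y x h1 h2 h3 with h | ⟨c, hc, h, -⟩
    · linarith [h.1]
    · linarith [h5 c hc]
  have hcontact : ∀ x ∈ Ioo l R, V x = 1 → W x = ψ 1 / x := fun x hx hVx => by
    have h1 : IsLocalMax (fun x => ψ (V x)) x := by
      have : ∀ᶠ y in 𝓝 (V x), ψ y ≤ ψ (V x) := by rw [hVx]; exact hψmax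
      exact (hV x hx).eventually this
    have := h1.hasDerivAt_eq_zero (hW x hx)
    rw [hVx] at this
    linarith
  have hyx' : y₀ < x₀ := hyx.lt_of_ne fun h => by rw [h] at hax; linarith
  have hyI := hI hρy (hyx.trans hxb)
  have hgy := hgx y₀ ⟨le_rfl, hyx⟩
  have hξ : 0 < q - y₀ := by
    by_contra! h
    have := ha y₀
    rw [hf.prim_zero _ h] at this
    linarith
  have hYpos := hf.pos _ hξ
  have hminR : ∀ᶠ x in 𝓝[>] y₀, a y₀ ≤ a x := by
    filter_upwards [Ioc_mem_nhdsGT hyx'] with y hy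
    by_contra! hlt
    exact hstrict y x₀ (hρy.trans hy.1.le) hy.2 hxb (by linarith) fun c hc => by
      linarith [hgx c ⟨hy.1.le.trans hc.1, hc.2⟩]
  have hVy_ge := (had y₀ hyI).nonneg_of_right_min hminR.frequently
  have hρy' : ρ < y₀ := hρy.lt_of_ne fun h => by subst h; linarith
  have hgy' : a y₀ + e < g y₀ := by
    refine hgy.lt_of_ne fun heq => ?_
    have hFe : F (q - y₀) = e := by linarith [ha y₀]
    obtain ⟨y₁, hy₁, hmin⟩ := isCompact_Icc.exists_isMinOn (nonempty_Icc.2 hρy)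
      (fun x hx => (hgd x (hI hx.1 (hx.2.trans (hyx.trans hxb)))).continuousAt.continuousWithinAt)
    rw [isMinOn_iff] at hmin
    rcases hy₁.2.lt_or_eq with hlt | rfl
    · have h1 : F (q - y₀) < F (q - y₁) :=
        hf.strictMonoOn (mem_Ici.2 hξ.le) (mem_Ici.2 (by linarith)) (by linarith)
      have h2 := hmin y₀ ⟨hρy, le_rfl⟩
      have h3 : a y₁ + e < g y₁ := by rw [ha]; linarith
      refine hstrict y₁ x₀ hy₁.1 (hy₁.2.trans hyx) hxb (by linarith) fun c hc => ?_
      rcases le_total c y₀ with h | h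
      · linarith [hmin c ⟨hy₁.1.trans hc.1, h⟩]
      · linarith [hgx c ⟨h, hc.2⟩]
    · have h1 : 0 ≤ V y₁ - 1 := by
        refine (hgd y₁ hyI).nonneg_of_right_min (Eventually.frequently ?_)
        filter_upwards [Ioc_mem_nhdsGT hyx'] with y hy
        linarith [hgx y ⟨hy.1.le, hy.2⟩]
      have h2 := eventually_lt_left_of_hasDerivAt_pos (had y₁ hyI) (by linarith)
      obtain ⟨y, hy, hyρ⟩ := (h2.and (Ico_mem_nhdsLT hρy')).exists
      refine hstrict y x₀ hyρ.1 (hyρ.2.le.trans hyx) hxb (by linarith) fun c hc => ?_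
      rcases le_total c y₁ with h | h
      · linarith [hmin c ⟨hyρ.1.trans hc.1, h⟩]
      · linarith [hgx c ⟨h, hc.2⟩]
  have hminL : ∀ᶠ x in 𝓝[<] y₀, a y₀ ≤ a x := by
    obtain ⟨d, hd, hd'⟩ := mem_nhdsLE_iff_exists_Ioc_subset.1
      (nhdsWithin_le_nhds (s := Iic y₀)
        ((hgd y₀ hyI).continuousAt.eventually (lt_mem_nhds hgy')))
    filter_upwards [Ioo_mem_nhdsLT hd, Ico_mem_nhdsLT hρy'] with y hy hyρ
    by_contra! hlt
    refine hstrict y x₀ hyρ.1 (hyρ.2.le.trans hyx) hxb (by linarith) fun c hc => ?_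
    rcases le_total c y₀ with h | h
    · have : a y₀ + e < g c := hd' ⟨hy.1.trans_le hc.1, h⟩
      linarith
    · linarith [hgx c ⟨h, hc.2⟩]
  have hVy : V y₀ = 1 - f (q - y₀) := by
    linarith [(had y₀ hyI).nonpos_of_left_min hminL.frequently]
  have hz : ∀ r, 0 < q - r → HasDerivAt (fun x => ψ (1 - f (q - x)))
      (ψ' (1 - f (q - r)) * f' (q - r)) r := fun r hr => by
    have h1 := ((hf.deriv _ hr).comp r ((hasDerivAt_id' r).const_sub q)).const_sub 1
    exact ((hψd (1 - f (q - r))).comp r h1).congr_deriv (by ring)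
  have hzc : ∀ r, ContinuousAt (fun x => 1 - f (q - x)) r := fun r => by
    have := hf.cont
    fun_prop
  have hnhd : ∀ {r}, r ∈ Ioo l R → ∀ᶠ x in 𝓝 r, HasDerivAt a (V x - (1 - f (q - x))) x :=
    fun hr => by filter_upwards [Ioo_mem_nhds hr.1 hr.2] with x hx using had x hx
  have hWy := deriv_comp_le_of_right_min hψ (hnhd hyI) (hV y₀ hyI) (hzc y₀) hVy
    ⟨by linarith [hf1 y₀ ⟨hρy, hyx.trans hxb⟩], by linarith⟩ (hW y₀ hyI) (hz y₀ hξ) hminR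
  have hdef : barrierDefect ψ ψ' f f' k q y₀ ≤ W y₀ - k * f (q - y₀) := by
    rw [hVy] at hWy
    simp only [barrierDefect]
    linarith
  have hend : ∀ x, y₀ < x → x ≤ b → V x = 1 → W y₀ - k * f (q - y₀) + η ≤ W x → False :=
    fun x h1 h2 h3 h4 => by
      have h5 := hzone y₀ x hρy h1 h2 (by linarith) (by
        by_contra! h
        linarith [hsub x ⟨by linarith, h2⟩ h])
      rw [hcontact x (hI (by linarith) h2) h3] at h4
      linarith
  have hinner : ∀ x c, x ≤ b → c ∈ Icc y₀ x → c < x → (∀ d ∈ Icc y₀ x, a y₀ + e ≤ g d) →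
      g c ≤ a y₀ + e → W y₀ - k * f (q - y₀) + η ≤ W c → False :=
    fun x c h1 h2 h3 h4 h5 h6 => by
      have hc : y₀ < c := h2.1.lt_of_ne fun h => by subst h; linarith
      have hcm : IsLocalMin g c := by
        filter_upwards [Ioo_mem_nhds hc h3] with d hd
        linarith [h4 d ⟨hd.1.le, hd.2.le⟩]
      have := hcm.hasDerivAt_eq_zero (hgd c (hI (by linarith) (by linarith)))
      exact hend c hc (by linarith) (by linarith) h6
  by_cases hcase : ∃ x, y₀ < x ∧ x ≤ b ∧ a y₀ + e < a x ∧ ∀ c ∈ Icc y₀ x, a y₀ + e ≤ g c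
  · obtain ⟨x, hx, hxb', hax', hgx'⟩ := hcase
    rcases hlim y₀ x hρy hx.le hxb' with h | ⟨c, hc, h1, h2⟩
    · linarith [h.1]
    · refine hinner x c hxb' hc (hc.2.lt_of_ne fun h => ?_) hgx' h1 (h2 hgx')
      subst h
      linarith [hag c]
  push Not at hcase
  have hnot : ∀ x, y₀ < x → x ≤ b → (∀ c ∈ Icc y₀ x, a y₀ + e ≤ g c) → a x ≤ a y₀ + e :=
    fun x h1 h2 h3 => by
      by_contra! h
      obtain ⟨c, hc, h4⟩ := hcase x h1 h2 h
      linarith [h3 c hc]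
  have hx0 : a x₀ = a y₀ + e := le_antisymm (hnot x₀ hyx' hxb hgx) hax
  have hxI := hI (hρy.trans hyx) hxb
  have hmaxL : ∀ᶠ x in 𝓝[<] x₀, a x ≤ a x₀ := by
    filter_upwards [Ioo_mem_nhdsLT hyx'] with x hx
    rw [hx0]
    exact hnot x hx.1 (hx.2.le.trans hxb) fun c hc => hgx c ⟨hc.1, hc.2.trans hx.2.le⟩
  have hVx_ge : 0 ≤ V x₀ - (1 - f (q - x₀)) := by
    have := (had x₀ hxI).neg.nonpos_of_left_min
      (hmaxL.frequently.mono fun x hx => by simpa using hx)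
    linarith
  have hxeq : g x₀ ≤ a y₀ + e → f (q - x₀) = 0 ∧ V x₀ = 1 := fun h => by
    have h1 : q - x₀ ≤ 0 := by
      by_contra! h'
      linarith [hf.prim_pos h', ha x₀]
    have h2 : V x₀ - 1 ≤ 0 := by
      refine (hgd x₀ hxI).nonpos_of_left_min (Eventually.frequently ?_)
      filter_upwards [Ioo_mem_nhdsLT hyx'] with x hx
      linarith [hgx x ⟨hx.1.le, hx.2.le⟩]
    have h3 := hf.zero _ h1
    exact ⟨h3, by linarith⟩
  rcases hlim y₀ x₀ hρy hyx hxb with ⟨-, h⟩ | ⟨c, hc, h1, h2⟩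
  · have hW' := h hax
    rcases le_or_gt (g x₀) (a y₀ + e) with hle | hgt
    · obtain ⟨h1, h2⟩ := hxeq hle
      rw [h1, mul_zero, sub_zero] at hW'
      exact hend x₀ hyx' hxb h2 hW'
    · have hξx : 0 < q - x₀ := by
        by_contra! h'
        have := ha x₀
        rw [hf.prim_zero _ h'] at this
        linarith
      have hmaxR : ∀ᶠ x in 𝓝[>] x₀, a x ≤ a x₀ := by
        obtain ⟨d, hd, hd'⟩ := mem_nhdsGE_iff_exists_Ico_subset.1
          (nhdsWithin_le_nhds (s := Ici x₀)
            ((hgd x₀ hxI).continuousAt.eventually (lt_mem_nhds hgt)))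
        filter_upwards [Ioo_mem_nhdsGT hd, Ioc_mem_nhdsGT (show x₀ < b by linarith)] with x hx hx'
        rw [hx0]
        refine hnot x (hyx'.trans hx.1) hx'.2 fun c hc => ?_
        rcases le_total c x₀ with h | h
        · exact hgx c ⟨hc.1, h⟩
        · have : a y₀ + e < g c := hd' ⟨h, hc.2.trans_lt hx.2⟩
          exact this.le
      have hVx_le : V x₀ - (1 - f (q - x₀)) ≤ 0 := by
        have := (had x₀ hxI).neg.nonneg_of_right_min
          (hmaxR.frequently.mono fun x hx => by simpa using hx)
        linarith
      have hVx : V x₀ = 1 - f (q - x₀) := by linarith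
      have hWx := le_deriv_comp_of_left_max hψ (hnhd hxI) (hV x₀ hxI) (hzc x₀) hVx
        ⟨by linarith [hf1 x₀ ⟨hρy.trans hyx, hxb⟩], by linarith [hf.pos _ hξx]⟩
        (hW x₀ hxI) (hz x₀ hξx) hmaxL
      have := hmono y₀ x₀ hρy hyx' hxb (by linarith)
      rw [hVx] at hWx
      simp only [barrierDefect] at this hdef
      linarith
  · rcases hc.2.lt_or_eq with hlt | rfl
    · exact hinner x₀ c hxb hc hlt hgx h1 (h2 hgx)
    · exact hend c hyx' hxb (hxeq h1).2 (h2 hgx)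

/-- `C¹` solutions of `u_t = (ψ(u_r))_r + ψ(u_r)/r` on `(l,R) × [0,T)`. -/
structure IsRadialSolution (ψ : ℝ → ℝ) (l R T : ℝ) (u ur ut : ℝ → ℝ → ℝ) : Prop where
  deriv_r : ∀ r ∈ Ioo l R, ∀ t ∈ Ico 0 T, HasDerivAt (fun x => u x t) (ur r t) r
  deriv_t : ∀ r ∈ Ioo l R, ∀ t ∈ Ico 0 T, HasDerivWithinAt (u r) (ut r t) (Ico 0 T) t
  cont : ContinuousOn (fun p : ℝ × ℝ => u p.1 p.2) (Ioo l R ×ˢ Ico 0 T)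
  cont_r : ContinuousOn (fun p : ℝ × ℝ => ur p.1 p.2) (Ioo l R ×ˢ Ico 0 T)
  cont_t : ContinuousOn (fun p : ℝ × ℝ => ut p.1 p.2) (Ioo l R ×ˢ Ico 0 T)
  eqn : ∀ r ∈ Ioo l R, ∀ t ∈ Ico 0 T,
    HasDerivAt (fun x => ψ (ur x t)) (ut r t - ψ (ur r t) / r) r

namespace IsRadialSolution

variable {ψ : ℝ → ℝ} {l R T : ℝ} {u ur ut : ℝ → ℝ → ℝ}

theorem hasDerivAt_t (h : IsRadialSolution ψ l R T u ur ut) {r t : ℝ} (hr : r ∈ Ioo l R)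
    (ht : t ∈ Ioo 0 T) : HasDerivAt (u r) (ut r t) t :=
  (h.deriv_t r hr t ⟨ht.1.le, ht.2⟩).hasDerivAt (Ico_mem_nhds ht.1 ht.2)

theorem continuousAt_ur (h : IsRadialSolution ψ l R T u ur ut) {r t : ℝ} (hr : r ∈ Ioo l R)
    (ht : t ∈ Ico 0 T) : ContinuousAt (fun x => ur x t) r :=
  (h.cont_r.comp (f := fun x => (x, t)) (s := Ioo l R) (by fun_prop)
    (fun x hx => ⟨hx, ht⟩)).continuousAt (Ioo_mem_nhds hr.1 hr.2)

theorem continuousOn_ur_time (h : IsRadialSolution ψ l R T u ur ut) {r : ℝ} (hr : r ∈ Ioo l R) :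
    ContinuousOn (fun t => ur r t) (Ico 0 T) :=
  h.cont_r.comp (f := fun t => (r, t)) (by fun_prop) (fun t ht => ⟨hr, ht⟩)

end IsRadialSolution

theorem isCompact_violations {G A : ℝ → ℝ → ℝ} {e : ℝ → ℝ} {ρ b s τ : ℝ}
    (hG : ContinuousOn (fun p : ℝ × ℝ => G p.1 p.2) (Icc ρ b ×ˢ Icc s τ))
    (hA : ContinuousOn (fun p : ℝ × ℝ => A p.1 p.2) (Icc ρ b ×ˢ Icc s τ)) (he : Continuous e) :
    IsCompact {p : ℝ × ℝ × ℝ | (ρ ≤ p.1 ∧ p.1 ≤ p.2.1 ∧ p.2.1 ≤ b ∧ s ≤ p.2.2 ∧ p.2.2 ≤ τ) ∧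
      A p.1 p.2.2 + e p.2.2 ≤ A p.2.1 p.2.2 ∧
      ∀ c ∈ Icc p.1 p.2.1, A p.1 p.2.2 + e p.2.2 ≤ G c p.2.2} := by
  set B : Set (ℝ × ℝ × ℝ) :=
    {p | ρ ≤ p.1 ∧ p.1 ≤ p.2.1 ∧ p.2.1 ≤ b ∧ s ≤ p.2.2 ∧ p.2.2 ≤ τ} with hB
  have hBcl : IsClosed B := by
    simp only [hB, ofPred_and]
    refine (isClosed_le (by fun_prop) (by fun_prop)).inter ((isClosed_le (by fun_prop)
      (by fun_prop)).inter ((isClosed_le (by fun_prop) (by fun_prop)).inter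
      ((isClosed_le (by fun_prop) (by fun_prop)).inter
      (isClosed_le (by fun_prop) (by fun_prop)))))
  have hBc : IsCompact B :=
    (isCompact_Icc.prod (isCompact_Icc.prod isCompact_Icc)).of_isClosed_subset hBcl
      (fun p (hp : _ ∧ _ ∧ _ ∧ _ ∧ _) => (⟨⟨hp.1, hp.2.1.trans hp.2.2.1⟩,
        ⟨hp.1.trans hp.2.1, hp.2.2.1⟩, ⟨hp.2.2.2.1, hp.2.2.2.2⟩⟩ :
          p ∈ Icc ρ b ×ˢ Icc ρ b ×ˢ Icc s τ))
  have hA1 : ContinuousOn (fun p : ℝ × ℝ × ℝ => A p.1 p.2.2 + e p.2.2) B :=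
    (hA.comp (f := fun p : ℝ × ℝ × ℝ => (p.1, p.2.2)) (by fun_prop)
      (fun p hp => ⟨⟨hp.1, hp.2.1.trans hp.2.2.1⟩, hp.2.2.2⟩)).add (by fun_prop)
  have hA2 : ContinuousOn (fun p : ℝ × ℝ × ℝ => A p.2.1 p.2.2) B :=
    hA.comp (f := fun p : ℝ × ℝ × ℝ => (p.2.1, p.2.2)) (by fun_prop)
      (fun p hp => ⟨⟨hp.1.trans hp.2.1, hp.2.2.1⟩, hp.2.2.2⟩)
  have hGθ : ∀ θ ∈ Icc (0 : ℝ) 1,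
      ContinuousOn (fun p : ℝ × ℝ × ℝ => G (p.1 + θ * (p.2.1 - p.1)) p.2.2) B := fun θ hθ => by
    refine hG.comp (f := fun p : ℝ × ℝ × ℝ => (p.1 + θ * (p.2.1 - p.1), p.2.2)) (by fun_prop)
      (fun p hp => ⟨⟨?_, ?_⟩, hp.2.2.2⟩)
    · have := mul_nonneg hθ.1 (sub_nonneg.2 hp.2.1)
      linarith [hp.1]
    · have := mul_le_mul_of_nonneg_right hθ.2 (sub_nonneg.2 hp.2.1)
      linarith [hp.2.2.1]
  refine hBc.of_isClosed_subset ?_ (fun p hp => hp.1)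
  have hcl := (hBcl.isClosed_le hA1 hA2).inter
    (isClosed_biInter fun θ (hθ : θ ∈ Icc (0 : ℝ) 1) => hBcl.isClosed_le hA1 (hGθ θ hθ))
  convert hcl using 1
  ext p
  simp only [mem_ofPred_eq, mem_inter_iff, mem_iInter]
  refine ⟨fun ⟨h1, h2, h3⟩ => ⟨⟨h1, h2⟩, fun θ hθ => ⟨h1, h3 _ ⟨?_, ?_⟩⟩⟩,
    fun ⟨⟨h1, h2⟩, h3⟩ => ⟨h1, h2, fun c hc => ?_⟩⟩
  · have := mul_nonneg hθ.1 (sub_nonneg.2 h1.2.1)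
    linarith
  · have := mul_le_mul_of_nonneg_right hθ.2 (sub_nonneg.2 h1.2.1)
    linarith
  · rcases h1.2.1.eq_or_lt with heq | hlt
    · have := (h3 0 ⟨le_rfl, zero_le_one⟩).2
      rw [zero_mul, add_zero] at this
      rwa [show c = p.1 by linarith [hc.1, hc.2]]
    · have hpos : 0 < p.2.1 - p.1 := sub_pos.2 hlt
      have := (h3 ((c - p.1) / (p.2.1 - p.1)) ⟨div_nonneg (by linarith [hc.1]) hpos.le,
        (div_le_one hpos).2 (by linarith [hc.2])⟩).2
      rwa [div_mul_cancel₀ _ hpos.ne', add_sub_cancel] at this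

/-- Comparison with the moving barrier `1 - f(β₀ + k t - r)`, whose edge may be reached by
supercritical points only within distance `σ`. -/
theorem IsRadialSolution.le_barrier {ψ ψ' F f f' : ℝ → ℝ} {l R T : ℝ} {u ur ut : ℝ → ℝ → ℝ}
    (hsol : IsRadialSolution ψ l R T u ur ut)
    (hψd : ∀ s, HasDerivAt ψ (ψ' s) s) (hψ : StrictMonoOn ψ (Ioo 0 1)) (hψmax : IsLocalMax ψ 1)
    (hf : IsProfile F f f') {ρ b s τ β₀ k σ : ℝ}
    (hlρ : l < ρ) (hbR : b < R) (hs : 0 ≤ s) (hsτ : s ≤ τ) (hτT : τ < T)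
    (hqb : ∀ t ∈ Icc s τ, β₀ + k * t < b)
    (hf1 : ∀ t ∈ Icc s τ, ∀ r ∈ Icc ρ b, f (β₀ + k * t - r) < 1)
    (hzone : ∀ t ∈ Icc s τ, ∀ y x, ρ ≤ y → y < x → x ≤ b → y < β₀ + k * t →
      β₀ + k * t - σ < x → ψ 1 / x ≤ barrierDefect ψ ψ' f f' k (β₀ + k * t) y)
    (hmono : ∀ t ∈ Icc s τ, ∀ y x, ρ ≤ y → y < x → x ≤ b → x < β₀ + k * t →
      barrierDefect ψ ψ' f f' k (β₀ + k * t) x ≤ barrierDefect ψ ψ' f f' k (β₀ + k * t) y)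
    (hsub : ∀ t ∈ Icc s τ, ∀ r ∈ Icc ρ b, r ≤ β₀ + k * t - σ → ur r t < 1)
    (hVρ : ∀ t ∈ Icc s τ, ur ρ t < 1 - f (β₀ + k * t - ρ))
    (hinit : ∀ r ∈ Icc ρ b, r < β₀ + k * s → ur r s ≤ 1 - f (β₀ + k * s - r))
    {r : ℝ} (hρr : ρ ≤ r) (hr : r < β₀ + k * τ) : ur r τ ≤ 1 - f (β₀ + k * τ - r) := by
  obtain ⟨q, hq⟩ : ∃ q : ℝ → ℝ, ∀ t, q t = β₀ + k * t := ⟨_, fun _ => rfl⟩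
  have hqc : Continuous q := by rw [show q = fun t => β₀ + k * t from funext hq]; fun_prop
  obtain ⟨g, hg⟩ : ∃ g : ℝ → ℝ → ℝ, ∀ r t, g r t = u r t - r := ⟨_, fun _ _ => rfl⟩
  obtain ⟨a, ha⟩ : ∃ a : ℝ → ℝ → ℝ, ∀ r t, a r t = g r t - F (q t - r) := ⟨_, fun _ _ => rfl⟩
  simp only [← hq] at hqb hf1 hzone hmono hsub hVρ hinit hr ⊢
  have hFc : Continuous F := continuous_iff_continuousAt.2 fun x => (hf.prim x).continuousAt
  have hfc := hf.cont
  have hI : ∀ {r}, r ∈ Icc ρ b → r ∈ Ioo l R :=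
    fun h => ⟨hlρ.trans_le h.1, h.2.trans_lt hbR⟩
  have hJ : ∀ {t}, t ∈ Icc s τ → t ∈ Ico 0 T := fun h => ⟨hs.trans h.1, h.2.trans_lt hτT⟩
  have hgc : ContinuousOn (fun p : ℝ × ℝ => g p.1 p.2) (Icc ρ b ×ˢ Icc s τ) := by
    simp only [hg]
    exact (hsol.cont.mono (prod_mono (fun _ => hI) (fun _ => hJ))).sub (by fun_prop)
  have hac : ContinuousOn (fun p : ℝ × ℝ => a p.1 p.2) (Icc ρ b ×ˢ Icc s τ) := by
    simp only [ha]
    exact hgc.sub (by fun_prop)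
  have hutc : ContinuousOn (fun p : ℝ × ℝ => ut p.1 p.2) (Icc ρ b ×ˢ Icc s τ) :=
    hsol.cont_t.mono (prod_mono (fun _ => hI) (fun _ => hJ))
  have hgd : ∀ t ∈ Icc s τ, ∀ r ∈ Ioo l R, HasDerivAt (fun r => g r t) (ur r t - 1) r :=
    fun t ht r hr => by
      simp only [hg]
      exact (hsol.deriv_r r hr t (hJ ht)).sub (hasDerivAt_id' r)
  have had : ∀ t ∈ Icc s τ, ∀ r ∈ Ioo l R,
      HasDerivAt (fun r => a r t) (ur r t - (1 - f (q t - r))) r := fun t ht r hr => by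
    simp only [ha]
    exact ((hgd t ht r hr).sub ((hf.prim (q t - r)).comp r
      ((hasDerivAt_id' r).const_sub (q t)))).congr_deriv (by ring)
  have hgt : ∀ t ∈ Ioo s τ, ∀ r ∈ Icc ρ b, HasDerivAt (g r) (ut r t) t := fun t ht r hr => by
    rw [show g r = fun t => u r t - r from funext (hg r)]
    exact (hsol.hasDerivAt_t (hI hr) ⟨hs.trans_lt ht.1, ht.2.trans hτT⟩).sub_const r
  have hqd : ∀ t, HasDerivAt q k t := fun t => by
    rw [show q = fun t => β₀ + k * t from funext hq]
    simpa using ((hasDerivAt_id' t).const_mul k).const_add β₀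
  have hat : ∀ t ∈ Ioo s τ, ∀ r ∈ Icc ρ b,
      HasDerivAt (a r) (ut r t - k * f (q t - r)) t := fun t ht r hr => by
    rw [show a r = fun t => g r t - F (q t - r) from funext (ha r)]
    exact ((hgt t ht r hr).sub ((hf.prim (q t - r)).comp t
      ((hqd t).sub_const r))).congr_deriv (by ring)
  have key : ∀ η > 0, ¬ ∃ y x, (ρ ≤ y ∧ y ≤ x ∧ x ≤ b) ∧
      a y τ + η * (1 + (τ - s)) ≤ a x τ ∧
      ∀ c ∈ Icc y x, a y τ + η * (1 + (τ - s)) ≤ g c τ := by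
    rintro η hη ⟨y₁, x₁, ⟨h1, h2, h3⟩, h4, h5⟩
    obtain ⟨e, he⟩ : ∃ e : ℝ → ℝ, ∀ t, e t = η * (1 + (t - s)) := ⟨_, fun _ => rfl⟩
    have hec : Continuous e := by
      rw [show e = fun t => η * (1 + (t - s)) from funext he]
      fun_prop
    have hed : ∀ t, HasDerivAt e η t := fun t => by
      rw [show e = fun t => η * (1 + (t - s)) from funext he]
      simpa using (((hasDerivAt_id' t).sub_const s).const_add 1).const_mul η
    simp only [← he] at h4 h5
    obtain ⟨⟨y₀, x₀, t₀⟩, ⟨⟨hρy, hyx, hxb, hst, htτ⟩, hax, hgx⟩, hmin⟩ :=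
      (isCompact_violations hgc hac hec).exists_isMinOn
        (f := fun p => p.2.2) ⟨(y₁, x₁, τ), ⟨h1, h2, h3, hsτ, le_rfl⟩, h4, h5⟩ (by fun_prop)
    rw [isMinOn_iff] at hmin
    simp only at hρy hyx hxb hst htτ hax hgx hmin
    have hmem : t₀ ∈ Icc s τ := ⟨hst, htτ⟩
    have hepos : ∀ t, s ≤ t → 0 < e t := fun t ht => by
      rw [he]
      exact mul_pos hη (by linarith)
    have hst' : s < t₀ := by
      refine hst.lt_of_ne fun heq => ?_
      subst heq
      have hes := hepos s le_rfl
      have hdec : AntitoneOn (fun r => a r s) (Icc ρ b ∩ Iic (q s)) := by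
        refine antitoneOn_of_deriv_nonpos ((convex_Icc ρ b).inter (convex_Iic _))
          (fun r hr => (had s hmem r (hI hr.1)).continuousAt.continuousWithinAt)
          (fun r hr => (had s hmem r
            (hI (interior_subset hr).1)).differentiableAt.differentiableWithinAt) fun r hr => ?_
        have hr' := interior_inter.subset hr
        rw [interior_Iic] at hr'
        rw [(had s hmem r (hI (interior_subset hr).1)).deriv]
        linarith [hinit r (interior_subset hr).1 hr'.2]
      have hyq : y₀ < q s := by
        by_contra! hle
        have := hgx y₀ ⟨le_rfl, hyx⟩
        linarith [ha y₀ s, hf.prim_zero (q s - y₀) (by linarith)]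
      rcases le_total x₀ (q s) with hle | hle
      · have : a x₀ s ≤ a y₀ s :=
          hdec ⟨⟨hρy, hyx.trans hxb⟩, hyq.le⟩ ⟨⟨hρy.trans hyx, hxb⟩, hle⟩ hyx
        linarith
      · have : a (q s) s ≤ a y₀ s := hdec ⟨⟨hρy, hyx.trans hxb⟩, hyq.le⟩
          ⟨⟨by linarith, hle.trans hxb⟩, mem_Iic.2 le_rfl⟩ hyq.le
        have h6 := ha (q s) s
        rw [hf.prim_zero (q s - q s) (by simp)] at h6
        linarith [hgx (q s) ⟨hyq.le, hle⟩]
    have hsubI : Icc s t₀ ⊆ Icc s τ := Icc_subset_Icc_right htτ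
    have hsubO : Ioo s t₀ ⊆ Ioo s τ := Ioo_subset_Ioo_right htτ
    refine no_first_violation (U := fun r => u r t₀) (V := fun r => ur r t₀)
      (W := fun r => ut r t₀) (q := q t₀) (e := e t₀) hψd hψ hψmax hf
      (fun r hr => hsol.deriv_r r hr t₀ (hJ hmem))
      (fun r hr => hsol.continuousAt_ur hr (hJ hmem))
      (fun r hr => hsol.eqn r hr t₀ (hJ hmem)) hlρ hbR (hqb t₀ hmem) hη
      (hepos t₀ hst) (hf1 t₀ hmem) (hzone t₀ hmem) (hmono t₀ hmem) (hsub t₀ hmem)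
      (hVρ t₀ hmem) ?_ hρy hyx hxb (by simpa only [hg, ha] using hax)
      (by simpa only [hg, ha] using hgx)
    intro y x hy hyx' hx
    have hyI : y ∈ Icc ρ b := ⟨hy, hyx'.trans hx⟩
    have hxI : x ∈ Icc ρ b := ⟨hy.trans hyx', hx⟩
    have hfreq : ∃ᶠ t in 𝓝[<] t₀, (∃ c ∈ ({x} : Set ℝ), a c t - a y t - e t < 0) ∨
        ∃ c ∈ Icc y x, g c t - a y t - e t < 0 := by
      refine Eventually.frequently ?_
      filter_upwards [Ioo_mem_nhdsLT hst'] with t ht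
      by_contra! hcon
      have := hmin (y, x, t) ⟨⟨hy, hyx', hx, ht.1.le, ht.2.le.trans htτ⟩,
        by linarith [hcon.1 x rfl], fun c hc => by linarith [hcon.2 c hc]⟩
      exact absurd this (not_le.2 ht.2)
    have hslice : ∀ {G : ℝ → ℝ → ℝ}, ContinuousOn (fun p : ℝ × ℝ => G p.1 p.2)
        (Icc ρ b ×ˢ Icc s τ) → ContinuousOn (fun p : ℝ × ℝ => G y p.2) (Icc ρ b ×ˢ Icc s τ) :=
      fun hG => hG.comp (f := fun p : ℝ × ℝ => (y, p.2)) (by fun_prop) (fun p hp => ⟨hyI, hp.2⟩)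
    have hmono1 : ({x} : Set ℝ) ×ˢ Icc s t₀ ⊆ Icc ρ b ×ˢ Icc s τ :=
      prod_mono (singleton_subset_iff.2 hxI) hsubI
    have hmono2 : Icc y x ×ˢ Icc s t₀ ⊆ Icc ρ b ×ˢ Icc s τ :=
      prod_mono (Icc_subset_Icc hy hx) hsubI
    rw [frequently_or_distrib] at hfreq
    rcases hfreq with hfreq | hfreq
    · left
      obtain ⟨c, rfl, h6, h7⟩ := exists_limit_contact isCompact_singleton hst'
        (P := fun c t => a c t - a y t - e t)
        (Pt := fun c t => (ut c t - k * f (q t - c)) - (ut y t - k * f (q t - y)) - η)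
        (((hac.sub (hslice hac)).sub (by fun_prop)).mono hmono1)
        ((((hutc.sub (by fun_prop)).sub ((hslice hutc).sub (by fun_prop))).sub
          (by fun_prop)).mono hmono1)
        (fun c hc t ht => by
          obtain rfl : c = x := hc
          exact ((hat t (hsubO ht) c hxI).sub (hat t (hsubO ht) y hyI)).sub (hed t)) hfreq
      simp only [← hg, ← ha]
      refine ⟨by linarith, fun h8 => ?_⟩
      have := h7 fun d hd => by
        obtain rfl : d = c := hd
        linarith
      linarith
    · right
      obtain ⟨c, hc, h6, h7⟩ := exists_limit_contact isCompact_Icc hst'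
        (P := fun c t => g c t - a y t - e t)
        (Pt := fun c t => ut c t - (ut y t - k * f (q t - y)) - η)
        (((hgc.sub (hslice hac)).sub (by fun_prop)).mono hmono2)
        (((hutc.sub ((hslice hutc).sub (by fun_prop))).sub
          (by fun_prop)).mono hmono2)
        (fun c hc t ht => ((hgt t (hsubO ht) c ⟨hy.trans hc.1, hc.2.trans hx⟩).sub
          (hat t (hsubO ht) y hyI)).sub (hed t)) hfreq
      simp only [← hg, ← ha]
      refine ⟨c, hc, by linarith, fun h8 => ?_⟩
      have := h7 fun d hd => by linarith [h8 d hd]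
      linarith
  by_contra! hlt
  have hτmem : τ ∈ Icc s τ := ⟨hsτ, le_rfl⟩
  have hrb : r < b := hr.trans (hqb τ hτmem)
  have hrI : r ∈ Ioo l R := hI ⟨hρr, hrb.le⟩
  have hFpos : 0 < F (q τ - r) := hf.prim_pos (sub_pos.2 hr)
  have hup := eventually_lt_right_of_hasDerivAt_neg (had τ hτmem r hrI).neg (by linarith)
  have hgnear : ∀ᶠ x in 𝓝[≥] r, a r τ + F (q τ - r) / 2 < g x τ :=
    nhdsWithin_le_nhds ((hgd τ hτmem r hrI).continuousAt.eventually
      (lt_mem_nhds (by rw [ha]; linarith)))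
  obtain ⟨d, hd, hd'⟩ := mem_nhdsGE_iff_exists_Ico_subset.1 hgnear
  have hI1 : ∀ᶠ x in 𝓝[>] r, x ∈ Ioo r d := Ioo_mem_nhdsGT (show r < d from hd)
  have hI2 : ∀ᶠ x in 𝓝[>] r, x ∈ Ioc r b := Ioc_mem_nhdsGT hrb
  obtain ⟨x, hx1, hx2, hx3⟩ := (hup.and (hI1.and hI2)).exists
  simp only [Pi.neg_apply, neg_lt_neg_iff] at hx1
  have hone : 0 < 1 + (τ - s) := by linarith
  set ε := min (a x τ - a r τ) (F (q τ - r) / 2) with hε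
  have hεpos : 0 < ε := lt_min (by linarith) (by linarith)
  refine key (ε / (1 + (τ - s))) (div_pos hεpos hone)
    ⟨r, x, ⟨hρr, hx2.1.le, hx3.2⟩, ?_, fun c hc => ?_⟩
  · rw [div_mul_cancel₀ _ hone.ne']
    linarith [min_le_left (a x τ - a r τ) (F (q τ - r) / 2)]
  · rw [div_mul_cancel₀ _ hone.ne']
    have : a r τ + F (q τ - r) / 2 < g c τ := hd' ⟨hc.1, hc.2.trans_lt hx2.2⟩
    linarith [min_le_right (a x τ - a r τ) (F (q τ - r) / 2)]

/-- The profile `B (√(δ² + 2 δ ξ₊) - δ)`, which vanishes for `ξ ≤ 0` and has slope `B` at `0+`. -/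
noncomputable def sqrtProfile (B δ ξ : ℝ) : ℝ := B * (√(δ ^ 2 + 2 * δ * max ξ 0) - δ)

section sqrtProfile

variable {B δ ξ : ℝ}

theorem le_sqrt_profile (hδ : 0 < δ) (ξ : ℝ) : δ ≤ √(δ ^ 2 + 2 * δ * max ξ 0) :=
  Real.le_sqrt_of_sq_le (by have := mul_nonneg hδ.le (le_max_right ξ 0); linarith)

theorem sqrtProfile_of_nonpos (hδ : 0 < δ) (hξ : ξ ≤ 0) : sqrtProfile B δ ξ = 0 := by
  rw [sqrtProfile, max_eq_right hξ, mul_zero, add_zero, Real.sqrt_sq hδ.le, sub_self, mul_zero]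

theorem sqrtProfile_nonneg (hB : 0 ≤ B) (hδ : 0 < δ) (ξ : ℝ) : 0 ≤ sqrtProfile B δ ξ :=
  mul_nonneg hB (sub_nonneg.2 (le_sqrt_profile hδ ξ))

theorem sqrtProfile_pos (hB : 0 < B) (hδ : 0 < δ) (hξ : 0 < ξ) : 0 < sqrtProfile B δ ξ :=
  mul_pos hB (sub_pos.2 (Real.lt_sqrt_of_sq_lt (by
    rw [max_eq_left hξ.le]
    nlinarith [mul_pos hδ hξ])))

theorem continuous_sqrtProfile : Continuous (sqrtProfile B δ) := by
  unfold sqrtProfile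
  fun_prop

theorem hasDerivAt_sqrt_profile (hδ : 0 < δ) (hξ : 0 < ξ) :
    HasDerivAt (fun ξ => √(δ ^ 2 + 2 * δ * max ξ 0)) (δ / √(δ ^ 2 + 2 * δ * max ξ 0)) ξ := by
  have h0 : 0 < δ ^ 2 + 2 * δ * ξ := by positivity
  have h1 : HasDerivAt (fun ξ => √(δ ^ 2 + 2 * δ * ξ)) (δ / √(δ ^ 2 + 2 * δ * ξ)) ξ := by
    have h2 : HasDerivAt (fun ξ => δ ^ 2 + 2 * δ * ξ) (2 * δ) ξ := by
      simpa using ((hasDerivAt_id' ξ).const_mul (2 * δ)).const_add (δ ^ 2)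
    refine (h2.sqrt h0.ne').congr_deriv ?_
    field_simp
  rw [max_eq_left hξ.le]
  refine h1.congr_of_eventuallyEq ?_
  filter_upwards [lt_mem_nhds hξ] with x hx
  rw [max_eq_left hx.le]

theorem hasDerivAt_sqrtProfile (hδ : 0 < δ) (hξ : 0 < ξ) :
    HasDerivAt (sqrtProfile B δ) (B * (δ / √(δ ^ 2 + 2 * δ * max ξ 0))) ξ :=
  ((hasDerivAt_sqrt_profile hδ hξ).sub_const δ).const_mul B

theorem hasDerivAt_deriv_sqrtProfile (hδ : 0 < δ) (hξ : 0 < ξ) :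
    HasDerivAt (fun ξ => B * (δ / √(δ ^ 2 + 2 * δ * max ξ 0)))
      (-(B * (δ / √(δ ^ 2 + 2 * δ * max ξ 0)) ^ 3 / δ)) ξ := by
  have hS : 0 < √(δ ^ 2 + 2 * δ * max ξ 0) := hδ.trans_le (le_sqrt_profile hδ ξ)
  refine ((((hasDerivAt_sqrt_profile hδ hξ).fun_inv hS.ne').const_mul δ).const_mul B).congr_deriv ?_
  field_simp

theorem isProfile_sqrtProfile (hB : 0 < B) (hδ : 0 < δ) :
    IsProfile (fun ξ => ∫ s in (0 : ℝ)..ξ, sqrtProfile B δ s) (sqrtProfile B δ)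
      (fun ξ => B * (δ / √(δ ^ 2 + 2 * δ * max ξ 0))) where
  prim ξ := continuous_sqrtProfile.integral_hasStrictDerivAt 0 ξ |>.hasDerivAt
  prim_zero ξ hξ := by
    rw [intervalIntegral.integral_congr (g := fun _ => (0 : ℝ)), intervalIntegral.integral_zero]
    intro s hs
    rw [uIcc_of_ge hξ] at hs
    exact sqrtProfile_of_nonpos hδ hs.2
  zero _ hξ := sqrtProfile_of_nonpos hδ hξ
  pos _ hξ := sqrtProfile_pos hB hδ hξ
  cont := continuous_sqrtProfile
  deriv _ hξ := hasDerivAt_sqrtProfile hδ hξ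

theorem exists_sqrtProfile_lt (B L : ℝ) (hB : 0 ≤ B) {ε : ℝ} (hε : 0 < ε) :
    ∃ δ > 0, δ ≤ ε ∧ ∀ ξ ≤ L, sqrtProfile B δ ξ < ε := by
  have h1 : Tendsto (fun δ => sqrtProfile B δ L) (𝓝[>] 0) (𝓝 0) := by
    refine (Continuous.tendsto' ?_ 0 0 (by simp [sqrtProfile])).mono_left nhdsWithin_le_nhds
    unfold sqrtProfile
    fun_prop
  have h2 : ∀ᶠ δ in 𝓝[>] (0 : ℝ), δ ∈ Ioc 0 ε := Ioc_mem_nhdsGT hε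
  obtain ⟨δ, h3, h4⟩ := ((h1.eventually_lt_const hε).and h2).exists
  refine ⟨δ, h4.1, h4.2, fun ξ hξ => lt_of_le_of_lt ?_ h3⟩
  have := h4.1
  unfold sqrtProfile
  gcongr

end sqrtProfile

theorem exists_degenerate_bounds {ψ ψ' ψ'' : ℝ → ℝ} (hψd : ∀ s, HasDerivAt ψ (ψ' s) s)
    (hψd' : ∀ s, HasDerivAt ψ' (ψ'' s) s) (hψc : ContinuousAt ψ'' 1) (hone : ψ' 1 = 0) {ω : ℝ}
    (hω : 0 < ω) : ∃ ε > 0, ∀ s, 0 ≤ s → s < ε → |ψ'' (1 - s) - ψ'' 1| ≤ ω ∧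
      |ψ' (1 - s) + ψ'' 1 * s| ≤ ω * s ∧ |ψ (1 - s) - ψ 1| ≤ ω * s := by
  have h1 : ∀ᶠ x in 𝓝 (1 : ℝ), |ψ'' x - ψ'' 1| ≤ ω := by
    have := hψc.eventually (Metric.closedBall_mem_nhds (ψ'' 1) hω)
    simpa [Real.dist_eq] using this
  have h2 := (hasDerivAt_iff_isLittleO.1 (hψd' 1)).def hω
  have h3 := (hasDerivAt_iff_isLittleO.1 (hψd 1)).def hω
  obtain ⟨ε, hε, h4⟩ := Metric.eventually_nhds_iff.1 (h1.and (h2.and h3))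
  refine ⟨ε, hε, fun s hs hsε => ?_⟩
  obtain ⟨h5, h6, h7⟩ := h4 (y := 1 - s) (by simpa [Real.dist_eq, abs_of_nonneg hs] using hsε)
  simp only [hone, smul_eq_mul, mul_zero, sub_zero, Real.norm_eq_abs, sub_sub_cancel_left,
    abs_neg, abs_of_nonneg hs] at h6 h7
  refine ⟨h5, ?_, h7⟩
  rwa [show ψ' (1 - s) + ψ'' 1 * s = ψ' (1 - s) - -s * ψ'' 1 by ring]

theorem barrier_slope_nonneg {B c ω K k M R₀ rm e f p₀ p₁ p₂ r δ : ℝ} (hc : 0 < c) (hω : 0 < ω)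
    (hωc : ω ≤ c) (hK : 0 < K) (hB : B = 4 / 3 * K / c)
    (hM : K ^ 2 * R₀ ^ 2 = 2 * M * c)
    (hsmall : ω * (2 * B ^ 2 + 2 * c * B / rm + 1 / rm ^ 2) ≤ K ^ 2 / (18 * c))
    (hrm : 0 < rm) (hr : rm ≤ |r|) (hrR : |r| ≤ R₀) (he : 0 < e) (he1 : e ≤ 1) (hδ : 0 < δ)
    (hf : f = B * (δ / e - δ)) (hf0 : 0 ≤ f) (hfω : f ≤ ω) (hf1 : f ≤ 1)
    (hp₂ : |p₂ + c| ≤ ω) (hp₁ : |p₁ - c * f| ≤ ω * f) (hp₀ : |p₀ - M| ≤ ω * f) (hk : k ≤ K) :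
    0 ≤ -p₂ * (B * e) ^ 2 + p₁ * (-(B * e ^ 3 / δ)) - p₁ * (B * e) / r + p₀ / r ^ 2
      - k * (B * e) := by
  have hBpos : 0 < B := by rw [hB]; positivity
  rw [abs_le] at hp₂ hp₁ hp₀
  have h1 : (c - ω) * (B ^ 2 * e ^ 2) ≤ -p₂ * (B * e) ^ 2 := by
    rw [mul_pow]
    exact mul_le_mul_of_nonneg_right (by linarith) (by positivity)
  have h2 : -((c + ω) * (B ^ 2 * (e ^ 2 - e ^ 3))) ≤ p₁ * (-(B * e ^ 3 / δ)) := by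
    have h3 : (c + ω) * (B ^ 2 * (e ^ 2 - e ^ 3)) = ((c + ω) * f) * (B * e ^ 3 / δ) := by
      rw [hf]; field_simp
    rw [h3, mul_neg]
    exact neg_le_neg (mul_le_mul_of_nonneg_right (by linarith) (by positivity))
  have h3 : p₁ * (B * e) / r ≤ ω * (2 * c * B / rm) := by
    have h4 : |p₁| ≤ 2 * c * ω := by
      have : 0 ≤ c * f := by positivity
      have : ω * f ≤ c * f := by gcongr
      have : c * f ≤ c * ω := by gcongr
      rw [abs_le]
      constructor <;> linarith
    calc p₁ * (B * e) / r ≤ |p₁ * (B * e) / r| := le_abs_self _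
      _ = |p₁| * (B * e) / |r| := by rw [abs_div, abs_mul, abs_of_pos (mul_pos hBpos he)]
      _ ≤ (2 * c * ω) * (B * 1) / rm := by gcongr
      _ = _ := by ring
  have h4 : K ^ 2 / (2 * c) - ω * (1 / rm ^ 2) ≤ p₀ / r ^ 2 := by
    have hr0 : 0 < |r| := hrm.trans_le hr
    have hR0 : 0 < R₀ := hr0.trans_le hrR
    have hMe : K ^ 2 / (2 * c) = M / R₀ ^ 2 := by
      field_simp; linarith
    have hMpos : 0 < M := by
      have : 0 < 2 * M * c := by rw [← hM]; positivity
      by_contra! h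
      nlinarith
    rw [hMe, ← sq_abs r]
    calc M / R₀ ^ 2 - ω * (1 / rm ^ 2) ≤ M / |r| ^ 2 - ω * (1 / |r| ^ 2) := by gcongr
      _ = (M - ω) / |r| ^ 2 := by ring
      _ ≤ _ := by
        gcongr
        have : ω * f ≤ ω * 1 := by gcongr
        linarith
  have h5 : k * (B * e) ≤ K * (B * e) := by gcongr
  have h6 : c * B ^ 2 * e ^ 3 - K * (B * e) + K ^ 2 / (2 * c) - K ^ 2 / (18 * c) =
      K ^ 2 / c * (16 / 9 * ((e - 1 / 2) ^ 2 * (e + 1))) := by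
    rw [hB]; field_simp; ring
  have h7 : 0 ≤ K ^ 2 / c * (16 / 9 * ((e - 1 / 2) ^ 2 * (e + 1))) := by positivity
  have h8 : ω * B ^ 2 * (2 * e ^ 2 - e ^ 3) ≤ ω * B ^ 2 * 2 := by
    gcongr
    nlinarith [pow_pos he 3]
  linarith

theorem exists_barrier {ψ ψ' ψ'' : ℝ → ℝ} (hψd : ∀ s, HasDerivAt ψ (ψ' s) s)
    (hψd' : ∀ s, HasDerivAt ψ' (ψ'' s) s) (hψc : ContinuousAt ψ'' 1) (hone : ψ' 1 = 0)
    {c K R₀ rm L ε : ℝ} (hc : 0 < c) (hψ'' : ψ'' 1 = -c) (hM : 0 < ψ 1) (hK : 0 < K)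
    (hKM : K ^ 2 * R₀ ^ 2 = 2 * ψ 1 * c) (hrm : 0 < rm) (hε : 0 < ε) :
    ∃ F f f' : ℝ → ℝ, ∃ σ > 0, σ ≤ ε ∧ IsProfile F f f' ∧ (∀ ξ ≤ L, f ξ < ε) ∧
      ∀ k ≤ K, ∀ q y x, y < x → q - y ≤ L → (∀ r ∈ Icc y x, rm ≤ |r| ∧ |r| ≤ R₀) →
        (x < q → barrierDefect ψ ψ' f f' k q x ≤ barrierDefect ψ ψ' f f' k q y) ∧
        (y < q → q - σ < x → ψ 1 / x ≤ barrierDefect ψ ψ' f f' k q y) := by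
  obtain ⟨B, hB⟩ : ∃ B, B = 4 / 3 * K / c := ⟨_, rfl⟩
  have hBpos : 0 < B := by rw [hB]; positivity
  have hlim : ∀ C d : ℝ, 0 < d → ∀ᶠ ω in 𝓝[>] (0 : ℝ), ω * C < d := fun C d hd =>
    ((Continuous.tendsto' (by fun_prop) 0 0 (by simp)).mono_left
      nhdsWithin_le_nhds).eventually_lt_const hd
  have hω1 : ∀ᶠ ω in 𝓝[>] (0 : ℝ), ω ∈ Ioc 0 c := Ioc_mem_nhdsGT hc
  obtain ⟨ω, ⟨hω, hωc⟩, hs1, hs2⟩ := (hω1.and ((hlim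
    (2 * B ^ 2 + 2 * c * B / rm + 1 / rm ^ 2) (K ^ 2 / (18 * c)) (by positivity)).and
    (hlim (7 / 6 * K / c + 1 / rm) (K / 6) (by positivity)))).exists
  obtain ⟨ε₁, hε₁, htol⟩ := exists_degenerate_bounds hψd hψd' hψc hone hω
  obtain ⟨δ, hδ, hδε, hfL⟩ := exists_sqrtProfile_lt B L hBpos.le
    (ε := min (min ε₁ ω) (min ε 1)) (by positivity)
  have hprof := isProfile_sqrtProfile hBpos hδ
  obtain ⟨f, hf⟩ : ∃ f, f = sqrtProfile B δ := ⟨_, rfl⟩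
  obtain ⟨f', hf'⟩ : ∃ f' : ℝ → ℝ, f' = fun ξ => B * (δ / √(δ ^ 2 + 2 * δ * max ξ 0)) := ⟨_, rfl⟩
  rw [← hf, ← hf'] at hprof
  rw [← hf] at hfL
  simp only [lt_min_iff] at hfL
  have hfnn : ∀ ξ, 0 ≤ f ξ := fun ξ => hf ▸ sqrtProfile_nonneg hBpos.le hδ ξ
  have hδε' : δ ≤ ε := hδε.trans ((min_le_right _ _).trans (min_le_left _ _))
  have hzone : ∀ k ≤ K, ∀ q y, q - y ≤ L → y < q → q - δ / 8 ≤ y → rm ≤ |y| →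
      ψ 1 / y ≤ barrierDefect ψ ψ' f f' k q y := fun k hk q y hL hyq hσ hy => by
    obtain ⟨ξ, hξ⟩ : ∃ ξ, ξ = q - y := ⟨_, rfl⟩
    obtain ⟨⟨hf1, hfω⟩, -, hf1'⟩ := hfL ξ (by rw [hξ]; exact hL)
    obtain ⟨-, hp₁, hp₀⟩ := htol (f ξ) (hfnn ξ) hf1
    have hξpos : 0 < ξ := by rw [hξ]; linarith
    have hslope : 7 / 6 * K / c ≤ f' ξ := by
      have hS : √(δ ^ 2 + 2 * δ * max ξ 0) ≤ 8 / 7 * δ := by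
        rw [max_eq_left hξpos.le]
        refine Real.sqrt_le_iff.2 ⟨by positivity, ?_⟩
        have : δ * ξ ≤ δ * (δ / 8) := by
          gcongr
          rw [hξ]; linarith
        nlinarith
      have hS0 : 0 < √(δ ^ 2 + 2 * δ * max ξ 0) := hδ.trans_le (le_sqrt_profile hδ ξ)
      have h7 : 7 / 8 ≤ δ / √(δ ^ 2 + 2 * δ * max ξ 0) := by
        rw [le_div_iff₀ hS0]; linarith
      have : 7 / 6 * K / c = B * (7 / 8) := by rw [hB]; ring
      rw [hf', this]
      dsimp only
      gcongr
    have hfpos := hprof.pos ξ hξpos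
    rw [hψ''] at hp₁
    rw [abs_le] at hp₁
    have h1 : (c - ω) * f ξ * (7 / 6 * K / c) ≤ ψ' (1 - f ξ) * f' ξ := by
      have : 0 ≤ (c - ω) * f ξ := mul_nonneg (by linarith) hfpos.le
      exact mul_le_mul (by linarith) hslope (by positivity) (by linarith)
    have h2 : ψ 1 / y - ψ (1 - f ξ) / y ≤ ω * f ξ * (1 / rm) := by
      rw [← sub_div]
      calc (ψ 1 - ψ (1 - f ξ)) / y ≤ |(ψ 1 - ψ (1 - f ξ)) / y| := le_abs_self _
        _ = |ψ (1 - f ξ) - ψ 1| / |y| := by rw [abs_div, abs_sub_comm]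
        _ ≤ ω * f ξ / rm := by gcongr
        _ = _ := by ring
    have h3 : k * f ξ ≤ K * f ξ := by gcongr
    have h4 : 0 ≤ f ξ * (K / 6 - ω * (7 / 6 * K / c + 1 / rm)) :=
      mul_nonneg hfpos.le (by linarith)
    have h5 : (c - ω) * f ξ * (7 / 6 * K / c) - K * f ξ - ω * f ξ * (1 / rm) =
        f ξ * (K / 6 - ω * (7 / 6 * K / c + 1 / rm)) := by
      field_simp; ring
    simp only [barrierDefect, ← hξ]
    linarith
  have hmono : ∀ k ≤ K, ∀ q y x, y < x → q - y ≤ L → (∀ r ∈ Icc y x, rm ≤ |r| ∧ |r| ≤ R₀) →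
      x < q → barrierDefect ψ ψ' f f' k q x ≤ barrierDefect ψ ψ' f f' k q y :=
    fun k hk q y x hyx hL hr hxq => by
      obtain ⟨h, hh⟩ : ∃ h : ℝ → ℝ, ∀ ξ, h ξ =
        ψ' (1 - f ξ) * f' ξ + ψ (1 - f ξ) / (q - ξ) - k * f ξ := ⟨_, fun _ => rfl⟩
      have hdef : ∀ r, barrierDefect ψ ψ' f f' k q r = h (q - r) := fun r => by
        rw [hh, barrierDefect, sub_sub_cancel]
      rw [hdef, hdef]
      have hd : ∀ ξ ∈ Icc (q - x) (q - y), ∃ d, 0 ≤ d ∧ HasDerivAt h d ξ := fun ξ hξ => by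
        obtain ⟨hr1, hr2⟩ := hr (q - ξ) ⟨by linarith [hξ.2], by linarith [hξ.1]⟩
        have hξpos : 0 < ξ := by linarith [hξ.1]
        have hS0 : 0 < √(δ ^ 2 + 2 * δ * max ξ 0) := hδ.trans_le (le_sqrt_profile hδ ξ)
        obtain ⟨⟨hf1, hfω⟩, -, hf1'⟩ := hfL ξ (hξ.2.trans hL)
        obtain ⟨hp₂, hp₁, hp₀⟩ := htol (f ξ) (hfnn ξ) hf1
        rw [hψ''] at hp₁ hp₂
        obtain ⟨e, he⟩ : ∃ e, e = δ / √(δ ^ 2 + 2 * δ * max ξ 0) := ⟨_, rfl⟩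
        have he0 : 0 < e := by rw [he]; positivity
        have hfe : f ξ = B * (δ / e - δ) := by
          rw [hf, sqrtProfile, he]
          field_simp
        have hf'e : f' ξ = B * e := by rw [hf', he]
        refine ⟨_, barrier_slope_nonneg hc hω hωc hK hB hKM hs1.le hrm hr1 hr2 he0
          (by rw [he, div_le_one hS0]; exact le_sqrt_profile hδ ξ) hδ hfe (hfnn ξ) hfω.le hf1'.le
          (p₂ := ψ'' (1 - f ξ)) (p₁ := ψ' (1 - f ξ)) (p₀ := ψ (1 - f ξ))
          (by simpa using hp₂) (by rwa [neg_mul, ← sub_eq_add_neg] at hp₁) hp₀ hk, ?_⟩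
        have hfd := hprof.deriv ξ hξpos
        have hfd' : HasDerivAt f' (-(B * e ^ 3 / δ)) ξ := by
          rw [hf', he]; exact hasDerivAt_deriv_sqrtProfile hδ hξpos
        have hq0 : q - ξ ≠ 0 := fun h0 => by
          rw [h0, abs_zero] at hr1; linarith
        have hone_sub := hfd.const_sub 1
        have h1 := (((hψd' (1 - f ξ)).comp ξ hone_sub).mul hfd')
        have h2 := ((hψd (1 - f ξ)).comp ξ hone_sub).div ((hasDerivAt_id' ξ).const_sub q) hq0
        have h3 := (h1.add h2).sub (hfd.const_mul k)
        rw [show h = fun ξ => ψ' (1 - f ξ) * f' ξ + ψ (1 - f ξ) / (q - ξ) - k * f ξ from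
          funext hh]
        refine h3.congr_deriv ?_
        simp only [Function.comp_apply, hf'e]
        field_simp
        ring
      have hmon : MonotoneOn h (Icc (q - x) (q - y)) := by
        refine monotoneOn_of_deriv_nonneg (convex_Icc _ _) (fun ξ hξ => ?_) (fun ξ hξ => ?_)
          fun ξ hξ => ?_
        · obtain ⟨d, -, h2⟩ := hd ξ hξ
          exact h2.continuousAt.continuousWithinAt
        · obtain ⟨d, -, h2⟩ := hd ξ (interior_subset hξ)
          exact h2.differentiableAt.differentiableWithinAt
        · obtain ⟨d, h1, h2⟩ := hd ξ (interior_subset hξ)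
          rwa [h2.deriv]
      exact hmon ⟨le_rfl, by linarith⟩ ⟨by linarith, le_rfl⟩ (by linarith)
  refine ⟨_, f, f', δ / 8, by positivity, by linarith, hprof, fun ξ hξ => (hfL ξ hξ).2.1,
    fun k hk q y x hyx hL hr => ⟨hmono k hk q y x hyx hL hr, fun hyq hqx => ?_⟩⟩
  have hdiv : ∀ z ∈ Icc y x, ψ 1 / x ≤ ψ 1 / z := fun z hz => by
    rcases lt_or_ge 0 y with h0 | h0
    · exact div_le_div_of_nonneg_left hM.le (h0.trans_le hz.1) hz.2
    · have hx0 : x < 0 := by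
        by_contra! hx0
        have := (hr 0 ⟨h0, hx0⟩).1
        rw [abs_zero] at this
        linarith
      have := div_le_div_of_nonneg_left hM.le (neg_pos.2 hx0) (neg_le_neg hz.2)
      rw [div_neg, div_neg] at this
      linarith
  rcases le_or_gt (q - δ / 8) y with hle | hlt
  · exact (hdiv y ⟨le_rfl, hyx.le⟩).trans
      (hzone k hk q y hL hyq hle (hr y ⟨le_rfl, hyx.le⟩).1)
  · have hmem : q - δ / 8 ∈ Icc y x := ⟨hlt.le, hqx.le⟩
    refine (hdiv _ hmem).trans ((hzone k hk q _ (by linarith) (by linarith) le_rfl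
      (hr _ hmem).1).trans ?_)
    exact hmono k hk q y (q - δ / 8) hlt hL (fun r hr' => hr r ⟨hr'.1, hr'.2.trans hqx.le⟩)
      (by linarith)

/-- A flux `ψ` which is increasing below the critical slope `1`, where it has a
nondegenerate maximum with `ψ''(1) = -c`. -/
structure IsDegenerateFlux (ψ ψ' ψ'' : ℝ → ℝ) (c : ℝ) : Prop where
  deriv : ∀ s, HasDerivAt ψ (ψ' s) s
  deriv' : ∀ s, HasDerivAt ψ' (ψ'' s) s
  cont : ContinuousAt ψ'' 1
  critical : ψ' 1 = 0
  second : ψ'' 1 = -c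
  c_pos : 0 < c
  strictMonoOn : StrictMonoOn ψ (Ioo 0 1)
  isLocalMax : IsLocalMax ψ 1
  pos : 0 < ψ 1

namespace IsRadialSolution

variable {ψ ψ' ψ'' : ℝ → ℝ} {c l R T : ℝ} {u ur ut : ℝ → ℝ → ℝ}

/-- The subcritical region expands to the right at any speed `k ≤ K`. -/
theorem expand_right (hψ : IsDegenerateFlux ψ ψ' ψ'' c) (h : IsRadialSolution ψ l R T u ur ut)
    {K R₀ rm : ℝ} (hK : 0 < K) (hKM : K ^ 2 * R₀ ^ 2 = 2 * ψ 1 * c) (hrm : 0 < rm)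
    (hbd : ∀ r ∈ Ioo l R, rm ≤ |r| ∧ |r| ≤ R₀) {ρ β₁ k s τ : ℝ} (hlρ : l < ρ) (hs : 0 ≤ s)
    (hsτ : s < τ) (hτT : τ < T) (hk : 0 ≤ k) (hkK : k ≤ K) (hβR : β₁ + k * τ < R)
    (hρβ : ρ ≤ β₁ + k * s) (hsub : ∀ t ∈ Ico s τ, ∀ r ∈ Icc ρ (β₁ + k * t), ur r t < 1)
    (hρ : ur ρ τ < 1) : ∀ r ∈ Icc ρ (β₁ + k * τ), ur r τ < 1 := by
  have hkmono : ∀ {t t'}, t ≤ t' → β₁ + k * t ≤ β₁ + k * t' := fun htt => by gcongr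
  have hρR : ρ < R := by linarith [hkmono hsτ.le]
  obtain ⟨tm, htm, hmax⟩ := isCompact_Icc.exists_isMaxOn (nonempty_Icc.2 hsτ.le)
    ((h.continuousOn_ur_time ⟨hlρ, hρR⟩).mono
      (fun t (ht : t ∈ Icc s τ) => ⟨hs.trans ht.1, ht.2.trans_lt hτT⟩))
  rw [isMaxOn_iff] at hmax
  have hθ : ur ρ tm < 1 := by
    rcases htm.2.lt_or_eq with hlt | rfl
    · exact hsub tm ⟨htm.1, hlt⟩ ρ ⟨le_rfl, hρβ.trans (hkmono htm.1)⟩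
    · exact hρ
  have hsI : s ∈ Ico 0 T := ⟨hs, hsτ.trans hτT⟩
  have hβs : β₁ + k * s ∈ Ioo l R := ⟨hlρ.trans_le hρβ, (hkmono hsτ.le).trans_lt hβR⟩
  have hnear : ∀ᶠ r in 𝓝[≥] (β₁ + k * s), ur r s < 1 :=
    nhdsWithin_le_nhds ((h.continuousAt_ur hβs hsI).eventually
      (gt_mem_nhds (hsub s ⟨le_rfl, hsτ⟩ _ ⟨hρβ, le_rfl⟩)))
  obtain ⟨d, hd, hd'⟩ := mem_nhdsGE_iff_exists_Ico_subset.1 hnear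
  obtain ⟨e, he, hed⟩ := exists_between
    (show 0 < min (d - (β₁ + k * s)) (R - (β₁ + k * τ)) from
      lt_min (sub_pos.2 hd) (sub_pos.2 hβR))
  rw [lt_min_iff] at hed
  obtain ⟨rM, hrM, hmax'⟩ := isCompact_Icc.exists_isMaxOn
    (nonempty_Icc.2 (show ρ ≤ β₁ + k * s + e by linarith))
    (fun r (hr : r ∈ Icc ρ (β₁ + k * s + e)) => (h.continuousAt_ur (r := r)
      ⟨hlρ.trans_le hr.1, by linarith [hr.2, hkmono hsτ.le]⟩ hsI).continuousWithinAt)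
  rw [isMaxOn_iff] at hmax'
  have hθ' : ur rM s < 1 := by
    rcases le_total rM (β₁ + k * s) with hle | hle
    · exact hsub s ⟨le_rfl, hsτ⟩ rM ⟨hrM.1, hle⟩
    · exact hd' ⟨hle, by linarith [hrM.2]⟩
  obtain ⟨F, f, f', σ, hσ, hσε, hf, hfε, hbar⟩ := exists_barrier (R₀ := R₀) hψ.deriv hψ.deriv'
    hψ.cont hψ.critical hψ.c_pos hψ.second hψ.pos hK hKM hrm (L := β₁ + k * τ + e - ρ)
    (ε := min (min (e / 2) 1) (min (1 - ur ρ tm) (1 - ur rM s)))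
    (lt_min (lt_min (by linarith) one_pos) (lt_min (by linarith) (by linarith)))
  simp only [lt_min_iff, le_min_iff] at hσε hfε
  have hbar' : ∀ t ≤ τ, ∀ y x, ρ ≤ y → y < x → x ≤ β₁ + k * τ + e →
      (x < β₁ + σ + k * t → barrierDefect ψ ψ' f f' k (β₁ + σ + k * t) x ≤
        barrierDefect ψ ψ' f f' k (β₁ + σ + k * t) y) ∧
      (y < β₁ + σ + k * t → β₁ + σ + k * t - σ < x →
        ψ 1 / x ≤ barrierDefect ψ ψ' f f' k (β₁ + σ + k * t) y) := fun t ht y x h1 h2 h3 =>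
    hbar k hkK _ y x h2 (by linarith [hkmono ht]) fun r hr => hbd r
      ⟨by linarith [hr.1], by linarith [hr.2]⟩
  have hmain : ∀ t ∈ Ico s τ, ∀ r, ρ ≤ r → r < β₁ + σ + k * t →
      ur r t ≤ 1 - f (β₁ + σ + k * t - r) := fun t ht r hr1 hr2 => by
    have hle : ∀ {t'}, t' ∈ Icc s t → t' ≤ τ := fun ht' => ht'.2.trans ht.2.le
    refine h.le_barrier hψ.deriv hψ.strictMonoOn hψ.isLocalMax hf hlρ
      (b := β₁ + k * τ + e) (σ := σ) (by linarith) hs ht.1 (ht.2.trans hτT)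
      (fun t' ht' => by linarith [hkmono (hle ht')])
      (fun t' ht' x hx => (hfε _ (by linarith [hkmono (hle ht'), hx.1])).1.2)
      (fun t' ht' y x h1 h2 h3 => (hbar' t' (hle ht') y x h1 h2 h3).2)
      (fun t' ht' y x h1 h2 h3 => (hbar' t' (hle ht') y x h1 h2 h3).1)
      (fun t' ht' x hx hx' => hsub t' ⟨ht'.1, ht'.2.trans_lt ht.2⟩ x ⟨hx.1, by linarith⟩)
      (fun t' ht' => ?_) (fun x hx hx' => ?_) hr1 hr2
    · linarith [(hfε (β₁ + σ + k * t' - ρ) (by linarith [hkmono (hle ht')])).2.1,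
        hmax t' ⟨ht'.1, hle ht'⟩]
    · linarith [(hfε (β₁ + σ + k * s - x) (by linarith [hkmono hsτ.le, hx.1])).2.2,
        hmax' x ⟨hx.1, by linarith⟩]
  intro r hr
  have hlim1 : Tendsto (fun t => ur r t) (𝓝[<] τ) (𝓝 (ur r τ)) :=
    ((h.continuousOn_ur_time ⟨hlρ.trans_le hr.1, hr.2.trans_lt hβR⟩).continuousAt
      (Ico_mem_nhds (hs.trans_lt hsτ) hτT)).tendsto.mono_left nhdsWithin_le_nhds
  have hlim2 : Tendsto (fun t => 1 - f (β₁ + σ + k * t - r)) (𝓝[<] τ)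
      (𝓝 (1 - f (β₁ + σ + k * τ - r))) := by
    have := hf.cont
    exact (Continuous.tendsto (by fun_prop) τ).mono_left nhdsWithin_le_nhds
  have hlim3 : ∀ᶠ t in 𝓝[<] τ, r < β₁ + σ + k * t :=
    nhdsWithin_le_nhds ((Continuous.tendsto (by fun_prop) τ).eventually
      (lt_mem_nhds (by linarith [hr.2])))
  have := le_of_tendsto_of_tendsto hlim1 hlim2 (by
    filter_upwards [hlim3, Ico_mem_nhdsLT hsτ] with t h1 h2 using hmain t h2 r hr.1 h1)
  linarith [hf.pos (β₁ + σ + k * τ - r) (by linarith [hr.2])]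

theorem reflect (h : IsRadialSolution ψ l R T u ur ut) :
    IsRadialSolution ψ (-R) (-l) T (fun r t => -u (-r) t) (fun r t => ur (-r) t)
      (fun r t => -ut (-r) t) := by
  have hI : ∀ {r}, r ∈ Ioo (-R) (-l) → -r ∈ Ioo l R := fun hr =>
    ⟨by linarith [hr.2], by linarith [hr.1]⟩
  have key : ∀ {g : ℝ → ℝ} {g' x : ℝ}, HasDerivAt g g' (-x) →
      HasDerivAt (fun x => g (-x)) (-g') x := fun {g g' x} hg => by
    simpa [Function.comp_def] using hg.comp x (hasDerivAt_neg x)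
  have hmaps : MapsTo (fun p : ℝ × ℝ => (-p.1, p.2)) (Ioo (-R) (-l) ×ˢ Ico 0 T)
      (Ioo l R ×ˢ Ico 0 T) := fun p hp => ⟨hI hp.1, hp.2⟩
  refine ⟨fun r hr t ht => ?_, fun r hr t ht => ?_, ?_, ?_, ?_, fun r hr t ht => ?_⟩
  · simpa using (key (h.deriv_r _ (hI hr) t ht)).fun_neg
  · exact (h.deriv_t _ (hI hr) t ht).fun_neg
  · exact (h.cont.comp (by fun_prop) hmaps).neg
  · exact h.cont_r.comp (by fun_prop) hmaps
  · exact (h.cont_t.comp (by fun_prop) hmaps).neg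
  · refine (key (h.eqn _ (hI hr) t ht)).congr_deriv ?_
    rw [div_neg]; ring

theorem neg (h : IsRadialSolution ψ l R T u ur ut) (hodd : ∀ s, ψ (-s) = -ψ s) :
    IsRadialSolution ψ l R T (fun r t => -u r t) (fun r t => -ur r t) (fun r t => -ut r t) where
  deriv_r r hr t ht := (h.deriv_r r hr t ht).fun_neg
  deriv_t r hr t ht := (h.deriv_t r hr t ht).fun_neg
  cont := h.cont.neg
  cont_r := h.cont_r.neg
  cont_t := h.cont_t.neg
  eqn r hr t ht := by
    simp only [hodd]
    exact (h.eqn r hr t ht).fun_neg.congr_deriv (by ring)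

theorem expand_left (hψ : IsDegenerateFlux ψ ψ' ψ'' c) (h : IsRadialSolution ψ l R T u ur ut)
    {K R₀ rm : ℝ} (hK : 0 < K) (hKM : K ^ 2 * R₀ ^ 2 = 2 * ψ 1 * c) (hrm : 0 < rm)
    (hbd : ∀ r ∈ Ioo l R, rm ≤ |r| ∧ |r| ≤ R₀) {ρ α₁ k s τ : ℝ} (hρR : ρ < R) (hs : 0 ≤ s)
    (hsτ : s < τ) (hτT : τ < T) (hk : 0 ≤ k) (hkK : k ≤ K) (hlα : l < α₁ - k * τ)
    (hαρ : α₁ - k * s ≤ ρ) (hsub : ∀ t ∈ Ico s τ, ∀ r ∈ Icc (α₁ - k * t) ρ, ur r t < 1)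
    (hρ : ur ρ τ < 1) : ∀ r ∈ Icc (α₁ - k * τ) ρ, ur r τ < 1 := fun r hr => by
  have := h.reflect.expand_right hψ hK hKM hrm
    (fun x hx => by
      simpa using hbd (-x) ⟨by linarith [hx.2], by linarith [hx.1]⟩)
    (ρ := -ρ) (β₁ := -α₁) (k := k) (by linarith) hs hsτ hτT hk hkK (by linarith) (by linarith)
    (fun t ht x hx => hsub t ht (-x) ⟨by linarith [hx.2], by linarith [hx.1]⟩)
    (by simpa using hρ) (-r) ⟨by linarith [hr.2], by linarith [hr.1]⟩
  simpa using this

theorem ut_eq_of_ur_eq_one (hψ : IsLocalMax ψ 1) (h : IsRadialSolution ψ l R T u ur ut)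
    {r t : ℝ} (hr : r ∈ Ioo l R) (ht : t ∈ Ico 0 T) (hrt : ur r t = 1) : ut r t = ψ 1 / r := by
  have h1 : IsLocalMax (fun x => ψ (ur x t)) r := by
    have : ∀ᶠ y in 𝓝 (ur r t), ψ y ≤ ψ (ur r t) := by rw [hrt]; exact hψ
    exact (h.continuousAt_ur hr ht).eventually this
  have := h1.hasDerivAt_eq_zero (h.eqn r hr t ht)
  rw [hrt] at this
  linarith

/-- A solution that has been subcritical up to time `τ` cannot become critical on a whole
interval at time `τ`. -/
theorem exists_ur_ne_one (hψ : IsLocalMax ψ 1) (hM : 0 < ψ 1)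
    (h : IsRadialSolution ψ l R T u ur ut) (h0 : 0 ∉ Ioo l R) {y x s τ : ℝ} (hly : l < y)
    (hyx : y < x) (hxR : x < R) (hs : 0 ≤ s) (hsτ : s < τ) (hτT : τ < T)
    (hsub : ∀ t ∈ Ico s τ, ∀ r ∈ Icc y x, ur r t < 1) : ∃ r ∈ Icc y x, ur r τ ≠ 1 := by
  by_contra! hone
  have hI : ∀ {r}, r ∈ Icc y x → r ∈ Ioo l R := fun hr =>
    ⟨hly.trans_le hr.1, hr.2.trans_lt hxR⟩
  have hyI : y ∈ Icc y x := ⟨le_rfl, hyx.le⟩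
  have hxI : x ∈ Icc y x := ⟨hyx.le, le_rfl⟩
  have hτ : τ ∈ Ioo 0 T := ⟨hs.trans_lt hsτ, hτT⟩
  have hmvt : ∀ t ∈ Ico 0 T, ∃ r ∈ Icc y x, u x t - u y t = ur r t * (x - y) := fun t ht => by
    obtain ⟨r, hr, hr'⟩ := exists_hasDerivAt_eq_slope (fun r => u r t) (fun r => ur r t) hyx
      (fun r hr => (h.deriv_r r (hI hr) t ht).continuousAt.continuousWithinAt)
      (fun r hr => h.deriv_r r (hI ⟨hr.1.le, hr.2.le⟩) t ht)
    exact ⟨r, ⟨hr.1.le, hr.2.le⟩, by rw [hr', div_mul_cancel₀ _ (sub_pos.2 hyx).ne']⟩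
  have hd := ((h.hasDerivAt_t (hI hxI) hτ).fun_sub (h.hasDerivAt_t (hI hyI) hτ)).fun_neg
  have h1 := hd.nonpos_of_left_min (Eventually.frequently (by
    filter_upwards [Ico_mem_nhdsLT hsτ] with t ht
    obtain ⟨r₁, hr₁, h1⟩ := hmvt t ⟨hs.trans ht.1, ht.2.trans hτT⟩
    obtain ⟨r₂, hr₂, h2⟩ := hmvt τ ⟨hτ.1.le, hτ.2⟩
    rw [h1, h2, hone r₂ hr₂]
    have := mul_lt_mul_of_pos_right (hsub t ht r₁ hr₁) (sub_pos.2 hyx)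
    linarith))
  rw [h.ut_eq_of_ur_eq_one hψ (hI hxI) ⟨hτ.1.le, hτ.2⟩ (hone x hxI),
    h.ut_eq_of_ur_eq_one hψ (hI hyI) ⟨hτ.1.le, hτ.2⟩ (hone y hyI)] at h1
  rcases lt_or_ge 0 y with hy | hy
  · linarith [div_lt_div_of_pos_left hM hy hyx]
  · have hx : x < 0 := by
      by_contra! hx
      exact h0 (hI ⟨hy, hx⟩)
    have := div_lt_div_of_pos_left hM (neg_pos.2 hx) (neg_lt_neg hyx)
    rw [div_neg, div_neg] at this
    linarith

theorem ur_lt_one_of_cone (hψ : IsDegenerateFlux ψ ψ' ψ'' c)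
    (h : IsRadialSolution ψ l R T u ur ut) {K R₀ rm : ℝ} (hK : 0 < K)
    (hKM : K ^ 2 * R₀ ^ 2 = 2 * ψ 1 * c) (hrm : 0 < rm)
    (hbd : ∀ r ∈ Ioo l R, rm ≤ |r| ∧ |r| ≤ R₀) {α₁ β₁ kl kr τ : ℝ} (hαβ : α₁ < β₁)
    (hτ : 0 ≤ τ) (hτT : τ < T) (hkl : kl ∈ Icc 0 K) (hkr : kr ∈ Icc 0 K)
    (hlα : l < α₁ - kl * τ) (hβR : β₁ + kr * τ < R) (hinit : ∀ r ∈ Icc α₁ β₁, ur r 0 < 1) :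
    ∀ r ∈ Icc (α₁ - kl * τ) (β₁ + kr * τ), ur r τ < 1 := by
  intro r hr
  by_contra! hge
  have hα : ∀ {t t'}, t ≤ t' → α₁ - kl * t' ≤ α₁ - kl * t := fun htt => by
    have := mul_le_mul_of_nonneg_left htt hkl.1
    linarith
  have hβ : ∀ {t t'}, t ≤ t' → β₁ + kr * t ≤ β₁ + kr * t' := fun htt => by
    have := mul_le_mul_of_nonneg_left htt hkr.1
    linarith
  have hI : ∀ {t r}, t ≤ τ → r ∈ Icc (α₁ - kl * t) (β₁ + kr * t) → r ∈ Ioo l R := fun ht hr =>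
    ⟨hlα.trans_le ((hα ht).trans hr.1), (hr.2.trans (hβ ht)).trans_lt hβR⟩
  obtain ⟨B, hB⟩ : ∃ B : Set (ℝ × ℝ), B = {p | α₁ - kl * p.2 ≤ p.1} ∩
    ({p | p.1 ≤ β₁ + kr * p.2} ∩ ({p | 0 ≤ p.2} ∩ {p | p.2 ≤ τ})) := ⟨_, rfl⟩
  have hBmem : ∀ p, p ∈ B ↔ α₁ - kl * p.2 ≤ p.1 ∧ p.1 ≤ β₁ + kr * p.2 ∧ 0 ≤ p.2 ∧ p.2 ≤ τ :=
    fun p => by rw [hB]; rfl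
  have hBcl : IsClosed B := by
    rw [hB]
    exact (isClosed_le (by fun_prop) (by fun_prop)).inter ((isClosed_le (by fun_prop)
      (by fun_prop)).inter ((isClosed_le (by fun_prop) (by fun_prop)).inter
      (isClosed_le (by fun_prop) (by fun_prop))))
  have hcont : ContinuousOn (fun p : ℝ × ℝ => ur p.1 p.2) B :=
    h.cont_r.mono fun p hp => by
      rw [hBmem] at hp
      exact ⟨hI hp.2.2.2 ⟨hp.1, hp.2.1⟩, hp.2.2.1, hp.2.2.2.trans_lt hτT⟩
  have hZ : IsCompact {p | p ∈ B ∧ 1 ≤ ur p.1 p.2} := by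
    refine (isCompact_Icc.prod isCompact_Icc).of_isClosed_subset
      (s := Icc (α₁ - kl * τ) (β₁ + kr * τ) ×ˢ Icc 0 τ)
      (hBcl.isClosed_le continuousOn_const hcont) fun p hp => ?_
    obtain ⟨h1, h2, h3, h4⟩ := (hBmem p).1 hp.1
    exact ⟨⟨(hα h4).trans h1, h2.trans (hβ h4)⟩, h3, h4⟩
  obtain ⟨⟨x, t⟩, ⟨hxt, hx1⟩, hmin⟩ := hZ.exists_isMinOn (f := fun p => p.2)
    ⟨(r, τ), (hBmem _).2 ⟨hr.1, hr.2, hτ, le_rfl⟩, hge⟩ (by fun_prop)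
  rw [isMinOn_iff] at hmin
  simp only at hmin hx1
  obtain ⟨hαx, hxβ, ht0, htτ⟩ := (hBmem _).1 hxt
  simp only at hαx hxβ ht0 htτ
  have hbelow : ∀ t' ∈ Ico 0 t, ∀ r ∈ Icc (α₁ - kl * t') (β₁ + kr * t'), ur r t' < 1 :=
    fun t' ht' r hr => by
      by_contra! hle
      exact absurd (hmin (r, t') ⟨(hBmem _).2 ⟨hr.1, hr.2, ht'.1, ht'.2.le.trans htτ⟩, hle⟩)
        (not_le.2 ht'.2)
  have htpos : 0 < t := by
    refine ht0.lt_of_ne fun heq => ?_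
    subst heq
    exact absurd hx1 (not_le.2 (hinit x ⟨by linarith, by linarith⟩))
  have htT : t < T := htτ.trans_lt hτT
  have hnear : ∀ ρ ∈ Ioo (α₁ - kl * t) (β₁ + kr * t), ∀ ρ' ∈ Ioo (α₁ - kl * t) (β₁ + kr * t),
      ∃ s, 0 ≤ s ∧ s < t ∧ α₁ - kl * s ≤ ρ ∧ ρ' ≤ β₁ + kr * s := fun ρ hρ ρ' hρ' => by
    have h1 : ∀ᶠ s in 𝓝[<] t, α₁ - kl * s < ρ := nhdsWithin_le_nhds
      ((Continuous.tendsto (by fun_prop) t).eventually (gt_mem_nhds hρ.1))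
    have h2 : ∀ᶠ s in 𝓝[<] t, ρ' < β₁ + kr * s := nhdsWithin_le_nhds
      ((Continuous.tendsto (by fun_prop) t).eventually (lt_mem_nhds hρ'.2))
    have h3 : ∀ᶠ s in 𝓝[<] t, s ∈ Ico 0 t := Ico_mem_nhdsLT htpos
    obtain ⟨s, h4, h5, h6⟩ := (h1.and (h2.and h3)).exists
    exact ⟨s, h6.1, h6.2, h4.le, h5.le⟩
  have hρ : ∃ ρ ∈ Ioo (α₁ - kl * t) (β₁ + kr * t), ur ρ t < 1 := by
    obtain ⟨y, hy, hy'⟩ := exists_between (show α₁ - kl * t < β₁ + kr * t by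
      linarith [mul_nonneg hkl.1 ht0, mul_nonneg hkr.1 ht0])
    obtain ⟨z, hz, hz'⟩ := exists_between hy'
    obtain ⟨s, hs, hst, h1, h2⟩ := hnear y ⟨hy, hy'⟩ z ⟨hy.trans hz, hz'⟩
    have hsub : ∀ t' ∈ Ico s t, ∀ r ∈ Icc y z, ur r t' < 1 := fun t' ht' r hr =>
      hbelow t' ⟨hs.trans ht'.1, ht'.2⟩ r
        ⟨(hα ht'.1).trans (h1.trans hr.1), (hr.2.trans h2).trans (hβ ht'.1)⟩
    have hyl := hI htτ ⟨hy.le, hy'.le⟩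
    have hzl := hI htτ ⟨(hy.trans hz).le, hz'.le⟩
    obtain ⟨ρ, hρ, hne⟩ := h.exists_ur_ne_one hψ.isLocalMax hψ.pos
      (fun h0 => by have := (hbd 0 h0).1; rw [abs_zero] at this; linarith)
      hyl.1 hz hzl.2 hs hst htT hsub
    refine ⟨ρ, ⟨hy.trans_le hρ.1, hρ.2.trans_lt hz'⟩, lt_of_le_of_ne ?_ hne⟩
    have hlim : Tendsto (fun t => ur ρ t) (𝓝[<] t) (𝓝 (ur ρ t)) :=
      ((h.continuousOn_ur_time ⟨hyl.1.trans_le hρ.1, hρ.2.trans_lt hzl.2⟩).continuousAt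
        (Ico_mem_nhds htpos htT)).tendsto.mono_left nhdsWithin_le_nhds
    refine le_of_tendsto hlim ?_
    filter_upwards [Ico_mem_nhdsLT hst] with t' ht' using (hsub t' ht' ρ hρ).le
  obtain ⟨ρ, hρ, hρ1⟩ := hρ
  obtain ⟨s, hs, hst, h1, h2⟩ := hnear ρ hρ ρ hρ
  have hρI := hI htτ ⟨hρ.1.le, hρ.2.le⟩
  refine absurd hx1 (not_le.2 ?_)
  rcases le_total ρ x with hle | hle
  · exact h.expand_right hψ hK hKM hrm hbd hρI.1 hs hst htT hkr.1 hkr.2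
      ((hβ htτ).trans_lt hβR) h2 (fun t' ht' r hr => hbelow t' ⟨hs.trans ht'.1, ht'.2⟩ r
        ⟨(hα ht'.1).trans (h1.trans hr.1), hr.2⟩) hρ1 x ⟨hle, hxβ⟩
  · exact h.expand_left hψ hK hKM hrm hbd hρI.2 hs hst htT hkl.1 hkl.2
      (hlα.trans_le (hα htτ)) h1 (fun t' ht' r hr => hbelow t' ⟨hs.trans ht'.1, ht'.2⟩ r
        ⟨hr.1, (hr.2.trans h2).trans (hβ ht'.1)⟩) hρ1 x ⟨hαx, hle⟩

theorem ur_lt_one (hψ : IsDegenerateFlux ψ ψ' ψ'' c) (h : IsRadialSolution ψ l R T u ur ut)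
    {K R₀ rm : ℝ} (hK : 0 < K) (hKM : K ^ 2 * R₀ ^ 2 = 2 * ψ 1 * c) (hrm : 0 < rm)
    (hbd : ∀ r ∈ Ioo l R, rm ≤ |r| ∧ |r| ≤ R₀) {r₃ r₄ : ℝ} (hl : l ≤ r₃) (h34 : r₃ < r₄)
    (hR : r₄ ≤ R) (hinit : ∀ r ∈ Ioo r₃ r₄, ur r 0 < 1) {r t : ℝ} (hr : r ∈ Ioo l R)
    (ht : t ∈ Ico 0 T) (h3 : r₃ - K * t < r) (h4 : r < r₄ + K * t) : ur r t < 1 := by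
  rcases ht.1.eq_or_lt with rfl | htpos
  · exact hinit r ⟨by linarith, by linarith⟩
  obtain ⟨α₁, hα1, hα2⟩ := exists_between
    (show r₃ < min ((r₃ + r₄) / 2) (r + K * t) from lt_min (by linarith) (by linarith))
  obtain ⟨β₁, hβ1, hβ2⟩ := exists_between
    (show max ((r₃ + r₄) / 2) (r - K * t) < r₄ from max_lt (by linarith) (by linarith))
  rw [lt_min_iff] at hα2
  rw [max_lt_iff] at hβ1
  have hspeed : ∀ d, d ≤ K * t → max d 0 / t ∈ Icc 0 K ∧ max d 0 / t * t = max d 0 :=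
    fun d hd => ⟨⟨by positivity, by
      rw [div_le_iff₀ htpos]
      exact max_le hd (by positivity)⟩, div_mul_cancel₀ _ htpos.ne'⟩
  obtain ⟨hkl, hkl'⟩ := hspeed (α₁ - r) (by linarith)
  obtain ⟨hkr, hkr'⟩ := hspeed (r - β₁) (by linarith)
  refine h.ur_lt_one_of_cone hψ hK hKM hrm hbd (α₁ := α₁) (β₁ := β₁) (by linarith) ht.1 ht.2
    hkl hkr ?_ ?_ (fun x hx => hinit x ⟨by linarith [hx.1], by linarith [hx.2]⟩) r ⟨?_, ?_⟩
  · rw [hkl']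
    rcases max_cases (α₁ - r) 0 with ⟨h1, -⟩ | ⟨h1, -⟩ <;> rw [h1] <;> linarith [hr.1]
  · rw [hkr']
    rcases max_cases (r - β₁) 0 with ⟨h1, -⟩ | ⟨h1, -⟩ <;> rw [h1] <;> linarith [hr.2]
  · rw [hkl']
    linarith [le_max_left (α₁ - r) 0]
  · rw [hkr']
    linarith [le_max_left (r - β₁) 0]

end IsRadialSolution

theorem isDegenerateFlux_deriv {φ : ℝ → ℝ} (hφ : ContDiff ℝ (⊤ : ℕ∞) φ)
    (hφeven : ∀ σ : ℝ, φ (-σ) = φ σ)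
    (hφ2pos : ∀ σ : ℝ, 0 ≤ σ → σ < 1 → 0 < deriv (deriv φ) σ)
    (hφ2one : deriv (deriv φ) 1 = 0)
    (hφ2neg : ∀ σ : ℝ, 1 < σ → deriv (deriv φ) σ < 0)
    (hφ3neg : deriv (deriv (deriv φ)) 1 < 0) :
    (∀ s, deriv φ (-s) = -deriv φ s) ∧
    IsDegenerateFlux (deriv φ) (deriv (deriv φ)) (deriv (deriv (deriv φ)))
      |deriv (deriv (deriv φ)) 1| := by
  have h1 : ContDiff ℝ (⊤ : ℕ∞) (deriv φ) := (contDiff_infty_iff_deriv.1 hφ).2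
  have h2 : ContDiff ℝ (⊤ : ℕ∞) (deriv (deriv φ)) := (contDiff_infty_iff_deriv.1 h1).2
  have h3 : ContDiff ℝ (⊤ : ℕ∞) (deriv (deriv (deriv φ))) := (contDiff_infty_iff_deriv.1 h2).2
  have hodd : ∀ s, deriv φ (-s) = -deriv φ s := fun s => by
    have h4 := deriv_comp_neg φ s
    rw [funext hφeven] at h4
    linarith
  have hmono : StrictMonoOn (deriv φ) (Icc 0 1) :=
    strictMonoOn_of_deriv_pos (convex_Icc 0 1) h1.continuous.continuousOn fun x hx => by
      rw [interior_Icc] at hx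
      exact hφ2pos x hx.1.le hx.2
  have hanti : StrictAntiOn (deriv φ) (Ici 1) :=
    strictAntiOn_of_deriv_neg (convex_Ici 1) h1.continuous.continuousOn fun x hx => by
      rw [interior_Ici] at hx
      exact hφ2neg x hx
  have hzero : deriv φ 0 = 0 := by
    have := hodd 0
    rw [neg_zero] at this
    linarith
  refine ⟨hodd, fun s => (h1.differentiable (by simp) s).hasDerivAt,
    fun s => (h2.differentiable (by simp) s).hasDerivAt, h3.continuous.continuousAt, hφ2one,
    by rw [abs_of_neg hφ3neg, neg_neg], abs_pos.2 hφ3neg.ne, hmono.mono Ioo_subset_Icc_self,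
    ?_, ?_⟩
  · filter_upwards [lt_mem_nhds (zero_lt_one (α := ℝ))] with x hx
    rcases le_total x 1 with hle | hle
    · exact hmono.monotoneOn ⟨hx.le, hle⟩ ⟨zero_le_one, le_rfl⟩ hle
    · exact hanti.antitoneOn (mem_Ici.2 le_rfl) (mem_Ici.2 hle) hle
  · rw [← hzero]
    exact hmono ⟨le_rfl, zero_le_one⟩ ⟨zero_le_one, le_rfl⟩ zero_lt_one

end

/-- Theorem 1.2 / `thm:PMR`.
For a radial `C¹` solution of `u_t = (φ'(u_r))_r + φ'(u_r)/r` (dimension `n = 2`)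
on `(r₁,r₂)×[0,T)` which is subcritical on `(r₃,r₄)` at time `0`, the subcritical
region expands at least at rate `k₀ = r₂⁻¹ √(2 φ'(1) |φ'''(1)|)`: the solution is
subcritical on the whole region `𝒟 = {(r,t) : r₃ - k₀ t < r < r₄ + k₀ t}`. -/
theorem subcritical_region_expands_radial
    (φ : ℝ → ℝ) (hφ : ContDiff ℝ (⊤ : ℕ∞) φ) (hφeven : ∀ σ : ℝ, φ (-σ) = φ σ)
    (hφ2pos : ∀ σ : ℝ, 0 ≤ σ → σ < 1 → 0 < deriv (deriv φ) σ)
    (hφ2one : deriv (deriv φ) 1 = 0)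
    (hφ2neg : ∀ σ : ℝ, 1 < σ → deriv (deriv φ) σ < 0)
    (hφ3neg : deriv (deriv (deriv φ)) 1 < 0)
    (r₁ r₂ r₃ r₄ T : ℝ)
    (hr₁ : 0 < r₁) (h13 : r₁ ≤ r₃) (h34 : r₃ < r₄) (h42 : r₄ ≤ r₂) (hT : 0 < T)
    (u ur ut : ℝ → ℝ → ℝ)
    -- `u` is of class `C¹` on `(r₁,r₂)×[0,T)`: the partial derivatives exist ...
    (hur : ∀ r t : ℝ, r ∈ Set.Ioo r₁ r₂ → t ∈ Set.Ico 0 T →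
      HasDerivAt (fun ρ => u ρ t) (ur r t) r)
    (hut : ∀ r t : ℝ, r ∈ Set.Ioo r₁ r₂ → t ∈ Set.Ico 0 T →
      HasDerivWithinAt (fun s => u r s) (ut r t) (Set.Ico 0 T) t)
    -- ... and `u`, `u_r`, `u_t` are continuous on `(r₁,r₂)×[0,T)`
    (huC : ContinuousOn (fun p : ℝ × ℝ => u p.1 p.2) (Set.Ioo r₁ r₂ ×ˢ Set.Ico 0 T))
    (hurC : ContinuousOn (fun p : ℝ × ℝ => ur p.1 p.2) (Set.Ioo r₁ r₂ ×ˢ Set.Ico 0 T))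
    (hutC : ContinuousOn (fun p : ℝ × ℝ => ut p.1 p.2) (Set.Ioo r₁ r₂ ×ˢ Set.Ico 0 T))
    -- the radial equation `u_t = (φ'(u_r))_r + φ'(u_r)/r`: the map
    -- `r ↦ φ'(u_r(r,t))` is differentiable with derivative `u_t(r,t) - φ'(u_r(r,t))/r`
    (heq : ∀ r t : ℝ, r ∈ Set.Ioo r₁ r₂ → t ∈ Set.Ico 0 T →
      HasDerivAt (fun ρ => deriv φ (ur ρ t)) (ut r t - deriv φ (ur r t) / r) r)
    -- the initial datum is subcritical on `(r₃,r₄)`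
    (hinit : ∀ r ∈ Set.Ioo r₃ r₄, |ur r 0| < 1) :
    ∀ r t : ℝ, r ∈ Set.Ioo r₁ r₂ → t ∈ Set.Ico 0 T →
      r₃ - Real.sqrt (2 * deriv φ 1 * |deriv (deriv (deriv φ)) 1|) / r₂ * t < r →
      r < r₄ + Real.sqrt (2 * deriv φ 1 * |deriv (deriv (deriv φ)) 1|) / r₂ * t →
      |ur r t| < 1 := by
  obtain ⟨hodd, hψ⟩ := isDegenerateFlux_deriv hφ hφeven hφ2pos hφ2one hφ2neg hφ3neg
  have hr₂ : 0 < r₂ := by linarith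
  have hMc : 0 < 2 * deriv φ 1 * |deriv (deriv (deriv φ)) 1| :=
    mul_pos (mul_pos two_pos hψ.pos) hψ.c_pos
  have hsol : IsRadialSolution (deriv φ) r₁ r₂ T u ur ut :=
    ⟨fun r hr t ht => hur r t hr ht, fun r hr t ht => hut r t hr ht, huC, hurC, hutC,
      fun r hr t ht => heq r t hr ht⟩
  have hK : 0 < √(2 * deriv φ 1 * |deriv (deriv (deriv φ)) 1|) / r₂ :=
    div_pos (Real.sqrt_pos.2 hMc) hr₂
  have hKM : (√(2 * deriv φ 1 * |deriv (deriv (deriv φ)) 1|) / r₂) ^ 2 * r₂ ^ 2 =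
      2 * deriv φ 1 * |deriv (deriv (deriv φ)) 1| := by
    rw [div_pow, Real.sq_sqrt hMc.le, div_mul_cancel₀ _ (by positivity)]
  have hbd : ∀ r ∈ Set.Ioo r₁ r₂, r₁ ≤ |r| ∧ |r| ≤ r₂ := fun r hr => by
    rw [abs_of_pos (hr₁.trans hr.1)]
    exact ⟨hr.1.le, hr.2.le⟩
  intro r t hr ht h3 h4
  rw [abs_lt]
  constructor
  · have := (hsol.neg hodd).ur_lt_one hψ hK hKM hr₁ hbd h13 h34 h42
      (fun x hx => by linarith [(abs_lt.1 (hinit x hx)).1]) hr ht h3 h4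
    linarith
  · exact hsol.ur_lt_one hψ hK hKM hr₁ hbd h13 h34 h42 (fun x hx => (abs_lt.1 (hinit x hx)).2)
      hr ht h3 h4
end

section
/- Let 0 < r₁ ≤ r₃ < r₄ ≤ r₂ and T > 0 be real numbers. Let u ∈ C¹((r₁,r₂)×[0,T)) be a classical solution of the radial equation u_t = (φ'(u_r))_r + φ'(u_r)/r on (r₁,r₂)×[0,T), and assume |u_r(r,0)| < 1 for all r ∈ (r₃,r₄). Set k₀ := r₂⁻¹·√(2·φ'(1)·|φ'''(1)|). Then for every t ∈ [0,T) with t > (r₂ − r₁)/k₀ one has |u_r(r,t)| < 1 for every r ∈ (r₁,r₂); that is, the subcritical region covers the whole domain after the time (r₂−r₁)/k₀, which depends only on r₁, r₂ and φ. -/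
open Set Filter Topology

/-- `u` is a classical solution of `u_t = (f(u_r))_r + f(u_r)/r` on `(r₁,r₂)×[0,T)`, with
space derivative `ur` and time derivative `ut`. -/
structure IsRadialSolution_s3 (f : ℝ → ℝ) (r₁ r₂ T : ℝ) (u ur ut : ℝ → ℝ → ℝ) : Prop where
  hasDerivAt_space : ∀ r t : ℝ, r ∈ Ioo r₁ r₂ → t ∈ Ico 0 T →
    HasDerivAt (fun ρ => u ρ t) (ur r t) r
  hasDerivWithinAt_time : ∀ r t : ℝ, r ∈ Ioo r₁ r₂ → t ∈ Ico 0 T →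
    HasDerivWithinAt (fun s => u r s) (ut r t) (Ico 0 T) t
  continuousOn : ContinuousOn (fun p : ℝ × ℝ => u p.1 p.2) (Ioo r₁ r₂ ×ˢ Ico 0 T)
  continuousOn_space : ContinuousOn (fun p : ℝ × ℝ => ur p.1 p.2) (Ioo r₁ r₂ ×ˢ Ico 0 T)
  continuousOn_time : ContinuousOn (fun p : ℝ × ℝ => ut p.1 p.2) (Ioo r₁ r₂ ×ˢ Ico 0 T)
  hasDerivAt_flux : ∀ r t : ℝ, r ∈ Ioo r₁ r₂ → t ∈ Ico 0 T →
    HasDerivAt (fun ρ => f (ur ρ t)) (ut r t - f (ur r t) / r) r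

theorem hasDerivAt_of_comp_left {f g : ℝ → ℝ} {x f' c : ℝ} (hg : ContinuousAt g x)
    (hf : HasStrictDerivAt f f' (g x)) (hf' : f' ≠ 0) (h : HasDerivAt (fun y => f (g y)) c x) :
    HasDerivAt g (c / f') x := by
  have h1 := (hf.to_localInverse hf').hasDerivAt
  have h2 : HasDerivAt (fun y => hf.localInverse f f' (g x) hf' (f (g y))) (f'⁻¹ * c) x :=
    h1.comp x h
  have h3 : ∀ᶠ y in 𝓝 x, hf.localInverse f f' (g x) hf' (f (g y)) = g y :=
    hg.eventually (hf.hasStrictFDerivAt_equiv hf').eventually_left_inverse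
  have := h2.congr_of_eventuallyEq (h3.mono fun _ h => h.symm)
  rwa [← div_eq_inv_mul] at this

theorem deriv_nonneg_of_forall_le_left {g : ℝ → ℝ} {D a t : ℝ} (hat : a < t)
    (hg : HasDerivAt g D t) (h : ∀ s ∈ Icc a t, g s ≤ g t) : 0 ≤ D := by
  have h1 := (hasDerivAt_iff_tendsto_slope.1 hg).mono_left
    (nhdsWithin_mono t (fun s (hs : s ∈ Iio t) => ne_of_lt hs))
  refine ge_of_tendsto h1 ?_
  filter_upwards [Ioo_mem_nhdsLT hat] with s hs
  rw [slope_def_field]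
  exact div_nonneg_of_nonpos (by linarith [h s ⟨hs.1.le, hs.2.le⟩]) (by linarith [hs.2])

theorem IsLocalMax.second_deriv_nonpos {F G : ℝ → ℝ} {D x : ℝ} (h : IsLocalMax F x)
    (hF : ∀ᶠ y in 𝓝 x, HasDerivAt F (G y) y) (hG : HasDerivAt G D x) : D ≤ 0 := by
  by_contra! hD
  have e : deriv F =ᶠ[𝓝 x] G := hF.mono fun y hy => hy.deriv
  have h0 : deriv F x = 0 := h.deriv_eq_zero
  have h2 : deriv (deriv F) x = D := by rw [e.deriv_eq]; exact hG.deriv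
  have hmin := isLocalMin_of_deriv_deriv_pos (f := F) (h2 ▸ hD) h0
    hF.self_of_nhds.continuousAt
  have hc : F =ᶠ[𝓝 x] fun _ => F x := by
    filter_upwards [h, hmin] with y h1 h2 using le_antisymm h1 h2
  have h3 : deriv F =ᶠ[𝓝 x] deriv (fun _ => F x) := hc.deriv
  rw [h3.deriv_eq] at h2
  simp at h2
  linarith

theorem exists_mem_uIcc_sub_eq_deriv_mul {g : ℝ → ℝ} (hg : Differentiable ℝ g) (a b : ℝ) :
    ∃ c ∈ uIcc a b, g b - g a = deriv g c * (b - a) := by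
  rcases lt_trichotomy a b with h | h | h
  · obtain ⟨c, hc, e⟩ := exists_deriv_eq_slope g h hg.continuous.continuousOn
      hg.differentiableOn
    refine ⟨c, Icc_subset_uIcc (Ioo_subset_Icc_self hc), ?_⟩
    rw [e, div_mul_cancel₀ _ (sub_ne_zero.2 h.ne')]
  · subst h; exact ⟨a, by simp, by simp⟩
  · obtain ⟨c, hc, e⟩ := exists_deriv_eq_slope g h hg.continuous.continuousOn
      hg.differentiableOn
    refine ⟨c, Icc_subset_uIcc' (Ioo_subset_Icc_self hc), ?_⟩
    rw [e]; linear_combination div_mul_cancel₀ (g a - g b) (sub_ne_zero.2 h.ne')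

theorem IsRadialSolution_s3.two_point_inequality {f : ℝ → ℝ} (hf : ContDiff ℝ (⊤ : ℕ∞) f)
    {r₁ r₂ T : ℝ} {u ur ut : ℝ → ℝ → ℝ} (hu : IsRadialSolution_s3 f r₁ r₂ T u ur ut)
    {b : ℝ → ℝ → ℝ} {q q' bt : ℝ → ℝ} {R h τ a : ℝ}
    (hR : R ∈ Ioo r₁ r₂) (hRh : R + h ∈ Ioo r₁ r₂) (hτ : τ ∈ Ioo 0 T)
    (hb : ∀ r, HasDerivAt (fun r => b r τ) (q r) r) (hq : ∀ r, HasDerivAt q (q' r) r)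
    (hbt : ∀ r, HasDerivAt (fun t => b r t) (bt r) τ)
    (hp : 0 < deriv f (ur R τ)) (hp' : 0 < deriv f (ur (R + h) τ))
    (hmax : IsLocalMax (fun r => u (r + h) τ - u r τ - (b (r + h) τ - b r τ)) R)
    (ha : a < τ)
    (hmaxt : ∀ s ∈ Icc a τ, u (R + h) s - u R s - (b (R + h) s - b R s) ≤
      u (R + h) τ - u R τ - (b (R + h) τ - b R τ)) :
    ur (R + h) τ - ur R τ = q (R + h) - q R ∧
    bt (R + h) - bt R ≤ deriv f (ur (R + h) τ) * (q' (R + h) - q' R) +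
      (deriv f (ur (R + h) τ) - deriv f (ur R τ)) *
        ((ut R τ - f (ur R τ) / R) / deriv f (ur R τ)) +
      (f (ur (R + h) τ) / (R + h) - f (ur R τ) / R) := by
  have hτ' : τ ∈ Ico 0 T := ⟨hτ.1.le, hτ.2⟩
  have hD : ∀ᶠ r in 𝓝 R, HasDerivAt
      (fun r => u (r + h) τ - u r τ - (b (r + h) τ - b r τ))
      (ur (r + h) τ - ur r τ - (q (r + h) - q r)) r := by
    have e1 : ∀ᶠ r in 𝓝 R, r ∈ Ioo r₁ r₂ := isOpen_Ioo.mem_nhds hR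
    have e2 : ∀ᶠ r in 𝓝 R, r + h ∈ Ioo r₁ r₂ :=
      (by fun_prop : Continuous fun r : ℝ => r + h).continuousAt.eventually
        (isOpen_Ioo.mem_nhds hRh)
    filter_upwards [e1, e2] with r h1 h2
    exact (((hu.hasDerivAt_space _ τ h2 hτ').comp_add_const r h).sub
      (hu.hasDerivAt_space _ τ h1 hτ')).sub (((hb _).comp_add_const r h).sub (hb r))
  have hcr : ∀ r ∈ Ioo r₁ r₂, ContinuousAt (fun r => ur r τ) r := fun r hr =>
    ContinuousAt.comp (f := fun r => (r, τ)) (g := fun p : ℝ × ℝ => ur p.1 p.2)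
      (hu.continuousOn_space.continuousAt
        (prod_mem_nhds (isOpen_Ioo.mem_nhds hr) (Ico_mem_nhds hτ.1 hτ.2))) (by fun_prop)
  have hstrict : ∀ x, HasStrictDerivAt f (deriv f x) x := fun x =>
    (hf.contDiffAt).hasStrictDerivAt (by simp)
  have hX := hasDerivAt_of_comp_left (hcr R hR) (hstrict _) hp.ne'
    (hu.hasDerivAt_flux R τ hR hτ')
  have hX' := hasDerivAt_of_comp_left (hcr _ hRh) (hstrict _) hp'.ne'
    (hu.hasDerivAt_flux _ τ hRh hτ')
  have h1 := hmax.hasDerivAt_eq_zero hD.self_of_nhds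
  have h2 := hmax.second_deriv_nonpos hD
    (((hX'.comp_add_const R h).sub hX).sub (((hq _).comp_add_const R h).sub (hq R)))
  have ht : ∀ r ∈ Ioo r₁ r₂, HasDerivAt (fun s => u r s) (ut r τ) τ := fun r hr =>
    (hu.hasDerivWithinAt_time r τ hr hτ').hasDerivAt (Ico_mem_nhds hτ.1 hτ.2)
  have h3 := deriv_nonneg_of_forall_le_left ha
    (((ht _ hRh).sub (ht _ hR)).sub ((hbt (R + h)).sub (hbt R))) hmaxt
  refine ⟨by linarith, ?_⟩
  set P := deriv f (ur R τ)
  set P' := deriv f (ur (R + h) τ)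
  set X := (ut R τ - f (ur R τ) / R) / P with hXdef
  set X' := (ut (R + h) τ - f (ur (R + h) τ) / (R + h)) / P' with hXdef'
  have e1 : ut R τ = P * X + f (ur R τ) / R := by rw [hXdef]; field_simp; ring
  have e2 : ut (R + h) τ = P' * X' + f (ur (R + h) τ) / (R + h) := by
    rw [hXdef']
    rw [mul_div_cancel₀ _ hp'.ne']; ring
  rw [e1, e2] at h3
  nlinarith [mul_le_mul_of_nonneg_left h2 hp'.le]

theorem IsRadialSolution_s3.touching_inequality {f : ℝ → ℝ} (hf : ContDiff ℝ (⊤ : ℕ∞) f)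
    {r₁ r₂ T : ℝ} (hr₁ : 0 < r₁) {u ur ut : ℝ → ℝ → ℝ}
    (hu : IsRadialSolution_s3 f r₁ r₂ T u ur ut) {r₀ t₀ k q₁ q₂ : ℝ}
    (hr₀ : r₀ ∈ Ioo r₁ r₂) (ht₀ : t₀ ∈ Ioo 0 T) (hpos : 0 < deriv f (ur r₀ t₀))
    {ε : ℝ} (hε : 0 < ε)
    (touch : ∀ r t, |r - r₀| < ε → t₀ - ε < t → t ≤ t₀ →
      ur r t ≤ ur r₀ t₀ + q₁ * (r - r₀ - k * (t - t₀)) +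
        q₂ / 2 * (r - r₀ - k * (t - t₀)) ^ 2) :
    -k * q₁ ≤ deriv f (ur r₀ t₀) * q₂ + deriv (deriv f) (ur r₀ t₀) * q₁ ^ 2 +
      deriv f (ur r₀ t₀) * q₁ / r₀ - f (ur r₀ t₀) / r₀ ^ 2 := by
  by_contra! hcon
  set σ := ur r₀ t₀ with hσ
  obtain ⟨η, hη, hgap⟩ : ∃ η > 0, deriv f σ * (q₂ + 2 * η) + deriv (deriv f) σ * q₁ ^ 2 +
      deriv f σ * q₁ / r₀ - f σ / r₀ ^ 2 < -k * q₁ - η := by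
    set gap := -k * q₁ - (deriv f σ * q₂ + deriv (deriv f) σ * q₁ ^ 2 +
      deriv f σ * q₁ / r₀ - f σ / r₀ ^ 2) with hg
    have hgp : 0 < gap := by linarith
    refine ⟨gap / (2 * (2 * deriv f σ + 1)), by positivity, ?_⟩
    have : gap / (2 * (2 * deriv f σ + 1)) * (2 * deriv f σ + 1) = gap / 2 := by
      field_simp
    nlinarith
  set Q := q₂ + 2 * η with hQ
  have hfd : Differentiable ℝ f := hf.differentiable (by simp)
  have hf1 : ContDiff ℝ (⊤ : ℕ∞) (deriv f) := ((contDiff_infty_iff_deriv).1 hf).2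
  have hf1d : Differentiable ℝ (deriv f) := hf1.differentiable (by simp)
  have hf2c : Continuous (deriv (deriv f)) := hf1.continuous_deriv (by simp)
  have hdom : Ioo r₁ r₂ ×ˢ Ico 0 T ∈ 𝓝 (r₀, t₀) :=
    prod_mem_nhds (isOpen_Ioo.mem_nhds hr₀) (Ico_mem_nhds ht₀.1 ht₀.2)
  have hurc : ContinuousAt (fun p : ℝ × ℝ => ur p.1 p.2) (r₀, t₀) :=
    hu.continuousOn_space.continuousAt hdom
  have hutc : ContinuousAt (fun p : ℝ × ℝ => ut p.1 p.2) (r₀, t₀) :=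
    hu.continuousOn_time.continuousAt hdom
  obtain ⟨δ, hδ, hδε, hgood⟩ : ∃ δ > 0, 2 * δ < ε ∧ ∀ r t, |r - r₀| ≤ 2 * δ → |t - t₀| ≤ 2 * δ →
      r ∈ Ioo r₁ r₂ ∧ t ∈ Ioo 0 T ∧ 0 < deriv f (ur r t) := by
    have e1 : ∀ᶠ p : ℝ × ℝ in 𝓝 (r₀, t₀), p ∈ Ioo r₁ r₂ ×ˢ Ioo 0 T :=
      prod_mem_nhds (isOpen_Ioo.mem_nhds hr₀) (isOpen_Ioo.mem_nhds ht₀)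
    have e2 : ∀ᶠ p : ℝ × ℝ in 𝓝 (r₀, t₀), 0 < deriv f (ur p.1 p.2) :=
      (hf1.continuous.continuousAt.comp hurc).eventually (lt_mem_nhds hpos)
    obtain ⟨d, hd, hd'⟩ := Metric.eventually_nhds_iff.1 (e1.and e2)
    refine ⟨min d ε / 4, by positivity, by linarith [min_le_right d ε], fun r t h1 h2 => ?_⟩
    have : dist (r, t) (r₀, t₀) < d := by
      rw [Prod.dist_eq, Real.dist_eq, Real.dist_eq]
      have := min_le_left d ε
      exact max_lt (by simp only; linarith) (by simp only; linarith)
    have := hd' this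
    exact ⟨this.1.1, this.1.2, this.2⟩
  let ρ : ℝ → ℝ → ℝ := fun r t => r - r₀ - k * (t - t₀)
  let b : ℝ → ℝ → ℝ := fun r t => σ * ρ r t + q₁ * ρ r t ^ 2 / 2 + Q * ρ r t ^ 3 / 6 +
    η * ρ r t * (t₀ - t)
  let q : ℝ → ℝ → ℝ := fun t r => σ + q₁ * ρ r t + Q * ρ r t ^ 2 / 2 + η * (t₀ - t)
  let q' : ℝ → ℝ → ℝ := fun t r => q₁ + Q * ρ r t
  let bt : ℝ → ℝ → ℝ := fun t r => -k * (σ + q₁ * ρ r t + Q * ρ r t ^ 2 / 2) - η * ρ r t -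
    k * η * (t₀ - t)
  have hρr : ∀ r t, HasDerivAt (fun r => ρ r t) 1 r := fun r t =>
    ((hasDerivAt_id r).sub_const r₀).sub_const _
  have hρt : ∀ r t, HasDerivAt (fun t => ρ r t) (-k) t := fun r t => by
    have := (((hasDerivAt_id t).sub_const t₀).const_mul k).const_sub (r - r₀)
    simpa using this
  have hb : ∀ t r, HasDerivAt (fun r => b r t) (q t r) r := fun t r => by
    have := ((((hρr r t).const_mul σ).add ((((hρr r t).pow 2).const_mul q₁).div_const 2)).add
      ((((hρr r t).pow 3).const_mul Q).div_const 6)).add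
      (((hρr r t).const_mul η).mul_const (t₀ - t))
    refine this.congr_deriv ?_
    simp only [q]; push_cast; ring
  have hq : ∀ t r, HasDerivAt (q t) (q' t r) r := fun t r => by
    have := ((((hρr r t).const_mul q₁).const_add σ).add
      ((((hρr r t).pow 2).const_mul Q).div_const 2)).add_const (η * (t₀ - t))
    refine this.congr_deriv ?_
    simp only [q']; push_cast; ring
  have hbt : ∀ t r, HasDerivAt (fun t => b r t) (bt t r) t := fun t r => by
    have := ((((hρt r t).const_mul σ).add ((((hρt r t).pow 2).const_mul q₁).div_const 2)).add
      ((((hρt r t).pow 3).const_mul Q).div_const 6)).add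
      (((hρt r t).const_mul η).mul ((hasDerivAt_id t).const_sub t₀))
    refine this.congr_deriv ?_
    simp only [bt, id]; push_cast; ring
  have htouch : ∀ r t, |r - r₀| ≤ 2 * δ → t₀ - 2 * δ ≤ t → t ≤ t₀ →
      ur r t - q t r ≤ -η * (ρ r t ^ 2 + (t₀ - t)) := fun r t h1 h2 h3 => by
    have := touch r t (by linarith) (by linarith) h3
    simp only [q, ρ, hQ]
    linarith
  let F : ℝ → ℝ → ℝ → ℝ := fun h r t => u (r + h) t - u r t - (b (r + h) t - b r t)
  have hmvt : ∀ h r t, h ∈ Ioo 0 δ → |r - r₀| ≤ δ → t₀ - δ ≤ t → t ≤ t₀ →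
      ∃ c ∈ Ioo r (r + h), F h r t = h * (ur c t - q t c) := by
    intro h r t hh hr ht1 ht2
    have hd : ∀ x ∈ Icc r (r + h), HasDerivAt (fun x => u x t - b x t) (ur x t - q t x) x := by
      intro x hx
      have hx' : |x - r₀| ≤ 2 * δ := by
        rw [abs_le] at hr ⊢; constructor <;> linarith [hx.1, hx.2, hh.1, hh.2]
      have := hgood x t hx' (by rw [abs_le]; constructor <;> linarith)
      exact (hu.hasDerivAt_space x t this.1 ⟨this.2.1.1.le, this.2.1.2⟩).sub (hb t x)
    obtain ⟨c, hc, e⟩ := exists_hasDerivAt_eq_slope (fun x => u x t - b x t)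
      (fun x => ur x t - q t x) (by linarith [hh.1] : r < r + h)
      (fun x hx => (hd x hx).continuousAt.continuousWithinAt)
      (fun x hx => hd x (Ioo_subset_Icc_self hx))
    refine ⟨c, hc, ?_⟩
    rw [e]
    have := hh.1.ne'
    simp only [F, add_sub_cancel_left]
    field_simp
    ring
  have hbc : ∀ h, Continuous fun p : ℝ × ℝ => b (p.1 + h) p.2 := fun h => by
    simp only [b, ρ]; fun_prop
  have hex : ∀ h, h ∈ Ioo 0 δ → ∃ R τ c e, R ∈ Icc (r₀ - δ) (r₀ + δ) ∧ τ ∈ Icc (t₀ - δ) t₀ ∧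
      (∀ r ∈ Icc (r₀ - δ) (r₀ + δ), ∀ t ∈ Icc (t₀ - δ) t₀, F h r t ≤ F h R τ) ∧
      c ∈ Ioo r₀ (r₀ + h) ∧ e ∈ Ioo R (R + h) ∧
      η * (ρ e τ ^ 2 + (t₀ - τ)) ≤ -(ur c t₀ - q t₀ c) := by
    intro h hh
    have hcu : ∀ a, a ∈ Icc 0 h → ContinuousOn (fun p : ℝ × ℝ => u (p.1 + a) p.2)
        (Icc (r₀ - δ) (r₀ + δ) ×ˢ Icc (t₀ - δ) t₀) := by
      intro a ha
      refine hu.continuousOn.comp (f := fun p : ℝ × ℝ => (p.1 + a, p.2)) (by fun_prop) ?_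
      rintro ⟨r, t⟩ ⟨hr, ht⟩
      have := hgood (r + a) t
        (by rw [abs_le]; constructor <;> linarith [hr.1, hr.2, ha.1, ha.2, hh.1, hh.2])
        (by rw [abs_le]; constructor <;> linarith [ht.1, ht.2])
      exact ⟨this.1, this.2.1.1.le, this.2.1.2⟩
    have hcF : ContinuousOn (fun p : ℝ × ℝ => F h p.1 p.2)
        (Icc (r₀ - δ) (r₀ + δ) ×ˢ Icc (t₀ - δ) t₀) := by
      have h0 := hcu 0 ⟨le_rfl, hh.1.le⟩
      have b0 := hbc 0
      simp only [add_zero] at h0 b0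
      exact ((hcu h ⟨hh.1.le, le_rfl⟩).sub h0).sub ((hbc h).sub b0).continuousOn
    obtain ⟨⟨R, τ⟩, ⟨hR, hτ⟩, hm⟩ := (isCompact_Icc.prod isCompact_Icc).exists_isMaxOn
      ⟨(r₀, t₀), ⟨by constructor <;> linarith, by constructor <;> linarith⟩⟩ hcF
    have hm' : ∀ r ∈ Icc (r₀ - δ) (r₀ + δ), ∀ t ∈ Icc (t₀ - δ) t₀, F h r t ≤ F h R τ :=
      fun r hr t ht => hm (show (r, t) ∈ _ from ⟨hr, ht⟩)
    simp only at hR hτ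
    have hRa : |R - r₀| ≤ δ := by rw [abs_le]; constructor <;> linarith [hR.1, hR.2]
    obtain ⟨c, hc, ec⟩ := hmvt h r₀ t₀ hh (by simpa using hδ.le) (by linarith) le_rfl
    obtain ⟨e, he, ee⟩ := hmvt h R τ hh hRa hτ.1 hτ.2
    refine ⟨R, τ, c, e, hR, hτ, hm', hc, he, ?_⟩
    have h1 := hm' r₀ ⟨by linarith, by linarith⟩ t₀ ⟨by linarith, le_rfl⟩
    rw [ec, ee] at h1
    have h2 := le_of_mul_le_mul_left h1 hh.1
    have h3 := htouch e τ (by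
      rw [abs_le] at hRa ⊢; constructor <;> linarith [he.1, he.2, hh.2]) (by linarith [hτ.1]) hτ.2
    linarith
  choose! R τ c e hR hτ hmax hc he hest using hex
  have hsmall : ∀ᶠ h in 𝓝[>] (0 : ℝ), h ∈ Ioo 0 δ := Ioo_mem_nhdsGT hδ
  have hid : Tendsto (fun h : ℝ => h) (𝓝[>] 0) (𝓝 0) := tendsto_id.mono_left nhdsWithin_le_nhds
  have hclim : Tendsto c (𝓝[>] 0) (𝓝 r₀) := by
    refine tendsto_of_tendsto_of_tendsto_of_le_of_le' tendsto_const_nhds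
      (h := fun h => r₀ + h) (by simpa using hid.const_add r₀) ?_ ?_
    · filter_upwards [hsmall] with h hh using (hc h hh).1.le
    · filter_upwards [hsmall] with h hh using (hc h hh).2.le
  have hω : Tendsto (fun h => -(ur (c h) t₀ - q t₀ (c h)) / η) (𝓝[>] 0) (𝓝 0) := by
    have h1 : Tendsto (fun h => ur (c h) t₀) (𝓝[>] 0) (𝓝 σ) :=
      hurc.tendsto.comp (hclim.prodMk_nhds tendsto_const_nhds)
    have h2 : Tendsto (fun h => q t₀ (c h)) (𝓝[>] 0) (𝓝 (q t₀ r₀)) :=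
      (hq t₀ r₀).continuousAt.tendsto.comp hclim
    have h3 : q t₀ r₀ = σ := by simp [q, ρ]
    rw [h3] at h2
    simpa using (h1.sub h2).neg.div_const η
  have hτlim : Tendsto τ (𝓝[>] 0) (𝓝 t₀) := by
    have : Tendsto (fun h => t₀ - τ h) (𝓝[>] 0) (𝓝 0) := by
      refine tendsto_of_tendsto_of_tendsto_of_le_of_le' tendsto_const_nhds hω ?_ ?_
      · filter_upwards [hsmall] with h hh using by linarith [(hτ h hh).2]
      · filter_upwards [hsmall] with h hh
        rw [le_div_iff₀ hη]
        nlinarith [hest h hh, sq_nonneg (ρ (e h) (τ h))]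
    simpa using this.const_sub t₀
  have helim : Tendsto e (𝓝[>] 0) (𝓝 r₀) := by
    have h1 : Tendsto (fun h => ρ (e h) (τ h) ^ 2) (𝓝[>] 0) (𝓝 0) := by
      refine tendsto_of_tendsto_of_tendsto_of_le_of_le' tendsto_const_nhds hω ?_ ?_
      · exact Eventually.of_forall fun h => sq_nonneg _
      · filter_upwards [hsmall] with h hh
        rw [le_div_iff₀ hη]
        nlinarith [hest h hh, (hτ h hh).2]
    have h2 : Tendsto (fun h => ρ (e h) (τ h)) (𝓝[>] 0) (𝓝 0) := by
      have := h1.sqrt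
      simp only [Real.sqrt_sq_eq_abs, Real.sqrt_zero] at this
      exact (tendsto_zero_iff_abs_tendsto_zero _).2 this
    have h3 := (h2.add ((hτlim.sub_const t₀).const_mul k)).add_const r₀
    simp only [sub_self, mul_zero, zero_add] at h3
    refine h3.congr fun h => ?_
    simp only [ρ]; ring
  have hRlim : Tendsto R (𝓝[>] 0) (𝓝 r₀) := by
    have h1 : Tendsto (fun h => e h - h) (𝓝[>] 0) (𝓝 r₀) := by simpa using helim.sub hid
    refine tendsto_of_tendsto_of_tendsto_of_le_of_le' h1 helim ?_ ?_
    · filter_upwards [hsmall] with h hh using by linarith [(he h hh).2]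
    · filter_upwards [hsmall] with h hh using (he h hh).1.le
  have hRhlim : Tendsto (fun h => R h + h) (𝓝[>] 0) (𝓝 r₀) := by simpa using hRlim.add hid
  have hp : Tendsto (fun h => ur (R h) (τ h)) (𝓝[>] 0) (𝓝 σ) :=
    hurc.tendsto.comp (hRlim.prodMk_nhds hτlim)
  have hp' : Tendsto (fun h => ur (R h + h) (τ h)) (𝓝[>] 0) (𝓝 σ) :=
    hurc.tendsto.comp (hRhlim.prodMk_nhds hτlim)
  have hut : Tendsto (fun h => ut (R h) (τ h)) (𝓝[>] 0) (𝓝 (ut r₀ t₀)) :=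
    hutc.tendsto.comp (hRlim.prodMk_nhds hτlim)
  have hρlim : Tendsto (fun h => ρ (R h) (τ h)) (𝓝[>] 0) (𝓝 0) := by
    have := (hRlim.sub_const r₀).sub ((hτlim.sub_const t₀).const_mul k)
    simpa using this
  have hslope : Tendsto (fun h => q₁ + Q * (ρ (R h) (τ h) + h / 2)) (𝓝[>] 0) (𝓝 q₁) := by
    have := ((hρlim.add (hid.div_const 2)).const_mul Q).const_add q₁
    simpa using this
  have hX₀ : (ut r₀ t₀ - f σ / r₀) / deriv f σ = q₁ := by
    have hcr : ContinuousAt (fun r => ur r t₀) r₀ :=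
      ContinuousAt.comp (f := fun r => (r, t₀)) (g := fun p : ℝ × ℝ => ur p.1 p.2)
        hurc (by fun_prop)
    have hd := hasDerivAt_of_comp_left hcr
      ((hf.contDiffAt).hasStrictDerivAt (by simp)) hpos.ne'
      (hu.hasDerivAt_flux r₀ t₀ hr₀ ⟨ht₀.1.le, ht₀.2⟩)
    have hm : IsLocalMax (fun r => ur r t₀ - q t₀ r) r₀ := by
      have : ∀ᶠ r in 𝓝 r₀, |r - r₀| < δ := Metric.ball_mem_nhds r₀ hδ
      filter_upwards [this] with r hr
      have h1 := htouch r t₀ (by linarith) (by linarith) le_rfl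
      have h2 : ur r₀ t₀ - q t₀ r₀ = 0 := by simp [q, ρ, hσ]
      rw [h2]
      nlinarith [sq_nonneg (ρ r t₀)]
    have := hm.hasDerivAt_eq_zero (hd.sub (hq t₀ r₀))
    have h2 : q' t₀ r₀ = q₁ := by simp [q', ρ]
    linarith
  have hg1 : ∀ h, ∃ ξ ∈ uIcc (ur (R h) (τ h)) (ur (R h + h) (τ h)),
      deriv f (ur (R h + h) (τ h)) - deriv f (ur (R h) (τ h)) =
        deriv (deriv f) ξ * (ur (R h + h) (τ h) - ur (R h) (τ h)) := fun h =>
    exists_mem_uIcc_sub_eq_deriv_mul hf1d _ _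
  have hg0 : ∀ h, ∃ ξ ∈ uIcc (ur (R h) (τ h)) (ur (R h + h) (τ h)),
      f (ur (R h + h) (τ h)) - f (ur (R h) (τ h)) =
        deriv f ξ * (ur (R h + h) (τ h) - ur (R h) (τ h)) := fun h =>
    exists_mem_uIcc_sub_eq_deriv_mul hfd _ _
  choose ξ hξ eξ using hg1
  choose ζ hζ eζ using hg0
  have hbetween : ∀ x : ℝ → ℝ, (∀ h, x h ∈ uIcc (ur (R h) (τ h)) (ur (R h + h) (τ h))) →
      Tendsto x (𝓝[>] 0) (𝓝 σ) := fun x hx => by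
    refine tendsto_of_tendsto_of_tendsto_of_le_of_le (g := fun h => min (ur (R h) (τ h)) (ur (R h + h) (τ h)))
      (h := fun h => max (ur (R h) (τ h)) (ur (R h + h) (τ h))) ?_ ?_ (fun h => (hx h).1)
      (fun h => (hx h).2)
    · simpa using hp.min hp'
    · simpa using hp.max hp'
  have hξlim := hbetween ξ hξ
  have hζlim := hbetween ζ hζ
  have key : ∀ᶠ h in 𝓝[>] (0 : ℝ),
      -k * (q₁ + Q * (ρ (R h) (τ h) + h / 2)) - η ≤
      deriv f (ur (R h + h) (τ h)) * Q +
      deriv (deriv f) (ξ h) * (q₁ + Q * (ρ (R h) (τ h) + h / 2)) *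
        ((ut (R h) (τ h) - f (ur (R h) (τ h)) / R h) / deriv f (ur (R h) (τ h))) +
      (deriv f (ζ h) * (q₁ + Q * (ρ (R h) (τ h) + h / 2)) / (R h + h) -
        f (ur (R h) (τ h)) / (R h * (R h + h))) := by
    filter_upwards [hsmall, hRlim.eventually (Metric.ball_mem_nhds r₀ hδ),
      hτlim.eventually (Metric.ball_mem_nhds t₀ hδ)] with h hh hRb hτb
    rw [Real.dist_eq] at hRb hτb
    have hRb' := abs_lt.1 hRb
    have hτb' := abs_lt.1 hτb
    have hm := hmax h hh
    have g1 := hgood (R h) (τ h) (by linarith) (by linarith)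
    have g2 := hgood (R h + h) (τ h)
      (by rw [abs_le]; constructor <;> linarith [hh.1, hh.2]) (by linarith)
    obtain ⟨E1, E2⟩ := hu.two_point_inequality hf g1.1 g2.1 g1.2.1 (hb (τ h)) (hq (τ h))
      (hbt (τ h)) g1.2.2 g2.2.2 (b := b) (a := t₀ - δ) (by
        have : Icc (r₀ - δ) (r₀ + δ) ∈ 𝓝 (R h) := Icc_mem_nhds (by linarith) (by linarith)
        filter_upwards [this] with r hr
        exact hm r hr _ (hτ h hh)) (by linarith)
      (fun s hs => hm _ (hR h hh) s ⟨hs.1, hs.2.trans (hτ h hh).2⟩)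
    rw [eξ h, E1] at E2
    have eζ' := eζ h
    rw [E1] at eζ'
    have hRp : 0 < R h := hr₁.trans g1.1.1
    have hRhp : 0 < R h + h := hr₁.trans g2.1.1
    have d1 : q (τ h) (R h + h) - q (τ h) (R h) =
        h * (q₁ + Q * (ρ (R h) (τ h) + h / 2)) := by
      simp only [q, ρ]; ring
    have d2 : bt (τ h) (R h + h) - bt (τ h) (R h) =
        h * (-k * (q₁ + Q * (ρ (R h) (τ h) + h / 2)) - η) := by
      simp only [bt, ρ]; ring
    have d3 : q' (τ h) (R h + h) - q' (τ h) (R h) = h * Q := by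
      simp only [q', ρ]; ring
    have d4 : f (ur (R h + h) (τ h)) / (R h + h) - f (ur (R h) (τ h)) / R h =
        h * (deriv f (ζ h) * (q₁ + Q * (ρ (R h) (τ h) + h / 2)) / (R h + h) -
        f (ur (R h) (τ h)) / (R h * (R h + h))) := by
      have : f (ur (R h + h) (τ h)) = f (ur (R h) (τ h)) +
        deriv f (ζ h) * (h * (q₁ + Q * (ρ (R h) (τ h) + h / 2))) := by rw [← d1]; linarith
      rw [this]
      field_simp
      ring
    rw [d2, d3, d4, d1] at E2
    refine le_of_mul_le_mul_left ?_ hh.1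
    linarith
  have hr₀p : 0 < r₀ := hr₁.trans hr₀.1
  have L1 : Tendsto (fun h => -k * (q₁ + Q * (ρ (R h) (τ h) + h / 2)) - η) (𝓝[>] 0)
      (𝓝 (-k * q₁ - η)) := (hslope.const_mul (-k)).sub_const η
  have cf : ∀ x : ℝ → ℝ, Tendsto x (𝓝[>] 0) (𝓝 σ) →
      Tendsto (fun h => f (x h)) (𝓝[>] 0) (𝓝 (f σ)) := fun x hx =>
    (hf.continuous.tendsto σ).comp hx
  have cf1 : ∀ x : ℝ → ℝ, Tendsto x (𝓝[>] 0) (𝓝 σ) →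
      Tendsto (fun h => deriv f (x h)) (𝓝[>] 0) (𝓝 (deriv f σ)) := fun x hx =>
    (hf1.continuous.tendsto σ).comp hx
  have cf2 : Tendsto (fun h => deriv (deriv f) (ξ h)) (𝓝[>] 0) (𝓝 (deriv (deriv f) σ)) :=
    (hf2c.tendsto σ).comp hξlim
  have L2 := (((cf1 _ hp').mul_const Q).add ((cf2.mul hslope).mul
    ((hut.sub ((cf _ hp).div hRlim hr₀p.ne')).div (cf1 _ hp) hpos.ne'))).add
    ((((cf1 _ hζlim).mul hslope).div hRhlim hr₀p.ne').sub
      ((cf _ hp).div (hRlim.mul hRhlim) (mul_pos hr₀p hr₀p).ne'))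
  have := le_of_tendsto_of_tendsto L1 L2 key
  rw [hX₀] at this
  have e2 : r₀ * r₀ = r₀ ^ 2 := by ring
  rw [e2] at this
  nlinarith

set_option maxHeartbeats 1000000 in
/-- Comparison of `w ∘ σ` with a family of barriers `B l`, vanishing on `|y| = l`, at the centre
`y = 0`, given that no barrier touches `w ∘ σ` from below. -/
theorem barrier_le_of_no_touching {σ : ℝ → ℝ → ℝ} {w : ℝ → ℝ} {B : ℝ → ℝ → ℝ} {θ δ c C : ℝ}
    (hσ : Continuous fun p : ℝ × ℝ => σ p.1 p.2) (hw : Continuous w)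
    (hw1 : w 1 = 0) (hwpos : ∀ s < 1, 0 < w s) (hδ : 0 < δ) (hc : 0 < c)
    (hB : ContinuousOn (fun p : ℝ × ℝ => B p.1 p.2) {p | 0 < p.1})
    (hB0 : ∀ l y, 0 < l → |y| = l → B l y = 0)
    (hBlow : ∀ l y, 0 < l → |y| ≤ l → c * (l ^ 2 - y ^ 2) ≤ B l y)
    (hBup : ∀ l y, 0 < l → |y| ≤ l → B l y ≤ C * l ^ 2)
    (center : ∀ t ∈ Icc 0 θ, σ 0 t < 1)
    (initial : ∀ y, |y| ≤ δ → σ y 0 < 1 ∧ ∀ l, 0 < l → l ≤ δ → |y| ≤ l → B l y < w (σ y 0))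
    (neumann : ∀ y t, |y| < δ → t ∈ Ioc 0 θ → σ y t = 1 →
      HasDerivAt (fun y => w (σ y t)) 0 y)
    (parabolic : ∀ l y t ε, l ∈ Ioo 0 δ → |y| < l → t ∈ Ioc 0 θ → σ y t < 1 →
      w (σ y t) = B l y → 0 < ε → (∀ y' t', |y' - y| < ε → t - ε < t' → t' ≤ t → 0 ≤ t' →
        σ y' t' ≤ 1 ∧ B l y' ≤ w (σ y' t')) → False)
    {t₀ : ℝ} (ht₀ : t₀ ∈ Icc 0 θ) : B (δ / 2) 0 ≤ w (σ 0 t₀) := by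
  by_contra! hcon
  have hwσ : Continuous fun p : ℝ × ℝ => w (σ p.1 p.2) := hw.comp hσ
  obtain ⟨μ, hμ, hμw⟩ : ∃ μ > 0, ∀ t ∈ Icc 0 θ, μ < w (σ 0 t) := by
    obtain ⟨t, ht, hmin⟩ := isCompact_Icc.exists_isMinOn (s := Icc 0 θ) ⟨t₀, ht₀⟩
      (f := fun t => w (σ 0 t)) (hwσ.comp (by fun_prop : Continuous fun t : ℝ => ((0:ℝ), t))).continuousOn
    have := hwpos _ (center t ht)
    refine ⟨w (σ 0 t) / 2, by linarith, fun s hs => ?_⟩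
    have : w (σ 0 t) ≤ w (σ 0 s) := hmin hs
    linarith
  obtain ⟨lm, hlm, hlmδ, hlmσ⟩ : ∃ lm > 0, lm ≤ δ / 2 ∧ ∀ y t, |y| ≤ lm → t ∈ Icc 0 θ →
      σ y t < 1 ∧ B lm y < w (σ y t) := by
    have h1 : ∀ᶠ y in 𝓝 (0:ℝ), ∀ t ∈ Icc 0 θ, σ y t < 1 ∧ μ < w (σ y t) := by
      apply isCompact_Icc.eventually_forall_of_forall_eventually
      intro t ht
      exact ((hσ.tendsto (0, t)).eventually_lt_const (center t ht)).and
        ((hwσ.tendsto (0, t)).eventually_const_lt (hμw t ht))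
    have h2 : ∀ᶠ l in 𝓝 (0:ℝ), C * l ^ 2 < μ := by
      have : Tendsto (fun l : ℝ => C * l ^ 2) (𝓝 0) (𝓝 (C * 0 ^ 2)) :=
        (by fun_prop : Continuous fun l : ℝ => C * l ^ 2).tendsto 0
      exact this.eventually_lt_const (by simpa using hμ)
    obtain ⟨ε, hε, h12⟩ := Metric.eventually_nhds_iff.1 (h1.and h2)
    refine ⟨min (ε / 2) (δ / 2), by positivity, min_le_right _ _, fun y t hy ht => ?_⟩
    have hl : (min (ε / 2) (δ / 2)) < ε := lt_of_le_of_lt (min_le_left _ _) (by linarith)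
    have hl0 : 0 < (min (ε / 2) (δ / 2)) := by positivity
    have ha := (h12 (y := y) (by rw [Real.dist_eq, sub_zero]; linarith)).1 t ht
    have hb := (h12 (y := min (ε / 2) (δ / 2)) (by
      rw [Real.dist_eq, sub_zero, abs_of_pos hl0]; exact hl)).2
    exact ⟨ha.1, (hBup _ _ hl0 hy).trans_lt (hb.trans ha.2)⟩
  let K : ℝ → ℝ → Prop := fun y t => ∀ τ ∈ Icc 0 θ, ∀ y' ∈ Icc (-δ) δ, 1 ≤ σ y' τ →
    t ≤ τ ∨ y * y' ≤ y' ^ 2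
  let Z : Set (ℝ × ℝ × ℝ) := {z | z.1 ∈ Icc (-(δ / 2)) (δ / 2) ∧ z.2.1 ∈ Icc 0 θ ∧
    z.2.2 ∈ Icc lm (δ / 2) ∧ |z.1| ≤ z.2.2 ∧ K z.1 z.2.1 ∧ w (σ z.1 z.2.1) ≤ B z.2.2 z.1}
  have hZmem : ∀ y t l, t ∈ Icc 0 θ → l ∈ Icc lm (δ / 2) → |y| ≤ l → K y t →
      w (σ y t) ≤ B l y → (y, t, l) ∈ Z := fun y t l ht hl hy hK hwB =>
    ⟨abs_le.1 (hy.trans hl.2), ht, hl, hy, hK, hwB⟩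
  have hZ : IsCompact Z := by
    have hbox : IsCompact (Icc (-(δ / 2)) (δ / 2) ×ˢ (Icc 0 θ ×ˢ Icc lm (δ / 2))) :=
      isCompact_Icc.prod (isCompact_Icc.prod isCompact_Icc)
    have hc1 : IsClosed {z : ℝ × ℝ × ℝ | |z.1| ≤ z.2.2 ∧ K z.1 z.2.1} := by
      apply IsClosed.and (isClosed_le (by fun_prop) (by fun_prop))
      have hK : ∀ τ ∈ Icc 0 θ, ∀ y' ∈ Icc (-δ) δ, 1 ≤ σ y' τ →
          IsClosed {z : ℝ × ℝ × ℝ | z.2.1 ≤ τ ∨ z.1 * y' ≤ y' ^ 2} := fun τ _ y' _ _ =>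
        (isClosed_le (f := fun z : ℝ × ℝ × ℝ => z.2.1) (g := fun _ => τ)
          (by fun_prop) (by fun_prop)).union
        (isClosed_le (f := fun z : ℝ × ℝ × ℝ => z.1 * y') (g := fun _ => y' ^ 2)
          (by fun_prop) (by fun_prop))
      simp only [K, Set.ofPred_forall]
      exact isClosed_iInter fun τ => isClosed_iInter fun h1 => isClosed_iInter fun y' =>
        isClosed_iInter fun h2 => isClosed_iInter fun h3 => hK τ h1 y' h2 h3
    have hc2 : IsClosed {z : ℝ × ℝ × ℝ |
        z ∈ Icc (-(δ / 2)) (δ / 2) ×ˢ (Icc 0 θ ×ˢ Icc lm (δ / 2)) ∧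
          w (σ z.1 z.2.1) ≤ B z.2.2 z.1} := by
      refine hbox.isClosed.isClosed_le ?_ ?_
      · exact (hwσ.comp (by fun_prop : Continuous fun z : ℝ × ℝ × ℝ => (z.1, z.2.1))).continuousOn
      · refine hB.comp (f := fun z : ℝ × ℝ × ℝ => (z.2.2, z.1))
          (by fun_prop : Continuous _).continuousOn ?_
        rintro z ⟨-, -, hz⟩
        exact hlm.trans_le hz.1
    refine hbox.of_isClosed_subset ?_ ?_
    · convert hc2.inter hc1 using 1
      ext z
      simp only [Z, mem_ofPred_eq, mem_inter_iff, mem_prod]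
      tauto
    · rintro z ⟨h1, h2, h3, -⟩
      exact ⟨h1, h2, h3⟩
  have hne : Z.Nonempty := by
    refine ⟨(0, t₀, δ / 2), hZmem 0 t₀ (δ / 2) ht₀ ⟨hlmδ, le_rfl⟩ (by simp; positivity) ?_ hcon.le⟩
    intro τ _ y' _ _
    right
    nlinarith [sq_nonneg y']
  obtain ⟨⟨y, t, l⟩, ⟨hyδ, ht, hl, hyl, hK, hwB⟩, hmin⟩ :=
    hZ.exists_isMinOn hne (f := fun z : ℝ × ℝ × ℝ => z.2.2) (by fun_prop)
  dsimp only at hyδ ht hl hyl hK hwB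
  have hminl : ∀ y' t' l', t' ∈ Icc 0 θ → l' ∈ Icc lm (δ / 2) → |y'| ≤ l' → K y' t' →
      w (σ y' t') ≤ B l' y' → l ≤ l' := fun y' t' l' h1 h2 h3 h4 h5 =>
    hmin (hZmem y' t' l' h1 h2 h3 h4 h5)
  have hl0 : 0 < l := hlm.trans_le hl.1
  have hlδ : l < δ := by linarith [hl.2]
  have hyδ' : |y| < δ := hyl.trans_lt hlδ
  have hKle : ∀ t', 0 < t' → t' ≤ θ → K y t' → σ y t' ≤ 1 := by
    intro t' ht' htθ hK'
    by_contra! hgt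
    have hev := (hσ.tendsto (y, t')).eventually_const_lt hgt
    have hcont : Tendsto (fun s : ℝ => (s * y, s * t')) (𝓝[<] 1) (𝓝 (y, t')) := by
      have : Tendsto (fun s : ℝ => (s * y, s * t')) (𝓝 1) (𝓝 (1 * y, 1 * t')) :=
        (by fun_prop : Continuous fun s : ℝ => (s * y, s * t')).tendsto 1
      rw [one_mul, one_mul] at this
      exact this.mono_left nhdsWithin_le_nhds
    obtain ⟨s, hs, hs0, hs1⟩ :=
      ((hcont.eventually hev).and (Ioo_mem_nhdsLT (zero_lt_one' ℝ))).exists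
    have hy0 : y ≠ 0 := by
      rintro rfl
      exact absurd (center t' ⟨ht'.le, htθ⟩) (not_lt.2 hgt.le)
    have hsy : |s * y| ≤ δ := by
      rw [abs_mul, abs_of_pos hs0]
      nlinarith [abs_nonneg y]
    rcases hK' (s * t') ⟨by positivity, by nlinarith⟩ (s * y) (abs_le.1 hsy) hs.le with h | h
    · nlinarith
    · have : 0 < s * (1 - s) * y ^ 2 := by
        have := sub_pos.2 hs1
        positivity
      nlinarith
  have ht0 : 0 < t := by
    rcases ht.1.lt_or_eq with h | h
    · exact h
    · subst h
      exact absurd hwB (not_le.2 ((initial y hyδ'.le).2 l hl0 hlδ.le hyl))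
  have hlml : lm < l := by
    rcases hl.1.lt_or_eq with h | h
    · exact h
    · subst h
      exact absurd hwB (not_le.2 (hlmσ y t hyl ht).2)
  have hlmy : ∀ t' ∈ Icc 0 θ, 1 ≤ σ y t' → lm < |y| := by
    intro t' ht' h1
    by_contra! h
    exact absurd (hlmσ y t' h ht').1 (not_lt.2 h1)
  rcases (hKle t ht0 ht.2 hK).lt_or_eq with hlt | heq1
  · have hyl' : |y| < l := by
      refine lt_of_le_of_ne hyl fun h => ?_
      have := hwpos _ hlt
      linarith [hB0 l y hl0 h]
    have hcol : ∀ τ ∈ Icc 0 t, σ y τ < 1 := by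
      intro τ hτ
      by_contra! h1
      have hτt : τ < t := lt_of_le_of_ne hτ.2 (by rintro rfl; linarith)
      have hτ0 : 0 < τ := lt_of_le_of_ne hτ.1 (by
        rintro rfl; linarith [(initial y hyδ'.le).1])
      have hKτ : K y τ := fun s hs y' hy' h => (hK s hs y' hy' h).imp_left hτ.2.trans
      have hτθ : τ ∈ Icc 0 θ := ⟨hτ.1, hτ.2.trans ht.2⟩
      have he : σ y τ = 1 := le_antisymm (hKle τ hτ0 hτθ.2 hKτ) h1
      have hly := hlmy τ hτθ h1
      have := hminl y τ |y| hτθ ⟨hly.le, hyl.trans hl.2⟩ le_rfl hKτ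
        (by rw [he, hw1, hB0 _ _ (hlm.trans hly) rfl])
      linarith
    obtain ⟨ε, hε, hεσ⟩ : ∃ ε > 0, ∀ y', |y' - y| < ε →
        |y'| < l ∧ ∀ τ ∈ Icc 0 t, σ y' τ < 1 := by
      have h1 : ∀ᶠ y' in 𝓝 y, ∀ τ ∈ Icc 0 t, σ y' τ < 1 := by
        apply isCompact_Icc.eventually_forall_of_forall_eventually
        intro τ hτ
        exact (hσ.tendsto (y, τ)).eventually_lt_const (hcol τ hτ)
      have h2 : ∀ᶠ y' in 𝓝 y, |y'| < l := (continuous_abs.tendsto y).eventually_lt_const hyl'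
      obtain ⟨ε, hε, h⟩ := Metric.eventually_nhds_iff.1 (h2.and h1)
      exact ⟨ε, hε, fun y' hy' => h (by rwa [Real.dist_eq])⟩
    have hnb : ∀ y' t', |y' - y| < ε → t' ≤ t → 0 ≤ t' → B l y' ≤ w (σ y' t') := by
      intro y' t' hy' ht't ht'0
      have hKn : K y' t' := by
        intro τ hτ x hx h1
        by_contra! h2
        rcases hK τ hτ x hx h1 with h3 | h3
        · linarith [h2.1]
        · have hxy : |x - y| < ε := by
            rw [abs_lt] at hy' ⊢
            rcases lt_trichotomy x 0 with h | h | h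
            · have : x ≤ y := by nlinarith
              have : y' < x := by nlinarith [h2.2]
              constructor <;> linarith
            · subst h; simp at h2
            · have : y ≤ x := by nlinarith
              have : x < y' := by nlinarith [h2.2]
              constructor <;> linarith
          have := (hεσ x hxy).2 τ ⟨hτ.1, h2.1.le.trans ht't⟩
          linarith
      have hlim : Tendsto (fun s => B s y') (𝓝[<] l) (𝓝 (B l y')) := by
        have h1 : ContinuousAt (fun p : ℝ × ℝ => B p.1 p.2) (l, y') :=
          hB.continuousAt ((isOpen_lt continuous_const continuous_fst).mem_nhds hl0)
        have h2 : Tendsto (fun s : ℝ => (s, y')) (𝓝[<] l) (𝓝 (l, y')) :=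
          ((by fun_prop : Continuous fun s : ℝ => (s, y')).tendsto l).mono_left nhdsWithin_le_nhds
        exact h1.tendsto.comp h2
      refine le_of_tendsto hlim ?_
      filter_upwards [Ioo_mem_nhdsLT (max_lt hlml (hεσ y' hy').1)] with s hs
      by_contra! h
      have := hminl y' t' s ⟨ht'0, ht't.trans ht.2⟩
        ⟨(le_max_left _ _).trans hs.1.le, hs.2.le.trans hl.2⟩
        ((le_max_right _ _).trans hs.1.le) hKn h.le
      linarith [hs.2]
    refine parabolic l y t ε ⟨hl0, hlδ⟩ hyl' ⟨ht0, ht.2⟩ hlt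
      (le_antisymm hwB (hnb y t (by simpa using hε) le_rfl ht.1)) hε ?_
    intro y' t' hy' _ ht't ht'0
    exact ⟨((hεσ y' hy').2 t' ⟨ht'0, ht't⟩).le, hnb y' t' hy' ht't ht'0⟩
  · have hly := hlmy t ht heq1.ge
    have hy0 : 0 < |y| := hlm.trans hly
    have hder := neumann y t hyδ' ⟨ht0, ht.2⟩ heq1
    have hsmall := hasDerivAt_iff_isLittleO.1 hder
    have hη : 0 < c * |y| / 4 := by positivity
    have hev := hsmall.def hη
    have hcont : Tendsto (fun s : ℝ => s * y) (𝓝[<] 1) (𝓝 y) := by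
      have : Tendsto (fun s : ℝ => s * y) (𝓝 1) (𝓝 (1 * y)) :=
        (by fun_prop : Continuous fun s : ℝ => s * y).tendsto 1
      rw [one_mul] at this
      exact this.mono_left nhdsWithin_le_nhds
    have hcont2 : Tendsto (fun s : ℝ => (1 + s) / 2 * |y|) (𝓝[<] 1) (𝓝 |y|) := by
      have : Tendsto (fun s : ℝ => (1 + s) / 2 * |y|) (𝓝 1) (𝓝 ((1 + 1) / 2 * |y|)) :=
        (by fun_prop : Continuous fun s : ℝ => (1 + s) / 2 * |y|).tendsto 1
      rw [show ((1:ℝ) + 1) / 2 * |y| = |y| by ring] at this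
      exact this.mono_left nhdsWithin_le_nhds
    obtain ⟨s, ⟨hs, hsl⟩, hs0, hs1⟩ := (((hcont.eventually hev).and
      (hcont2.eventually_const_lt hly)).and (Ioo_mem_nhdsLT (zero_lt_one' ℝ))).exists
    rw [heq1, hw1] at hs
    simp only [smul_zero, sub_zero, Real.norm_eq_abs] at hs
    have e1 : |s * y - y| = (1 - s) * |y| := by
      rw [show s * y - y = -((1 - s) * y) by ring, abs_neg, abs_mul, abs_of_pos (sub_pos.2 hs1)]
    have e2 : |s * y| = s * |y| := by rw [abs_mul, abs_of_pos hs0]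
    rw [e1] at hs
    have hlow := hBlow ((1 + s) / 2 * |y|) (s * y) (by positivity) (by rw [e2]; nlinarith)
    have e3 : y ^ 2 = |y| ^ 2 := (sq_abs y).symm
    have h4 : w (σ (s * y) t) ≤ B ((1 + s) / 2 * |y|) (s * y) := by
      refine (le_abs_self _).trans (hs.trans (le_trans ?_ hlow))
      rw [mul_pow s y, e3]
      have : 0 ≤ c * |y| ^ 2 * (1 - s) * s := by
        have := sub_pos.2 hs1
        positivity
      nlinarith
    have := hminl (s * y) t ((1 + s) / 2 * |y|) ht
      ⟨hsl.le, by nlinarith [hl.2]⟩ (by rw [e2]; nlinarith) (by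
        intro τ hτ x hx h1
        refine (hK τ hτ x hx h1).imp_right fun h => ?_
        rcases le_total (y * x) 0 with h5 | h5 <;> nlinarith [sq_nonneg x]) h4
    nlinarith

/-- The comparison profile, vanishing on `|y| = l`. -/
noncomputable def barrier (A l y : ℝ) : ℝ :=
  A * ((l ^ 2 - y ^ 2) / 10000 + (l ^ 2 - y ^ 2) * √(l ^ 2 - y ^ 2) / (100 * l))

/-- The derivative of `barrier A l`. -/
noncomputable def barrierDeriv (A l y : ℝ) : ℝ :=
  -2 * y * A * (1 / 10000 + 3 / 200 * (√(l ^ 2 - y ^ 2) / l))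

theorem continuousOn_barrier (A : ℝ) :
    ContinuousOn (fun p : ℝ × ℝ => barrier A p.1 p.2) {p | 0 < p.1} := by
  unfold barrier
  have : ∀ p ∈ {p : ℝ × ℝ | 0 < p.1}, 100 * p.1 ≠ 0 := fun p hp => by
    have : 0 < p.1 := hp
    positivity
  fun_prop (disch := assumption)

theorem barrier_eq_zero {A l y : ℝ} (h : |y| = l) : barrier A l y = 0 := by
  simp [barrier, ← h]

theorem le_barrier {A l y : ℝ} (hA : 0 < A) (hl : 0 < l) (h : |y| ≤ l) :
    A / 10000 * (l ^ 2 - y ^ 2) ≤ barrier A l y := by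
  have hX : 0 ≤ l ^ 2 - y ^ 2 := sub_nonneg.2 (sq_le_sq' (by linarith [neg_le_of_abs_le h])
    (le_of_abs_le h))
  have : 0 ≤ A * ((l ^ 2 - y ^ 2) * √(l ^ 2 - y ^ 2) / (100 * l)) := by positivity
  unfold barrier
  linarith

theorem barrier_le {A l y : ℝ} (hA : 0 < A) (hl : 0 < l) (h : |y| ≤ l) :
    barrier A l y ≤ A / 50 * l ^ 2 := by
  have hX : 0 ≤ l ^ 2 - y ^ 2 := sub_nonneg.2 (sq_le_sq' (by linarith [neg_le_of_abs_le h])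
    (le_of_abs_le h))
  have hs : √(l ^ 2 - y ^ 2) ≤ l := Real.sqrt_le_iff.2 ⟨hl.le, by nlinarith [sq_nonneg y]⟩
  have h1 : (l ^ 2 - y ^ 2) * √(l ^ 2 - y ^ 2) / (100 * l) ≤ l ^ 2 / 100 := by
    rw [div_le_div_iff₀ (by positivity) (by positivity)]
    have : (l ^ 2 - y ^ 2) * √(l ^ 2 - y ^ 2) ≤ l ^ 2 * l :=
      mul_le_mul (by nlinarith [sq_nonneg y]) hs (by positivity) (by positivity)
    linarith
  have : (l ^ 2 - y ^ 2) / 10000 + (l ^ 2 - y ^ 2) * √(l ^ 2 - y ^ 2) / (100 * l) ≤ l ^ 2 / 50 := by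
    nlinarith [sq_nonneg y, sq_nonneg l]
  unfold barrier
  nlinarith

theorem hasDerivAt_barrier {A l y : ℝ} (h : |y| < l) :
    HasDerivAt (barrier A l) (barrierDeriv A l y) y := by
  have hX : 0 < l ^ 2 - y ^ 2 := sub_pos.2 (sq_lt_sq' (by linarith [neg_lt_of_abs_lt h])
    (lt_of_abs_lt h))
  have hl : 0 < l := (abs_nonneg y).trans_lt h
  have h1 : HasDerivAt (fun y : ℝ => l ^ 2 - y ^ 2) (-(2 * y)) y := by
    simpa using ((hasDerivAt_pow 2 y).const_sub (l ^ 2))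
  have h2 := h1.sqrt hX.ne'
  have h3 := (((h1.div_const 10000).add ((h1.mul h2).div_const (100 * l))).const_mul A)
  refine h3.congr_deriv ?_
  have hs : 0 < √(l ^ 2 - y ^ 2) := Real.sqrt_pos.2 hX
  have hs2 : √(l ^ 2 - y ^ 2) ^ 2 = l ^ 2 - y ^ 2 := Real.sq_sqrt hX.le
  unfold barrierDeriv
  generalize √(l ^ 2 - y ^ 2) = s at hs hs2
  rw [← hs2]
  field_simp
  ring

theorem hasDerivAt_barrierDeriv {A l y : ℝ} (h : |y| < l) :
    HasDerivAt (barrierDeriv A l) (A * (-2 / 10000 - 6 / 100 * (√(l ^ 2 - y ^ 2) / l) +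
      3 / 100 / (√(l ^ 2 - y ^ 2) / l))) y := by
  have hX : 0 < l ^ 2 - y ^ 2 := sub_pos.2 (sq_lt_sq' (by linarith [neg_lt_of_abs_lt h])
    (lt_of_abs_lt h))
  have hl : 0 < l := (abs_nonneg y).trans_lt h
  have h1 : HasDerivAt (fun y : ℝ => l ^ 2 - y ^ 2) (-(2 * y)) y := by
    simpa using ((hasDerivAt_pow 2 y).const_sub (l ^ 2))
  have h2 := h1.sqrt hX.ne'
  have h3 : HasDerivAt (fun y : ℝ => -2 * y * A) (-2 * 1 * A) y :=
    ((hasDerivAt_id y).const_mul (-2)).mul_const A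
  have h4 := h3.mul (((h2.div_const l).const_mul (3 / 200)).const_add (1 / 10000))
  refine h4.congr_deriv ?_
  have hs : 0 < √(l ^ 2 - y ^ 2) := Real.sqrt_pos.2 hX
  have hs2 : √(l ^ 2 - y ^ 2) ^ 2 = l ^ 2 - y ^ 2 := Real.sq_sqrt hX.le
  generalize √(l ^ 2 - y ^ 2) = s at hs hs2
  have : y ^ 2 = l ^ 2 - s ^ 2 := by linarith
  field_simp
  ring_nf
  rw [this]
  ring

theorem neg_mul_barrierDeriv_lt {A L k D Q l y : ℝ} (hA : 0 < A) (hL : 0 < L) (h : |y| < l)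
    (hD : 0 < D) (hDB : 2 * L * barrier A l y ≤ D ^ 2) (hk : k ^ 2 ≤ 2 * L * A)
    (hQ : A * (3 / 100 / (√(l ^ 2 - y ^ 2) / l) + 9 / 10) ≤ Q) :
    -k * barrierDeriv A l y < D * Q := by
  have hX : 0 < l ^ 2 - y ^ 2 := sub_pos.2 (sq_lt_sq' (by linarith [neg_lt_of_abs_lt h])
    (lt_of_abs_lt h))
  have hl : 0 < l := (abs_nonneg y).trans_lt h
  have hs : 0 < √(l ^ 2 - y ^ 2) := Real.sqrt_pos.2 hX
  have hs2 : √(l ^ 2 - y ^ 2) ^ 2 = l ^ 2 - y ^ 2 := Real.sq_sqrt hX.le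
  unfold barrier at hDB
  unfold barrierDeriv
  generalize √(l ^ 2 - y ^ 2) = s at *
  obtain ⟨ξ, hξ, rfl⟩ : ∃ ξ, 0 < ξ ∧ s = ξ * l := ⟨s / l, by positivity, by field_simp⟩
  rw [← hs2] at hDB
  rw [mul_div_cancel_right₀ _ hl.ne'] at hQ ⊢
  have hQ0 : 0 < A * (3 / 100 / ξ + 9 / 10) := by positivity
  refine lt_of_lt_of_le ?_ (mul_le_mul_of_nonneg_left hQ hD.le)
  refine (le_abs_self _).trans_lt ?_
  refine abs_lt_of_sq_lt_sq ?_ (by positivity)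
  have e1 : (-k * (-2 * y * A * (1 / 10000 + 3 / 200 * ξ))) ^ 2 =
      k ^ 2 * (4 * y ^ 2 * A ^ 2 * (1 / 10000 + 3 / 200 * ξ) ^ 2) := by ring
  have e2 : (D * (A * (3 / 100 / ξ + 9 / 10))) ^ 2 =
      D ^ 2 * (A ^ 2 * (3 / 100 + 9 / 10 * ξ) ^ 2 / ξ ^ 2) := by field_simp
  have hy : y ^ 2 ≤ l ^ 2 := by nlinarith [sq_nonneg (ξ * l)]
  rw [e1, e2]
  calc _ ≤ (2 * L * A) * (4 * l ^ 2 * A ^ 2 * (1 / 10000 + 3 / 200 * ξ) ^ 2) := by gcongr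
    _ < (2 * L * (A * ((ξ * l) ^ 2 / 10000 + (ξ * l) ^ 2 * (ξ * l) / (100 * l)))) *
        (A ^ 2 * (3 / 100 + 9 / 10 * ξ) ^ 2 / ξ ^ 2) := by
      have e3 : (2 * L * (A * ((ξ * l) ^ 2 / 10000 + (ξ * l) ^ 2 * (ξ * l) / (100 * l)))) *
        (A ^ 2 * (3 / 100 + 9 / 10 * ξ) ^ 2 / ξ ^ 2) =
        (2 * L * A * l ^ 2 * A ^ 2) * ((1 / 10000 + ξ / 100) * (3 / 100 + 9 / 10 * ξ) ^ 2) := by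
        field_simp
      rw [e3, show (2 * L * A) * (4 * l ^ 2 * A ^ 2 * (1 / 10000 + 3 / 200 * ξ) ^ 2) =
        (2 * L * A * l ^ 2 * A ^ 2) * (4 * (1 / 10000 + 3 / 200 * ξ) ^ 2) by ring]
      refine mul_lt_mul_of_pos_left ?_ (by positivity)
      obtain ⟨η, rfl⟩ : ∃ η, ξ = η / 100 := ⟨100 * ξ, by ring⟩
      have hη : 0 < η := by linarith
      nlinarith [mul_nonneg hη.le (sq_nonneg (η - 17 / 10)), sq_nonneg (η - 17 / 10)]
    _ ≤ _ := by gcongr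

theorem exists_quadratic_touching {f β β₁ : ℝ → ℝ} (hf : ContDiff ℝ (⊤ : ℕ∞) f)
    {β₂ σ y ε : ℝ} (hβ : ∀ᶠ z in 𝓝 y, HasDerivAt β (β₁ z) z) (hβ₁ : HasDerivAt β₁ β₂ y)
    (hD : deriv f σ ≠ 0) (hε : 0 < ε) :
    ∃ q₁ q₂, deriv f σ * q₁ = -β₁ y ∧
      deriv f σ * q₂ + deriv (deriv f) σ * q₁ ^ 2 + β₂ = ε ∧
      ∀ᶠ ρ in 𝓝 (0 : ℝ), f σ + β y ≤ f (σ + q₁ * ρ + q₂ / 2 * ρ ^ 2) + β (y + ρ) := by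
  have hdf : Differentiable ℝ f := hf.differentiable (by simp)
  have hdf' : Differentiable ℝ (deriv f) :=
    (hf.iterate_deriv 1).differentiable (by simp)
  set q₁ := -β₁ y / deriv f σ with hq₁
  set q₂ := (ε - β₂ - deriv (deriv f) σ * q₁ ^ 2) / deriv f σ with hq₂
  have e1 : deriv f σ * q₁ = -β₁ y := by rw [hq₁]; field_simp
  have e2 : deriv f σ * q₂ + deriv (deriv f) σ * q₁ ^ 2 + β₂ = ε := by rw [hq₂]; field_simp; ring
  refine ⟨q₁, q₂, e1, e2, ?_⟩
  have hq : ∀ ρ, HasDerivAt (fun ρ => σ + q₁ * ρ + q₂ / 2 * ρ ^ 2) (q₁ + q₂ * ρ) ρ := by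
    intro ρ
    have := (((hasDerivAt_id ρ).const_mul q₁).const_add σ).add ((hasDerivAt_pow 2 ρ).const_mul (q₂ / 2))
    refine this.congr_deriv ?_
    simp
    ring
  have hq' : ∀ ρ, HasDerivAt (fun ρ => q₁ + q₂ * ρ) q₂ ρ := by
    intro ρ
    simpa using ((hasDerivAt_id ρ).const_mul q₂).const_add q₁
  have hadd : Tendsto (fun ρ => y + ρ) (𝓝 0) (𝓝 y) := by
    simpa using (by fun_prop : Continuous fun ρ : ℝ => y + ρ).tendsto 0
  set ψ : ℝ → ℝ := fun ρ => f (σ + q₁ * ρ + q₂ / 2 * ρ ^ 2) + β (y + ρ) with hψ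
  have h1 : ∀ᶠ ρ in 𝓝 (0:ℝ), HasDerivAt ψ
      (deriv f (σ + q₁ * ρ + q₂ / 2 * ρ ^ 2) * (q₁ + q₂ * ρ) + β₁ (y + ρ)) ρ := by
    filter_upwards [hadd.eventually hβ] with ρ hρ
    exact ((hdf _).hasDerivAt.comp ρ (hq ρ)).add (hρ.comp_const_add y ρ)
  have h2 : HasDerivAt (fun ρ => deriv f (σ + q₁ * ρ + q₂ / 2 * ρ ^ 2) * (q₁ + q₂ * ρ)
      + β₁ (y + ρ)) ε 0 := by
    have ha : HasDerivAt (fun ρ => deriv f (σ + q₁ * ρ + q₂ / 2 * ρ ^ 2)) _ 0 :=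
      (hdf' _).hasDerivAt.comp 0 (hq 0)
    have hb : HasDerivAt (fun ρ => β₁ (y + ρ)) β₂ 0 :=
      HasDerivAt.comp_const_add y 0 (by simpa using hβ₁)
    refine ((ha.mul (hq' 0)).add hb).congr_deriv ?_
    simp only [mul_zero, add_zero, ne_eq, OfNat.ofNat_ne_zero, not_false_eq_true, zero_pow]
    linarith
  have h3 : deriv ψ =ᶠ[𝓝 0] _ := h1.mono fun ρ h => h.deriv
  have h4 : deriv (deriv ψ) 0 = ε := by rw [h3.deriv_eq, h2.deriv]
  have h5 : deriv ψ 0 = 0 := by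
    rw [h1.self_of_nhds.deriv]
    simp [e1]
  have := isLocalMin_of_deriv_deriv_pos (h4 ▸ hε) h5 h1.self_of_nhds.continuousAt
  filter_upwards [this] with ρ hρ
  simpa [hψ] using hρ

theorem exists_two_mul_le_sq_deriv {f : ℝ → ℝ} (hf : ContDiff ℝ (⊤ : ℕ∞) f)
    (hmono : ∀ s ∈ Ico (0 : ℝ) 1, 0 < deriv f s) (h1 : deriv f 1 = 0) {L : ℝ}
    (hL : deriv (deriv f) 1 < -L) :
    ∃ a ∈ Ico (0 : ℝ) 1, ∀ s ∈ Icc a 1, 2 * L * (f 1 - f s) ≤ deriv f s ^ 2 := by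
  have hdf : Differentiable ℝ f := hf.differentiable (by simp)
  have hf' : ContDiff ℝ (⊤ : ℕ∞) (deriv f) := hf.iterate_deriv 1
  have hdf' : Differentiable ℝ (deriv f) := hf'.differentiable (by simp)
  have hc : Continuous (deriv (deriv f)) := (hf'.iterate_deriv 1).continuous
  have hev : ∀ᶠ s in 𝓝 (1:ℝ), deriv (deriv f) s < -L := hc.continuousAt.eventually_lt_const hL
  obtain ⟨ε, hε, hs⟩ := Metric.eventually_nhds_iff.1 hev
  refine ⟨max 0 (1 - ε / 2), ⟨le_max_left _ _, max_lt one_pos (by linarith)⟩, ?_⟩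
  have hanti : AntitoneOn (fun s => deriv f s ^ 2 - 2 * L * (f 1 - f s))
      (Icc (max 0 (1 - ε / 2)) 1) := by
    have hd : ∀ s, HasDerivAt (fun s => deriv f s ^ 2 - 2 * L * (f 1 - f s))
        (2 * deriv f s * (deriv (deriv f) s + L)) s := by
      intro s
      have := ((hdf' s).hasDerivAt.pow 2).sub
        (((hdf s).hasDerivAt.const_sub (f 1)).const_mul (2 * L))
      refine this.congr_deriv ?_
      simp
      ring
    refine antitoneOn_of_deriv_nonpos (convex_Icc _ _)
      (fun s _ => (hd s).continuousAt.continuousWithinAt)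
      (fun s _ => (hd s).differentiableAt.differentiableWithinAt) ?_
    intro s h
    rw [interior_Icc] at h
    rw [(hd s).deriv]
    have ha := hmono s ⟨(le_max_left _ _).trans h.1.le, h.2⟩
    have hb := hs (y := s) (by
      rw [Real.dist_eq, abs_lt]
      have := (le_max_right 0 (1 - ε / 2)).trans_lt h.1
      constructor <;> linarith [h.2])
    exact mul_nonpos_of_nonneg_of_nonpos (by linarith) (by linarith)
  intro s h
  have := hanti h (right_mem_Icc.2 (max_lt one_pos (by linarith)).le) h.2
  simp only [h1, sub_self, mul_zero, sub_zero] at this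
  linarith [this]

theorem strictMonoOn_Icc_of_deriv_pos {f : ℝ → ℝ} (hf : Continuous f)
    (hmono : ∀ s ∈ Ico (0 : ℝ) 1, 0 < deriv f s) : StrictMonoOn f (Icc 0 1) := by
  refine strictMonoOn_of_deriv_pos (convex_Icc 0 1) hf.continuousOn fun s hs => ?_
  rw [interior_Icc] at hs
  exact hmono s ⟨hs.1.le, hs.2⟩

theorem IsRadialSolution_s3.not_touching {f : ℝ → ℝ} (hf : ContDiff ℝ (⊤ : ℕ∞) f)
    (hmono : ∀ s ∈ Ico (0 : ℝ) 1, 0 < deriv f s)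
    {r₁ r₂ T : ℝ} (hr₁ : 0 < r₁) {u ur ut : ℝ → ℝ → ℝ}
    (hu : IsRadialSolution_s3 f r₁ r₂ T u ur ut) {L A a k : ℝ} (hL : 0 < L) (hA : 0 < A)
    (hfA : A * r₂ ^ 2 = f 1) (ha : a ∈ Ico (0 : ℝ) 1)
    (hfa : ∀ s ∈ Icc a 1, 2 * L * (f 1 - f s) ≤ deriv f s ^ 2) (hk : k ^ 2 ≤ 2 * L * A)
    {l y r₀ t₀ ε : ℝ} (hy : |y| < l) (hl : l ≤ r₁ / 10) (hr₀ : r₀ ∈ Ioo r₁ r₂)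
    (ht₀ : t₀ ∈ Ioo 0 T) (hσ : ur r₀ t₀ ∈ Ioo a 1) (hB : barrier A l y = f 1 - f (ur r₀ t₀))
    (hε : 0 < ε)
    (touch : ∀ r t, |r - r₀ - k * (t - t₀)| < ε → t₀ - ε < t → t ≤ t₀ → 0 ≤ t →
      ur r t ≤ 1 ∧ barrier A l (y + (r - r₀ - k * (t - t₀))) ≤ f 1 - f (max (ur r t) a)) :
    False := by
  set σ := ur r₀ t₀
  have hl0 : 0 < l := (abs_nonneg y).trans_lt hy
  have hD : 0 < deriv f σ := hmono σ ⟨ha.1.trans hσ.1.le, hσ.2⟩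
  have hsm := strictMonoOn_Icc_of_deriv_pos hf.continuous hmono
  obtain ⟨q₁, q₂, e1, e2, hq⟩ := exists_quadratic_touching (β := barrier A l) hf
    (((continuous_abs.tendsto y).eventually_lt_const hy).mono fun z hz => hasDerivAt_barrier hz)
    (hasDerivAt_barrierDeriv (A := A) hy) hD.ne' (show 0 < A / 100 by positivity)
  have hqt : Tendsto (fun ρ => σ + q₁ * ρ + q₂ / 2 * ρ ^ 2) (𝓝 0) (𝓝 σ) := by
    simpa using (by fun_prop : Continuous fun ρ : ℝ => σ + q₁ * ρ + q₂ / 2 * ρ ^ 2).tendsto 0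
  obtain ⟨η, hη, hηq⟩ := Metric.eventually_nhds_iff.1
    (hq.and ((hqt.eventually_const_lt hσ.1).and (hqt.eventually_lt_const hσ.2)))
  have key := hu.touching_inequality (k := k) (q₁ := q₁) (q₂ := q₂) hf hr₁ hr₀ ht₀ hD
    (ε := min (min ε η / (2 * (1 + |k|))) (min ε t₀))
    (by have := ht₀.1; positivity) (by
      intro r t hr ht htt
      have hk0 := abs_nonneg k
      set e := min (min ε η / (2 * (1 + |k|))) (min ε t₀) with he
      have he1 : e * (2 * (1 + |k|)) ≤ min ε η := by
        rw [← le_div_iff₀ (by positivity)]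
        exact min_le_left _ _
      have he2 : e ≤ ε := (min_le_right _ _).trans (min_le_left _ _)
      have he3 : e ≤ t₀ := (min_le_right _ _).trans (min_le_right _ _)
      have he0 : 0 < e := by linarith
      have hρ : |r - r₀ - k * (t - t₀)| < min ε η := by
        refine lt_of_lt_of_le ?_ he1
        have h1 : |k * (t - t₀)| ≤ |k| * e := by
          rw [abs_mul]
          gcongr
          rw [abs_le]; constructor <;> linarith
        have h2 := abs_sub (r - r₀) (k * (t - t₀))
        nlinarith
      set ρ := r - r₀ - k * (t - t₀)
      obtain ⟨hle, htouch⟩ := touch r t (hρ.trans_le (min_le_left _ _)) (by linarith) htt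
        (by linarith)
      obtain ⟨g1, g2, g3⟩ := hηq (y := ρ) (by
        rw [Real.dist_eq, sub_zero]; exact hρ.trans_le (min_le_right _ _))
      by_contra! hcon
      have hmax : max (ur r t) a = ur r t := max_eq_left (by linarith)
      rw [hmax] at htouch
      have := hsm ⟨by linarith [ha.1], g3.le⟩ ⟨by linarith [ha.1], hle⟩ hcon
      linarith)
  have hr0 : 0 < r₀ := hr₁.trans hr₀.1
  have hXpos : 0 < l ^ 2 - y ^ 2 := sub_pos.2 (sq_lt_sq' (by linarith [neg_lt_of_abs_lt hy])
    (lt_of_abs_lt hy))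
  have hs0 : 0 < √(l ^ 2 - y ^ 2) := Real.sqrt_pos.2 hXpos
  have hsl : √(l ^ 2 - y ^ 2) ≤ l := Real.sqrt_le_iff.2 ⟨hl0.le, by nlinarith [sq_nonneg y]⟩
  have hDB := hfa σ ⟨hσ.1.le, hσ.2.le⟩
  rw [← hB] at hDB
  refine absurd (neg_mul_barrierDeriv_lt (Q := A * (-2 / 10000 - 6 / 100 * (√(l ^ 2 - y ^ 2) / l) +
      3 / 100 / (√(l ^ 2 - y ^ 2) / l)) - A / 100 + barrierDeriv A l y / r₀ + f σ / r₀ ^ 2)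
      hA hL hy hD hDB hk ?_) (not_lt.2 ?_)
  · have hb1 : -(A / 100) ≤ barrierDeriv A l y / r₀ := by
      rw [le_div_iff₀ hr0]
      unfold barrierDeriv
      have hξ : √(l ^ 2 - y ^ 2) / l ≤ 1 := (div_le_one hl0).2 hsl
      have hξ0 : 0 < √(l ^ 2 - y ^ 2) / l := by positivity
      generalize √(l ^ 2 - y ^ 2) / l = ξ at hξ hξ0
      have hyl : y ≤ l := (le_abs_self y).trans hy.le
      have h1 : y * (1 / 10000 + 3 / 200 * ξ) ≤ l * (1 / 50) :=
        (mul_le_mul_of_nonneg_right hyl (by positivity)).trans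
          (mul_le_mul_of_nonneg_left (by linarith) hl0.le)
      have h2 : l ≤ r₀ / 10 := by linarith [hr₀.1]
      have h3 : 0 ≤ A * (r₀ / 100 - 2 * (y * (1 / 10000 + 3 / 200 * ξ))) :=
        mul_nonneg hA.le (by linarith)
      linarith
    have hb2 : A * (99 / 100) ≤ f σ / r₀ ^ 2 := by
      rw [le_div_iff₀ (by positivity), show f σ = f 1 - barrier A l y by linarith, ← hfA]
      have h1 := barrier_le hA hl0 hy.le
      have h2 : l ^ 2 ≤ (r₀ / 10) ^ 2 := pow_le_pow_left₀ hl0.le (by linarith [hr₀.1]) 2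
      have h3 : r₀ ^ 2 ≤ r₂ ^ 2 := pow_le_pow_left₀ hr0.le hr₀.2.le 2
      nlinarith
    have hξ : √(l ^ 2 - y ^ 2) / l ≤ 1 := (div_le_one hl0).2 hsl
    generalize √(l ^ 2 - y ^ 2) / l = ξ at hξ
    nlinarith
  · rw [show deriv f σ * q₁ / r₀ = -(barrierDeriv A l y / r₀) by rw [e1]; ring] at key
    calc _ ≤ deriv f σ * (k * q₁) := mul_le_mul_of_nonneg_left (by linarith) hD.le
      _ = -k * barrierDeriv A l y := by linear_combination k * e1

theorem IsRadialSolution_s3.lt_one_of_line {f : ℝ → ℝ} (hf : ContDiff ℝ (⊤ : ℕ∞) f) (hf0 : f 0 = 0)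
    (hmono : ∀ s ∈ Ico (0 : ℝ) 1, 0 < deriv f s) (h1 : deriv f 1 = 0)
    (h2 : deriv (deriv f) 1 < 0) {r₁ r₂ T : ℝ} (hr₁ : 0 < r₁) {u ur ut : ℝ → ℝ → ℝ}
    (hu : IsRadialSolution_s3 f r₁ r₂ T u ur ut) {r₀ k t₁ : ℝ} (hr₀ : r₀ ∈ Ioo r₁ r₂)
    (ht₁ : t₁ ∈ Ioo 0 T) (he : r₀ + k * t₁ ∈ Ioo r₁ r₂)
    (hk : k ^ 2 * r₂ ^ 2 < 2 * f 1 * -deriv (deriv f) 1) (hinit : ur r₀ 0 < 1) :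
    ur (r₀ + k * t₁) t₁ < 1 := by
  have hr₂ : 0 < r₂ := hr₁.trans (hr₀.1.trans hr₀.2)
  have hsm := strictMonoOn_Icc_of_deriv_pos hf.continuous hmono
  have hf1 : 0 < f 1 := hf0 ▸ hsm (by simp) (by simp) one_pos
  obtain ⟨A, hA, hfA⟩ : ∃ A > 0, A * r₂ ^ 2 = f 1 := ⟨f 1 / r₂ ^ 2, by positivity, by field_simp⟩
  obtain ⟨L, hL, hkL, hL2⟩ : ∃ L > 0, k ^ 2 ≤ 2 * L * A ∧ deriv (deriv f) 1 < -L := by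
    have h3 : k ^ 2 < 2 * A * -deriv (deriv f) 1 := by
      rw [← hfA] at hk
      have : 0 < r₂ ^ 2 := by positivity
      nlinarith
    refine ⟨(k ^ 2 / (2 * A) + -deriv (deriv f) 1) / 2, ?_, ?_, ?_⟩
    · have : 0 ≤ k ^ 2 / (2 * A) := by positivity
      linarith
    · have : k ^ 2 / (2 * A) * (2 * A) = k ^ 2 := by field_simp
      nlinarith
    · have : k ^ 2 / (2 * A) < -deriv (deriv f) 1 := by
        rw [div_lt_iff₀ (by positivity)]
        linarith
      linarith
  obtain ⟨a, ha, hfa⟩ := exists_two_mul_le_sq_deriv hf hmono h1 hL2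
  set w : ℝ → ℝ := fun s => f 1 - f (max s a) with hw
  have hwc : Continuous w := by
    have := hf.continuous
    fun_prop
  have hw1 : w 1 = 0 := by simp [hw, max_eq_left ha.2.le]
  have hwpos : ∀ s < 1, 0 < w s := fun s hs =>
    sub_pos.2 (hsm ⟨ha.1.trans (le_max_right _ _), (max_lt hs ha.2).le⟩ (by simp) (max_lt hs ha.2))
  have hwa : 0 < w a := hwpos a ha.2
  have hline : ∀ t ∈ Icc 0 t₁, min r₀ (r₀ + k * t₁) ≤ r₀ + k * t ∧
      r₀ + k * t ≤ max r₀ (r₀ + k * t₁) := by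
    intro t ht
    rcases le_total 0 k with h | h
    · exact ⟨(min_le_left _ _).trans (by nlinarith [ht.1]),
        le_trans (by nlinarith [ht.2]) (le_max_right _ _)⟩
    · exact ⟨(min_le_right _ _).trans (by nlinarith [ht.2]),
        le_trans (by nlinarith [ht.1]) (le_max_left _ _)⟩
  have ht₁' : ∀ t ∈ Icc 0 t₁, t ∈ Ico 0 T := fun t ht => ⟨ht.1, ht.2.trans_lt ht₁.2⟩
  have hμ := hwpos _ hinit
  obtain ⟨ε₁, hε₁, hinit'⟩ : ∃ ε > 0, ∀ y, |y| < ε → ur (r₀ + y) 0 < 1 ∧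
      w (ur r₀ 0) / 2 < w (ur (r₀ + y) 0) := by
    have hc : ContinuousAt (fun y => ur (r₀ + y) 0) 0 := by
      have h3 : ContinuousOn (fun r => ur r 0) (Ioo r₁ r₂) :=
        hu.continuousOn_space.comp (f := fun r : ℝ => (r, (0 : ℝ)))
          (by fun_prop : Continuous _).continuousOn fun r hr =>
            ⟨hr, ht₁' 0 ⟨le_rfl, ht₁.1.le⟩⟩
      have h4 : ContinuousAt (fun r => ur r 0) (r₀ + 0) := by
        rw [add_zero]; exact h3.continuousAt (Ioo_mem_nhds hr₀.1 hr₀.2)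
      exact h4.comp (f := fun y => r₀ + y) (by fun_prop)
    have h5 : ContinuousAt (fun y => w (ur (r₀ + y) 0)) 0 := hwc.continuousAt.comp hc
    obtain ⟨ε, hε, h⟩ := Metric.eventually_nhds_iff.1
      ((hc.eventually_lt_const (by simpa using hinit)).and
        (h5.eventually_const_lt (show w (ur r₀ 0) / 2 < w (ur (r₀ + 0) 0) by simpa using hμ)))
    exact ⟨ε, hε, fun y hy => h (by simpa [Real.dist_eq] using hy)⟩
  obtain ⟨δ, hδ, hδε, hδ1, hδ2, hδr, hδμ, hδa⟩ : ∃ δ > 0, δ < ε₁ ∧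
      r₁ < min r₀ (r₀ + k * t₁) - δ ∧ max r₀ (r₀ + k * t₁) + δ < r₂ ∧ δ < r₁ / 10 ∧
      A / 50 * δ ^ 2 < w (ur r₀ 0) / 2 ∧ A / 50 * δ ^ 2 < w a := by
    have hsq : Tendsto (fun δ : ℝ => A / 50 * δ ^ 2) (𝓝[>] 0) (𝓝 0) := by
      have : Tendsto (fun δ : ℝ => A / 50 * δ ^ 2) (𝓝 0) (𝓝 (A / 50 * 0 ^ 2)) :=
        (by fun_prop : Continuous fun δ : ℝ => A / 50 * δ ^ 2).tendsto 0
      exact (by simpa using this : Tendsto (fun δ : ℝ => A / 50 * δ ^ 2) (𝓝 0) (𝓝 0)).mono_left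
        nhdsWithin_le_nhds
    have hlt : ∀ x > 0, ∀ᶠ δ : ℝ in 𝓝[>] 0, δ < x := fun x hx =>
      nhdsWithin_le_nhds (eventually_lt_nhds hx)
    have hmin : r₁ < min r₀ (r₀ + k * t₁) := lt_min hr₀.1 he.1
    have hmax : max r₀ (r₀ + k * t₁) < r₂ := max_lt hr₀.2 he.2
    obtain ⟨δ, g0, g1, g2, g3, g4, g5, g6⟩ := ((eventually_mem_nhdsWithin (s := Ioi (0 : ℝ))).and
      ((hlt _ hε₁).and ((hlt _ (sub_pos.2 hmin)).and ((hlt _ (sub_pos.2 hmax)).and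
      ((hlt (r₁ / 10) (by positivity)).and
      ((hsq.eventually_lt_const (half_pos hμ)).and (hsq.eventually_lt_const hwa))))))).exists
    exact ⟨δ, g0, g1, by linarith, by linarith, g4, g5, g6⟩
  have htube : ∀ y t, |y| ≤ δ → t ∈ Icc 0 t₁ → r₀ + k * t + y ∈ Ioo r₁ r₂ := by
    intro y t hy ht
    have := hline t ht
    have := abs_le.1 hy
    constructor <;> linarith
  obtain ⟨σ, hσc, hσ⟩ : ∃ σ : ℝ → ℝ → ℝ, Continuous (fun p : ℝ × ℝ => σ p.1 p.2) ∧
      ∀ y t, |y| ≤ δ → t ∈ Icc 0 t₁ → σ y t = ur (r₀ + k * t + y) t := by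
    refine ⟨fun y t => ur (r₀ + k * max 0 (min t t₁) + max (-δ) (min y δ)) (max 0 (min t t₁)),
      ?_, ?_⟩
    · refine hu.continuousOn_space.comp_continuous (f := fun p : ℝ × ℝ =>
        (r₀ + k * max 0 (min p.2 t₁) + max (-δ) (min p.1 δ), max 0 (min p.2 t₁)))
        (by fun_prop) fun p => ?_
      have hm : max 0 (min p.2 t₁) ∈ Icc 0 t₁ :=
        ⟨le_max_left _ _, max_le ht₁.1.le (min_le_right _ _)⟩
      exact ⟨htube _ _ (abs_le.2 ⟨le_max_left _ _, max_le (by linarith) (min_le_right _ _)⟩) hm,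
        ht₁' _ hm⟩
    · intro y t hy ht
      have := abs_le.1 hy
      simp only [min_eq_left ht.2, max_eq_right ht.1, min_eq_left this.2, max_eq_right this.1]
  by_contra! hcon
  have hσ0 : Continuous fun t => σ 0 t := hσc.comp (by fun_prop : Continuous fun t : ℝ => ((0:ℝ), t))
  obtain ⟨t₂, ⟨ht₂, ht₂σ⟩, hfirst⟩ : ∃ t, (t ∈ Icc 0 t₁ ∧ 1 ≤ σ 0 t) ∧
      ∀ s ∈ Ico 0 t, σ 0 s < 1 := by
    have hcomp : IsCompact (Icc 0 t₁ ∩ {t | 1 ≤ σ 0 t}) :=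
      isCompact_Icc.inter_right (isClosed_le continuous_const hσ0)
    obtain ⟨t, ht, hmin⟩ := hcomp.exists_isMinOn (f := fun t => t) ⟨t₁, ⟨ht₁.1.le, le_rfl⟩, by
      rw [mem_ofPred_eq, hσ 0 t₁ (by simpa using hδ.le) ⟨ht₁.1.le, le_rfl⟩, add_zero]
      exact hcon⟩ continuousOn_id
    refine ⟨t, ⟨ht.1, ht.2⟩, fun s hs => ?_⟩
    by_contra! h
    have : t ≤ s := hmin ⟨⟨hs.1, hs.2.le.trans ht.1.2⟩, h⟩
    linarith [hs.2]
  have h0 : σ 0 0 < 1 := by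
    rw [hσ 0 0 (by simpa using hδ.le) ⟨le_rfl, ht₁.1.le⟩]
    simpa using hinit
  have ht₂0 : 0 < t₂ := lt_of_le_of_ne ht₂.1 (by rintro rfl; linarith)
  have hbar : ∀ θ ∈ Ico 0 t₂, barrier A (δ / 2) 0 ≤ w (σ 0 θ) := by
    intro θ hθ
    have hsub : ∀ t ∈ Icc 0 θ, t ∈ Icc 0 t₁ := fun t ht =>
      ⟨ht.1, ht.2.trans (hθ.2.le.trans ht₂.2)⟩
    have hsub' : ∀ t ∈ Ioc 0 θ, t ∈ Icc 0 t₁ := fun t ht => hsub t ⟨ht.1.le, ht.2⟩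
    refine barrier_le_of_no_touching (c := A / 10000) (C := A / 50) hσc hwc hw1 hwpos hδ
      (by positivity) (continuousOn_barrier A) (fun l y _ h => barrier_eq_zero h)
      (fun l y hl h => le_barrier hA hl h) (fun l y hl h => barrier_le hA hl h)
      (fun t ht => hfirst t ⟨ht.1, ht.2.trans_lt hθ.2⟩) ?_ ?_ ?_ ⟨hθ.1, le_rfl⟩
    · intro y hy
      have hin := hinit' y (hy.trans_lt hδε)
      rw [hσ y 0 hy ⟨le_rfl, ht₁.1.le⟩, mul_zero, add_zero]
      refine ⟨hin.1, fun l hl hlδ hyl => ?_⟩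
      have h3 := barrier_le hA hl hyl
      have h4 : A / 50 * l ^ 2 ≤ A / 50 * δ ^ 2 := by gcongr
      linarith [hin.2]
    · intro y t hy ht hσ1
      have htI := hsub' t ht
      rw [hσ y t hy.le htI] at hσ1
      have hr := htube y t hy.le htI
      have hflux := hu.hasDerivAt_flux _ t hr (ht₁' t htI)
      have hcont : ContinuousAt (fun ρ => ur ρ t) (r₀ + k * t + y) := by
        have h3 : ContinuousOn (fun r => ur r t) (Ioo r₁ r₂) :=
          hu.continuousOn_space.comp (f := fun r : ℝ => (r, t))
            (by fun_prop : Continuous _).continuousOn fun r hr => ⟨hr, ht₁' t htI⟩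
        exact h3.continuousAt (Ioo_mem_nhds hr.1 hr.2)
      have hlm : IsLocalMax f 1 := isLocalMax_of_deriv_deriv_neg h2 h1 hf.continuous.continuousAt
      have hlm2 : IsLocalMax (fun ρ => f (ur ρ t)) (r₀ + k * t + y) := by
        have h3 : ∀ᶠ ρ in 𝓝 (r₀ + k * t + y), f (ur ρ t) ≤ f 1 :=
          hcont.eventually (p := fun s => f s ≤ f 1) (by simp only [hσ1]; exact hlm)
        filter_upwards [h3] with ρ hρ
        rwa [hσ1]
      rw [hlm2.hasDerivAt_eq_zero hflux] at hflux
      have hd := (hflux.comp_const_add (r₀ + k * t) y).const_sub (f 1)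
      rw [neg_zero] at hd
      refine hd.congr_of_eventuallyEq ?_
      have hcont2 : ContinuousAt (fun y => ur (r₀ + k * t + y) t) y :=
        hcont.comp (f := fun y => r₀ + k * t + y) (by fun_prop)
      filter_upwards [hcont2.eventually_const_lt (u := a) (by simpa only [hσ1] using ha.2),
        (continuous_abs.tendsto y).eventually_lt_const hy] with z hz1 hz2
      rw [hσ z t hz2.le htI]
      simp only [hw, max_eq_left hz1.le]
    · intro l y t ε hl hyl ht hσ1 hwB hε htouch
      have htI := hsub' t ht
      have hyδ : |y| < δ := hyl.trans hl.2
      have hBl : barrier A l y < w a := by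
        have h3 := barrier_le hA hl.1 hyl.le
        have h4 : A / 50 * l ^ 2 ≤ A / 50 * δ ^ 2 := by
          have := hl.1; have := hl.2.le; gcongr
        linarith
      have hσa : a < σ y t := by
        by_contra! h
        have : w (σ y t) = w a := by simp [hw, max_eq_right h]
        linarith
      have hwσ : w (σ y t) = f 1 - f (σ y t) := by simp only [hw, max_eq_left hσa.le]
      rw [hσ y t hyδ.le htI] at hσ1 hσa hwσ hwB
      refine hu.not_touching hf hmono hr₁ hL hA hfA ha hfa hkL hyl
        (hl.2.le.trans hδr.le) (htube y t hyδ.le htI) ⟨ht.1, (ht₁' t htI).2⟩ ⟨hσa, hσ1⟩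
        (by rw [← hwσ, hwB]) (ε := min ε (δ - |y|)) (lt_min hε (by linarith)) ?_
      intro r s hr hs hst hs0
      set z := y + (r - (r₀ + k * t + y) - k * (s - t)) with hz
      have hzy : z - y = r - (r₀ + k * t + y) - k * (s - t) := by rw [hz]; ring
      rw [← hzy] at hr
      have hzδ : |z| ≤ δ := by
        have h3 := abs_sub_abs_le_abs_sub z y
        have h4 := hr.trans_le (min_le_right _ _)
        linarith
      have hsI : s ∈ Icc 0 t₁ := ⟨hs0, hst.trans htI.2⟩
      have hrz : r = r₀ + k * s + z := by rw [hz]; ring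
      have := htouch z s (hr.trans_le (min_le_left _ _))
        (by linarith [min_le_left ε (δ - |y|)]) hst hs0
      rw [hσ z s hzδ hsI, ← hrz] at this
      exact this
  have hlim1 : σ 0 t₂ ≤ 1 := by
    refine le_of_tendsto (hσ0.continuousWithinAt (s := Iio t₂)) ?_
    filter_upwards [Ioo_mem_nhdsLT ht₂0] with s hs using (hfirst s ⟨hs.1.le, hs.2⟩).le
  have hlim2 : barrier A (δ / 2) 0 ≤ w (σ 0 t₂) := by
    refine ge_of_tendsto ((hwc.comp hσ0).continuousWithinAt (s := Iio t₂)) ?_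
    filter_upwards [Ioo_mem_nhdsLT ht₂0] with s hs using hbar s ⟨hs.1.le, hs.2⟩
  have hpos := le_barrier (y := 0) hA (half_pos hδ) (by simpa using (half_pos hδ).le)
  rw [le_antisymm hlim1 ht₂σ, hw1] at hlim2
  have : 0 < A / 10000 * ((δ / 2) ^ 2 - 0 ^ 2) := by
    rw [zero_pow two_ne_zero, sub_zero]; positivity
  linarith

theorem IsRadialSolution_s3.neg {f : ℝ → ℝ} (hf : ∀ s, f (-s) = -f s) {r₁ r₂ T : ℝ}
    {u ur ut : ℝ → ℝ → ℝ} (hu : IsRadialSolution_s3 f r₁ r₂ T u ur ut) :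
    IsRadialSolution_s3 f r₁ r₂ T (fun r t => -u r t) (fun r t => -ur r t) (fun r t => -ut r t) where
  hasDerivAt_space r t hr ht := (hu.hasDerivAt_space r t hr ht).neg
  hasDerivWithinAt_time r t hr ht := (hu.hasDerivWithinAt_time r t hr ht).neg
  continuousOn := hu.continuousOn.neg
  continuousOn_space := hu.continuousOn_space.neg
  continuousOn_time := hu.continuousOn_time.neg
  hasDerivAt_flux r t hr ht := by
    simp only [hf]
    exact (hu.hasDerivAt_flux r t hr ht).neg.congr_deriv (by ring)

/-- For a radial `C¹` solution of `u_t = (φ'(u_r))_r + φ'(u_r)/r` (dimension `n = 2`)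
on `(r₁,r₂)×[0,T)` whose initial datum is subcritical on some nonempty `(r₃,r₄)`,
the subcritical region covers the whole domain `(r₁,r₂)` after the time
`(r₂-r₁)/k₀`, where `k₀ = r₂⁻¹ √(2 φ'(1) |φ'''(1)|)` depends only on `r₁`, `r₂`, `φ`. -/
theorem subcritical_region_covers_domain_radial
    (φ : ℝ → ℝ) (hφ : ContDiff ℝ (⊤ : ℕ∞) φ) (hφeven : ∀ σ : ℝ, φ (-σ) = φ σ)
    (hφ2pos : ∀ σ : ℝ, 0 ≤ σ → σ < 1 → 0 < deriv (deriv φ) σ)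
    (hφ2one : deriv (deriv φ) 1 = 0)
    (hφ2neg : ∀ σ : ℝ, 1 < σ → deriv (deriv φ) σ < 0)
    (hφ3neg : deriv (deriv (deriv φ)) 1 < 0)
    (r₁ r₂ r₃ r₄ T : ℝ)
    (hr₁ : 0 < r₁) (h13 : r₁ ≤ r₃) (h34 : r₃ < r₄) (h42 : r₄ ≤ r₂) (hT : 0 < T)
    (u ur ut : ℝ → ℝ → ℝ)
    -- `u` is of class `C¹` on `(r₁,r₂)×[0,T)`: the partial derivatives exist ...
    (hur : ∀ r t : ℝ, r ∈ Set.Ioo r₁ r₂ → t ∈ Set.Ico 0 T →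
      HasDerivAt (fun ρ => u ρ t) (ur r t) r)
    (hut : ∀ r t : ℝ, r ∈ Set.Ioo r₁ r₂ → t ∈ Set.Ico 0 T →
      HasDerivWithinAt (fun s => u r s) (ut r t) (Set.Ico 0 T) t)
    -- ... and `u`, `u_r`, `u_t` are continuous on `(r₁,r₂)×[0,T)`
    (huC : ContinuousOn (fun p : ℝ × ℝ => u p.1 p.2) (Set.Ioo r₁ r₂ ×ˢ Set.Ico 0 T))
    (hurC : ContinuousOn (fun p : ℝ × ℝ => ur p.1 p.2) (Set.Ioo r₁ r₂ ×ˢ Set.Ico 0 T))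
    (hutC : ContinuousOn (fun p : ℝ × ℝ => ut p.1 p.2) (Set.Ioo r₁ r₂ ×ˢ Set.Ico 0 T))
    -- the radial equation `u_t = (φ'(u_r))_r + φ'(u_r)/r`: the map
    -- `r ↦ φ'(u_r(r,t))` is differentiable with derivative `u_t(r,t) - φ'(u_r(r,t))/r`
    (heq : ∀ r t : ℝ, r ∈ Set.Ioo r₁ r₂ → t ∈ Set.Ico 0 T →
      HasDerivAt (fun ρ => deriv φ (ur ρ t)) (ut r t - deriv φ (ur r t) / r) r)
    -- the initial datum is subcritical on `(r₃,r₄)`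
    (hinit : ∀ r ∈ Set.Ioo r₃ r₄, |ur r 0| < 1) :
    ∀ t : ℝ, t ∈ Set.Ico 0 T →
      (r₂ - r₁) / (Real.sqrt (2 * deriv φ 1 * |deriv (deriv (deriv φ)) 1|) / r₂) < t →
      ∀ r ∈ Set.Ioo r₁ r₂, |ur r t| < 1 := by
  intro t ht hkt r hr
  have hsol : IsRadialSolution_s3 (deriv φ) r₁ r₂ T u ur ut := ⟨hur, hut, huC, hurC, hutC, heq⟩
  have hf : ContDiff ℝ (⊤ : ℕ∞) (deriv φ) := hφ.iterate_deriv 1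
  have hmono : ∀ s ∈ Ico (0 : ℝ) 1, 0 < deriv (deriv φ) s := fun s hs => hφ2pos s hs.1 hs.2
  have hodd : ∀ s, deriv φ (-s) = -deriv φ s := by
    intro s
    have h := deriv_comp_neg φ s
    rw [funext hφeven] at h
    linarith
  have hf0 : deriv φ 0 = 0 := by
    have := hodd 0
    rw [neg_zero] at this
    linarith
  have hf1 : 0 < deriv φ 1 :=
    hf0 ▸ strictMonoOn_Icc_of_deriv_pos hf.continuous hmono (by simp) (by simp) one_pos
  have hr₂ : 0 < r₂ := hr₁.trans (hr.1.trans hr.2)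
  rw [abs_of_neg hφ3neg] at hkt
  have hM : 0 < 2 * deriv φ 1 * -deriv (deriv (deriv φ)) 1 :=
    mul_pos (by positivity) (neg_pos.2 hφ3neg)
  set M := 2 * deriv φ 1 * -deriv (deriv (deriv φ)) 1
  have hsM : 0 < √M := Real.sqrt_pos.2 hM
  rw [div_lt_iff₀ (by positivity)] at hkt
  have ht0 : 0 < t := by
    by_contra! h
    have : t * (√M / r₂) ≤ 0 := mul_nonpos_of_nonpos_of_nonneg h (by positivity)
    linarith [hr.1, hr.2]
  obtain ⟨r₀, hr₀⟩ := exists_between h34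
  have hr₀' : r₀ ∈ Ioo r₁ r₂ := ⟨h13.trans_lt hr₀.1, hr₀.2.trans_le h42⟩
  obtain ⟨k, hk⟩ : ∃ k, r = r₀ + k * t := ⟨(r - r₀) / t, by field_simp; ring⟩
  have hkM : k ^ 2 * r₂ ^ 2 < M := by
    have h1 : |k| * t < r₂ - r₁ := by
      rw [← abs_of_pos ht0, ← abs_mul, show k * t = r - r₀ by linarith, abs_lt]
      constructor <;> linarith [hr.1, hr.2, hr₀'.1, hr₀'.2]
    have h2 : |k| < √M / r₂ := by nlinarith
    rw [lt_div_iff₀ hr₂] at h2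
    have h3 : (|k| * r₂) ^ 2 < √M ^ 2 := pow_lt_pow_left₀ h2 (by positivity) two_ne_zero
    rwa [Real.sq_sqrt hM.le, mul_pow, sq_abs] at h3
  have h0 := abs_lt.1 (hinit r₀ hr₀)
  subst hk
  have hup := hsol.lt_one_of_line hf hf0 hmono hφ2one hφ3neg hr₁ hr₀' ⟨ht0, ht.2⟩ hr hkM h0.2
  have hdown := (hsol.neg hodd).lt_one_of_line hf hf0 hmono hφ2one hφ3neg hr₁ hr₀' ⟨ht0, ht.2⟩ hr
    hkM (by linarith [h0.1])
  exact abs_lt.2 ⟨by linarith, hup⟩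
end
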